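/- Let 𝔥 be a complex Hilbert space of dimension not equal to two. The map d ↦ Q, where Q(x,y) = D(x,y*) and D is the unique bounded bilinear extension of d, is a one-to-one correspondence between bounded decoherence functionals d for 𝔥 and bounded sesquilinear Hermitian forms Q on B(𝔥) satisfying Q(1,1) = 1 and Q(p,p) ≥ 0 for every projection p on 𝔥. -/

import Mathlib

/- Common background definitions: decoherence functionals on the projection
lattice of a complex Hilbert space, boundedness/additivity notions, trace class
operators, and an axiomatisation of the Hilbert space tensor product
`𝔥 ⊗ 𝔥` together with the operator tensor product. -/

noncomputable section

open scoped ComplexInnerProductSpace ComplexOrder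
open ContinuousLinearMap

universe u

variable {E : Type u} [NormedAddCommGroup E] [InnerProductSpace ℂ E] [CompleteSpace E]
variable {G : Type u} [NormedAddCommGroup G] [InnerProductSpace ℂ G] [CompleteSpace G]

/-- `p` is an orthogonal projection on a Hilbert space. -/
def IsOrthoProj (p : E →L[ℂ] E) : Prop :=
  IsIdempotentElem p ∧ IsSelfAdjoint p

/-- `p` is an operator of finite rank. -/
def HasFiniteRank (p : E →L[ℂ] E) : Prop :=
  FiniteDimensional ℂ ↥(LinearMap.range (p : E →ₗ[ℂ] E))

/-- A decoherence functional on the lattice of projections `P(𝔥)`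
(modelled as a function on all pairs of bounded operators whose defining
properties refer only to its values at pairs of orthogonal projections). -/
structure IsDecoherenceFunctional (d : (E →L[ℂ] E) → (E →L[ℂ] E) → ℂ) : Prop where
  hermitian : ∀ p q, IsOrthoProj p → IsOrthoProj q → d p q = starRingEnd ℂ (d q p)
  pos : ∀ p, IsOrthoProj p → 0 ≤ d p p
  normalized : d 1 1 = 1
  orthoadd : ∀ p₁ p₂ q, IsOrthoProj p₁ → IsOrthoProj p₂ → IsOrthoProj q →
    p₁ * p₂ = 0 → d (p₁ + p₂) q = d p₁ q + d p₂ q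

/-- A decoherence functional is bounded if `{|d(p,q)|}` is a bounded set. -/
def DFBounded (d : (E →L[ℂ] E) → (E →L[ℂ] E) → ℂ) : Prop :=
  ∃ C : ℝ, ∀ p q, IsOrthoProj p → IsOrthoProj q → ‖d p q‖ ≤ C

/-- Countable additivity of a decoherence functional: for every countable
pairwise orthogonal family of projections summing (strongly) to `P`,
`d (P, q) = ∑ d (pᵢ, q)`. -/
def DFCountablyAdditive (d : (E →L[ℂ] E) → (E →L[ℂ] E) → ℂ) : Prop :=
  ∀ (p : ℕ → E →L[ℂ] E) (P q : E →L[ℂ] E),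
    (∀ i, IsOrthoProj (p i)) → IsOrthoProj P → IsOrthoProj q →
    (∀ i j, i ≠ j → p i * p j = 0) →
    (∀ x : E, HasSum (fun i => p i x) (P x)) →
    HasSum (fun i => d (p i) q) (d P q)

/-- Complete additivity of a decoherence functional. -/
def DFCompletelyAdditive (d : (E →L[ℂ] E) → (E →L[ℂ] E) → ℂ) : Prop :=
  ∀ (ι : Type u) (p : ι → E →L[ℂ] E) (P q : E →L[ℂ] E),
    (∀ i, IsOrthoProj (p i)) → IsOrthoProj P → IsOrthoProj q →
    (∀ i j, i ≠ j → p i * p j = 0) →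
    (∀ x : E, HasSum (fun i => p i x) (P x)) →
    HasSum (fun i => d (p i) q) (d P q)

/-- A bilinear form `D` on `B(𝔥) × B(𝔥)` is bounded. -/
def IsBoundedBilinear (D : (E →L[ℂ] E) →ₗ[ℂ] (E →L[ℂ] E) →ₗ[ℂ] ℂ) : Prop :=
  ∃ C : ℝ, ∀ x y : E →L[ℂ] E, ‖D x y‖ ≤ C * ‖x‖ * ‖y‖

/-- The bilinear form `D` extends the decoherence functional `d`. -/
def ExtendsDF (D : (E →L[ℂ] E) →ₗ[ℂ] (E →L[ℂ] E) →ₗ[ℂ] ℂ)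
    (d : (E →L[ℂ] E) → (E →L[ℂ] E) → ℂ) : Prop :=
  ∀ p q, IsOrthoProj p → IsOrthoProj q → D p q = d p q

/-- `T` is a trace class operator (via the standard characterisation: the sums
`∑ |⟪eᵢ, T fᵢ⟫|` over finite orthonormal families are uniformly bounded). -/
def IsTraceClass (T : E →L[ℂ] E) : Prop :=
  ∃ C : ℝ, ∀ (n : ℕ) (e f : Fin n → E), Orthonormal ℂ e → Orthonormal ℂ f →
    ∑ i, ‖⟪e i, T (f i)⟫‖ ≤ C

/-- The trace of an operator computed in the Hilbert basis `b` (for a trace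
class operator this is basis independent and is the usual trace). -/
def traceAlong {ι : Type*} (b : HilbertBasis ι ℂ E) (T : E →L[ℂ] E) : ℂ :=
  ∑' i, ⟪b i, T (b i)⟫

/-- The rank one orthogonal projection `p_ξ` onto the span of a unit vector `ξ`. -/
def rankOneProj (ξ : E) : E →L[ℂ] E :=
  (innerSL ℂ ξ).smulRight ξ

/-- An axiomatisation of the Hilbert space tensor product `G = E ⊗ E`:
a bilinear map `tmul` into `G` multiplying inner products and having dense span. -/
structure HilbertTensorProduct (E G : Type u) [NormedAddCommGroup E]
    [InnerProductSpace ℂ E] [NormedAddCommGroup G] [InnerProductSpace ℂ G] :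
    Type u where
  tmul : E →ₗ[ℂ] E →ₗ[ℂ] G
  inner_tmul : ∀ a b c d : E, ⟪tmul a b, tmul c d⟫ = ⟪a, c⟫ * ⟪b, d⟫
  dense_span : Dense (↑(Submodule.span ℂ (Set.range fun z : E × E => tmul z.1 z.2)) : Set G)

/-- The algebraic tensor product `E ⊗_alg E`, viewed as a (dense) subspace of `G`. -/
def HilbertTensorProduct.algSpan (J : HilbertTensorProduct E G) : Submodule ℂ G :=
  Submodule.span ℂ (Set.range fun z : E × E => J.tmul z.1 z.2)

/-- The Hilbert space tensor product together with the operator tensor product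
`(x, y) ↦ x ⊗ y` on bounded operators. -/
structure OperatorTensor (E G : Type u) [NormedAddCommGroup E]
    [InnerProductSpace ℂ E] [NormedAddCommGroup G] [InnerProductSpace ℂ G]
    extends HilbertTensorProduct E G where
  op : (E →L[ℂ] E) → (E →L[ℂ] E) → (G →L[ℂ] G)
  op_tmul : ∀ (x y : E →L[ℂ] E) (a b : E), op x y (tmul a b) = tmul (x a) (y b)

/-- The algebraic tensor product `K(𝔥) • K(𝔥)`: the span in `B(G)` of the
operators `x ⊗ y` with `x, y` compact. -/
def OperatorTensor.compactSpan (J : OperatorTensor E G) : Submodule ℂ (G →L[ℂ] G) :=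
  Submodule.span ℂ {T | ∃ x y : E →L[ℂ] E,
    IsCompactOperator (⇑x) ∧ IsCompactOperator (⇑y) ∧ T = J.op x y}

/-- `β` is the linear functional on `K(𝔥) • K(𝔥)` induced by the bilinear form
`D`, i.e. `β (x ⊗ y) = D (x, y)` for compact `x, y`. -/
def IsBetaFor (J : OperatorTensor E G)
    (D : (E →L[ℂ] E) →ₗ[ℂ] (E →L[ℂ] E) →ₗ[ℂ] ℂ)
    (β : ↥J.compactSpan →ₗ[ℂ] ℂ) : Prop :=
  ∀ x y : E →L[ℂ] E, IsCompactOperator (⇑x) → IsCompactOperator (⇑y) →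
    ∀ hm : J.op x y ∈ J.compactSpan, β ⟨J.op x y, hm⟩ = D x y

/-- `β` is bounded for the operator norm (inherited from `B(G)`). -/
def BetaNormBounded (J : OperatorTensor E G) (β : ↥J.compactSpan →ₗ[ℂ] ℂ) : Prop :=
  ∃ C : ℝ, ∀ S : J.compactSpan, ‖β S‖ ≤ C * ‖(S : G →L[ℂ] G)‖

/-- A decoherence functional is tensor bounded if its associated functional `β`
on `K(𝔥) • K(𝔥)` is bounded for the (pre-)C*-norm. -/
def IsTensorBounded (J : OperatorTensor E G)
    (d : (E →L[ℂ] E) → (E →L[ℂ] E) → ℂ) : Prop :=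
  ∃ D, IsBoundedBilinear D ∧ ExtendsDF D d ∧
    ∃ β, IsBetaFor J D β ∧ BetaNormBounded J β

/-- `β` is uniformly bounded on the projections `p_ξ`, `ξ` a unit vector of the
algebraic tensor product `𝔥 ⊗_alg 𝔥`. -/
def BetaTraciallyBounded (J : OperatorTensor E G) (β : ↥J.compactSpan →ₗ[ℂ] ℂ) : Prop :=
  ∃ C : ℝ, ∀ ξ : G, ξ ∈ J.toHilbertTensorProduct.algSpan → ‖ξ‖ = 1 →
    ∀ hm : rankOneProj ξ ∈ J.compactSpan, ‖β ⟨rankOneProj ξ, hm⟩‖ ≤ C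

/-- A decoherence functional is tracially bounded if it is bounded and its
associated functional `β` is uniformly bounded on rank one projections `p_ξ`
with `ξ` a unit vector in `𝔥 ⊗_alg 𝔥`. -/
def IsTraciallyBounded (J : OperatorTensor E G)
    (d : (E →L[ℂ] E) → (E →L[ℂ] E) → ℂ) : Prop :=
  DFBounded d ∧ ∃ D, IsBoundedBilinear D ∧ ExtendsDF D d ∧
    ∃ β, IsBetaFor J D β ∧ BetaTraciallyBounded J β

/-- A bounded Hermitian sesquilinear form on `B(𝔥)` (linear in the first,
conjugate linear in the second variable) which is normalised and positive on
projections. -/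
def IsGoodForm (Q : (E →L[ℂ] E) →ₗ[ℂ] ((E →L[ℂ] E) →ₛₗ[starRingEnd ℂ] ℂ)) : Prop :=
  (∃ K : ℝ, ∀ x y : E →L[ℂ] E, ‖Q x y‖ ≤ K * ‖x‖ * ‖y‖) ∧
  (∀ x y : E →L[ℂ] E, Q x y = starRingEnd ℂ (Q y x)) ∧
  Q 1 1 = 1 ∧
  (∀ p : E →L[ℂ] E, IsOrthoProj p → 0 ≤ Q p p)


/-- Frame function on nonzero vectors of ℝ³ (degree 0 homogeneous). -/
structure Fr (f : ℝ → ℝ → ℝ → ℝ) (W : ℝ) : Prop where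
  hom : ∀ c x y z, c ≠ 0 → f (c*x) (c*y) (c*z) = f x y z
  add : ∀ x y z x' y' z' x'' y'' z'', 0 < x^2+y^2+z^2 → 0 < x'^2+y'^2+z'^2 →
    0 < x''^2+y''^2+z''^2 → x*x'+y*y'+z*z' = 0 → x*x''+y*y''+z*z'' = 0 →
    x'*x''+y'*y''+z'*z'' = 0 → f x y z + f x' y' z' + f x'' y'' z'' = W

theorem perp_pos (x y z : ℝ) (hr : 0 < x^2+y^2) : 0 < (x*z)^2+(y*z)^2+(-(x^2+y^2))^2 := by
  have : (x*z)^2+(y*z)^2+(-(x^2+y^2))^2 = (x^2+y^2)*z^2+(x^2+y^2)^2 := by ring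
  rw [this]; positivity

theorem fr_perp {G : ℝ → ℝ → ℝ → ℝ} {a : ℝ} (hG : Fr G a) (heq : ∀ x y, 0 < x^2+y^2 → G x y 0 = 0)
    (x y z : ℝ) (hz : z ≠ 0) (hr : 0 < x^2+y^2) : G x y z + G (x*z) (y*z) (-(x^2+y^2)) = a := by
  have h := hG.add x y z (x*z) (y*z) (-(x^2+y^2)) (-y) x 0 (by positivity) (perp_pos x y z hr)
    (by nlinarith) (by ring) (by ring) (by ring)
  rw [heq (-y) x (by nlinarith)] at h
  linarith

theorem fr_step {G : ℝ → ℝ → ℝ → ℝ} {a δ : ℝ} (hG : Fr G a) (heq : ∀ x y, 0 < x^2+y^2 → G x y 0 = 0)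
    (hlow : ∀ x y z, 0 < x^2+y^2+z^2 → -δ ≤ G x y z)
    (x y z t : ℝ) (hz : z ≠ 0) (hr : 0 < x^2+y^2) : G (x-t*y) (y+t*x) z ≤ G x y z + δ := by
  have h0 : 0 < x^2+y^2+z^2 := by positivity
  have e1 := fr_perp hG heq x y z hz hr
  have key : 0 < (-t*(x^2+y^2)*x - (x^2+y^2+z^2)*y)^2 + (-t*(x^2+y^2)*y + (x^2+y^2+z^2)*x)^2
      + (-t*(x^2+y^2)*z)^2 := by
    have : (-t*(x^2+y^2)*x - (x^2+y^2+z^2)*y)^2 + (-t*(x^2+y^2)*y + (x^2+y^2+z^2)*x)^2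
      + (-t*(x^2+y^2)*z)^2 = t^2*(x^2+y^2)^2*(x^2+y^2+z^2) + (x^2+y^2+z^2)^2*(x^2+y^2) := by ring
    rw [this]; positivity
  have e2 := hG.add (x-t*y) (y+t*x) z (-t*(x^2+y^2)*x - (x^2+y^2+z^2)*y)
    (-t*(x^2+y^2)*y + (x^2+y^2+z^2)*x) (-t*(x^2+y^2)*z) (x*z) (y*z) (-(x^2+y^2))
    (by positivity) key (perp_pos x y z hr) (by ring) (by ring) (by ring)
  have e3 := hlow _ _ _ key
  linarith

theorem fr_iter {G : ℝ → ℝ → ℝ → ℝ} {a δ : ℝ} (hG : Fr G a) (heq : ∀ x y, 0 < x^2+y^2 → G x y 0 = 0)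
    (hlow : ∀ x y z, 0 < x^2+y^2+z^2 → -δ ≤ G x y z) (t : ℝ) (k : ℕ) (u : ℂ) (hu : u ≠ 0) :
    G ((1+t*Complex.I)^k*u).re ((1+t*Complex.I)^k*u).im 1 ≤ G u.re u.im 1 + k*δ := by
  have h1 : (1 + t*Complex.I : ℂ) ≠ 0 := by
    intro h; have := congrArg Complex.re h; simp at this
  have hpos : ∀ v : ℂ, v ≠ 0 → 0 < v.re^2+v.im^2 := by
    intro v hv; have := Complex.normSq_pos.2 hv; rw [Complex.normSq_apply] at this; nlinarith
  induction k with
  | zero => simp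
  | succ k ih =>
    have h2 : (1+t*Complex.I)^k*u ≠ 0 := mul_ne_zero (pow_ne_zero _ h1) hu
    have h3 := fr_step hG heq hlow ((1+t*Complex.I)^k*u).re ((1+t*Complex.I)^k*u).im 1 t one_ne_zero
      (hpos _ h2)
    have h4 : (1+t*Complex.I)^(k+1)*u = (1+t*Complex.I)*((1+t*Complex.I)^k*u) := by ring
    rw [h4]
    generalize (1+t*Complex.I)^k*u = v at *
    simp only [Complex.mul_re, Complex.mul_im, Complex.add_re, Complex.add_im, Complex.one_re, Complex.one_im,
      Complex.ofReal_re, Complex.ofReal_im, Complex.I_re, Complex.I_im]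
    push_cast
    ring_nf at h3 ⊢ 
    ring_nf at ih
    linarith

/-- choice of the number of steps -/
theorem exists_k (η : ℝ) (hη : 0 < η) : ∃ k : ℕ, 3 ≤ k ∧ (1/(Real.cos (Real.pi/k))^2)^k ≤ 1+η := by
  have ht : Filter.Tendsto (fun k : ℕ => 1 - Real.pi^2/(k:ℝ)) Filter.atTop (nhds (1-0)) :=
    tendsto_const_nhds.sub (tendsto_const_div_atTop_nhds_zero_nat _)
  have hlt : 1/(1+η) < 1 - 0 := by rw [sub_zero, div_lt_one (by linarith)]; linarith
  obtain ⟨k, hk1, hk2⟩ := ((ht.eventually (lt_mem_nhds hlt)).and (Filter.eventually_ge_atTop 4)).exists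
  refine ⟨k, by omega, ?_⟩
  have hk0 : (4:ℝ) ≤ k := by exact_mod_cast hk2
  have hc : 1 - Real.pi^2/(k:ℝ)^2 ≤ Real.cos (Real.pi/k)^2 := by
    have h1 := Real.sin_le (x := Real.pi/k) (by positivity)
    have h0 : 0 ≤ Real.sin (Real.pi/k) := Real.sin_nonneg_of_nonneg_of_le_pi (by positivity)
      (div_le_self Real.pi_pos.le (by linarith))
    have h2 : Real.sin (Real.pi/k)^2 ≤ (Real.pi/k)^2 := pow_le_pow_left₀ h0 h1 2
    have h3 := Real.sin_sq_add_cos_sq (Real.pi/k)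
    rw [div_pow] at h2
    linarith
  have hb : (0:ℝ) ≤ 1 - Real.pi^2/(k:ℝ)^2 := by
    rw [sub_nonneg, div_le_one (by positivity)]
    have := Real.pi_lt_four; have := Real.pi_pos; nlinarith
  have hB := one_add_mul_le_pow (a := - (Real.pi^2/(k:ℝ)^2)) (by linarith) k
  have h5 : (1:ℝ) - Real.pi^2/k ≤ (Real.cos (Real.pi/k)^2)^k := by
    calc (1:ℝ) - Real.pi^2/k = 1 + k * (-(Real.pi^2/(k:ℝ)^2)) := by field_simp; ring
      _ ≤ (1 + -(Real.pi^2/(k:ℝ)^2))^k := hB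
      _ ≤ _ := pow_le_pow_left₀ (by linarith) (by linarith) _
  rw [one_div, inv_pow, inv_le_comm₀ _ (by linarith), ← one_div]
  · linarith
  · have : 0 < 1/(1+η) := by positivity
    linarith

theorem cexp_pow (k : ℕ) (θ : ℝ) (hc : Real.cos θ ≠ 0) :
    (1 + (Real.tan θ:ℝ)*Complex.I)^k = ((1/Real.cos θ)^k : ℝ) * (Real.cos (k*θ) + Real.sin (k*θ) * Complex.I) := by
  have h1 : (1 + (Real.tan θ:ℝ)*Complex.I : ℂ) = ((1/Real.cos θ : ℝ):ℂ) * (Real.cos θ + Real.sin θ*Complex.I) := by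
    rw [Real.tan_eq_sin_div_cos]
    have : (Real.cos θ : ℂ) ≠ 0 := by exact_mod_cast hc
    push_cast at this ⊢
    field_simp
  rw [h1, mul_pow]
  push_cast
  rw [Complex.cos_add_sin_mul_I_pow]

theorem exists_theta (k : ℕ) (hk : 3 ≤ k) (c : ℝ) (hc : 0 < c) (h : 1 ≤ c * (1/Real.cos (Real.pi/k))^k) :
    ∃ θ, 0 ≤ θ ∧ θ ≤ Real.pi/k ∧ c * ((1/Real.cos θ)^k * Real.cos (k*θ)) = -1 := by
  have hk0 : (3:ℝ) ≤ k := by exact_mod_cast hk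
  have hpk : Real.pi/k ≤ Real.pi/3 := by gcongr
  have hpk0 : 0 ≤ Real.pi/k := by positivity
  have hcos : ∀ θ ∈ Set.Icc 0 (Real.pi/k), Real.cos θ ≠ 0 := by
    intro θ hθ
    exact (Real.cos_pos_of_mem_Ioo ⟨by linarith [hθ.1, Real.pi_pos], by linarith [hθ.2, Real.pi_pos]⟩).ne'
  have hcont : ContinuousOn (fun θ => c * ((1/Real.cos θ)^k * Real.cos (k*θ))) (Set.Icc 0 (Real.pi/k)) := by
    refine ContinuousOn.mul continuousOn_const (ContinuousOn.mul (ContinuousOn.pow (ContinuousOn.div continuousOn_const (by fun_prop) hcos) _) (by fun_prop))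
  have := intermediate_value_Icc' hpk0 hcont
  have hm : (-1:ℝ) ∈ Set.Icc (c * ((1/Real.cos (Real.pi/k))^k * Real.cos (k*(Real.pi/k)))) (c * ((1/Real.cos 0)^k * Real.cos (k*0))) := by
    have e : (k:ℝ)*(Real.pi/k) = Real.pi := by field_simp
    rw [e]; simp only [Real.cos_pi, mul_zero, Real.cos_zero, div_one, one_pow, mul_one]
    constructor <;> linarith
  obtain ⟨θ, hθ, h2⟩ := this hm
  exact ⟨θ, hθ.1, hθ.2, h2⟩

/-- lambda comparison -/
theorem lam_bound (ρ lam η : ℝ) (hρ : 0 ≤ ρ) (h1 : 1 ≤ lam) (h2 : lam ≤ (1+η)^3) (hη : 0 ≤ η) (hη1 : η ≤ 1) (a A : ℝ)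
    (ha : |a| ≤ A) : |a/(1+ρ) - a/(1+lam*ρ)| ≤ 7*A*η := by
  have hl : lam - 1 ≤ 7*η := by nlinarith [mul_nonneg hη hη, mul_nonneg hη (mul_nonneg hη hη)]
  have e : a/(1+ρ) - a/(1+lam*ρ) = a * ((lam-1) * (ρ/((1+ρ)*(1+lam*ρ)))) := by
    have : 0 < 1+lam*ρ := by positivity
    field_simp; ring
  have h3 : ρ/((1+ρ)*(1+lam*ρ)) ≤ 1 := by
    have : 0 < 1+lam*ρ := by positivity
    rw [div_le_one (by positivity)]; nlinarith [mul_nonneg hρ hρ, mul_nonneg (mul_nonneg hρ hρ) (by linarith : 0 ≤ lam), mul_nonneg hρ (by linarith : 0 ≤ lam)]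
  have h4 : 0 ≤ ρ/((1+ρ)*(1+lam*ρ)) := by positivity
  have h5 : (lam-1) * (ρ/((1+ρ)*(1+lam*ρ))) ≤ 7*η := by nlinarith
  have h6 : 0 ≤ (lam-1) * (ρ/((1+ρ)*(1+lam*ρ))) := mul_nonneg (by linarith) h4
  rw [e, abs_mul, abs_of_nonneg h6]
  calc |a| * ((lam-1) * (ρ/((1+ρ)*(1+lam*ρ)))) ≤ A * (7*η) := mul_le_mul ha h5 h6 ((abs_nonneg a).trans ha)
    _ = _ := by ring

/-- the deviation function -/
noncomputable def KK (G : ℝ → ℝ → ℝ → ℝ) (a : ℝ) (x y z : ℝ) : ℝ := G x y z - a * (z^2/(x^2+y^2+z^2))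

theorem KK_frame {G : ℝ → ℝ → ℝ → ℝ} {a : ℝ} (hG : Fr G a) (x y x' y' : ℝ) (h : x*x'+y*y' = -1) :
    KK G a x y 1 + KK G a x' y' 1 + KK G a (y-y') (x'-x) (x*y'-y*x') = 0 := by
  have hp : (y-y')^2+(x'-x)^2+(x*y'-y*x')^2 = (x^2+y^2+1)*(x'^2+y'^2+1) := by
    linear_combination (-(x*x'+y*y')-1) * h
  have := hG.add x y 1 x' y' 1 (y-y') (x'-x) (x*y'-y*x') (by positivity) (by positivity)
    (by rw [hp]; positivity) (by linarith) (by ring) (by ring)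
  unfold KK
  rw [hp]
  have e : (1:ℝ)^2/(x^2+y^2+1^2) + 1^2/(x'^2+y'^2+1^2) + (x*y'-y*x')^2/((x^2+y^2+1)*(x'^2+y'^2+1)) = 1 := by
    field_simp
    linear_combination (-(x*x'+y*y')+1) * h
  linear_combination this - a * e

theorem cnormSq (v : ℂ) : v.re^2+v.im^2 = Complex.normSq v := by rw [Complex.normSq_apply]; ring

set_option maxHeartbeats 1000000 in
/-- contraction -/
theorem KK_contract {G : ℝ → ℝ → ℝ → ℝ} {a δ η A D : ℝ} (hG : Fr G a) (heq : ∀ x y, 0 < x^2+y^2 → G x y 0 = 0)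
    (hpole : G 0 0 1 = a)
    (hlow : ∀ x y z, 0 < x^2+y^2+z^2 → -δ ≤ G x y z) (hδ : 0 ≤ δ) (hη : 0 < η) (hη1 : η ≤ 1) (ha : |a| ≤ A)
    (k : ℕ) (hk : 3 ≤ k) (hkη : (1/(Real.cos (Real.pi/k))^2)^k ≤ 1+η)
    (hD : ∀ x y z, 0 < x^2+y^2+z^2 → |KK G a x y z| ≤ D) (x y z : ℝ) (h0 : 0 < x^2+y^2+z^2) :
    |KK G a x y z| ≤ (D + ((k+2)*δ + 7*A*η))/2 := by
  have hA : 0 ≤ A := (abs_nonneg a).trans ha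
  have hD0 : 0 ≤ D := (abs_nonneg _).trans (hD x y z h0)
  set e := (k+2)*δ + 7*A*η with he
  have he0 : 0 ≤ e := by positivity
  have hk0 : (3:ℝ) ≤ k := by exact_mod_cast hk
  have hpk : Real.pi/k ≤ Real.pi/3 := by gcongr
  have hcpos : ∀ θ, 0 ≤ θ → θ ≤ Real.pi/k → 0 < Real.cos θ := by
    intro θ h1 h2
    exact Real.cos_pos_of_mem_Ioo ⟨by linarith [Real.pi_pos], by linarith [Real.pi_pos]⟩
  -- bound of powers
  have hpow : ∀ θ, 0 ≤ θ → θ ≤ Real.pi/k → 1 ≤ (1/Real.cos θ)^k ∧ ((1/Real.cos θ)^k)^2 ≤ 1+η := by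
    intro θ h1 h2
    have hc1 := hcpos θ h1 h2
    have hc2 := hcpos (Real.pi/k) (by positivity) le_rfl
    have hle : Real.cos (Real.pi/k) ≤ Real.cos θ :=
      Real.cos_le_cos_of_nonneg_of_le_pi h1 (by linarith [Real.pi_pos]) h2
    refine ⟨one_le_pow₀ (by rw [le_div_iff₀ hc1]; linarith [Real.cos_le_one θ]), ?_⟩
    refine le_trans ?_ hkη
    rw [← pow_mul, mul_comm k 2, pow_mul]
    gcongr
    rw [div_pow, one_pow]
    gcongr
  -- downward
  have DC : ∀ u : ℂ, 1/(1+η) ≤ Complex.normSq u → -(D+e)/2 ≤ KK G a u.re u.im 1 := by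
    intro u hu
    have hu' : 1 ≤ (1+η) * Complex.normSq u := by
      rw [div_le_iff₀ (by linarith)] at hu; linarith
    have hun : 0 < Complex.normSq u := lt_of_lt_of_le (by positivity) hu
    have hu0 : u ≠ 0 := Complex.normSq_pos.1 hun
    obtain ⟨θ, h1, h2, h3⟩ := exists_theta k hk ((1+η)*Complex.normSq u) (by positivity)
      (by have := (hpow (Real.pi/k) (by positivity) le_rfl).1; nlinarith)
    have hc := hcpos θ h1 h2
    have hp := hpow θ h1 h2
    have hs := cexp_pow k θ hc.ne'
    set L := (1/Real.cos θ)^k with hL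
    set v := (1 + (Real.tan θ:ℝ)*Complex.I)^k * u with hv
    have hv0 : v ≠ 0 := by
      rw [hv]; refine mul_ne_zero (pow_ne_zero _ ?_) hu0
      intro h; have := congrArg Complex.re h; simp at this
    have i1 := fr_iter hG heq hlow (Real.tan θ) k u hu0
    have i2 := fr_iter hG heq hlow (Real.sqrt η) 1 v hv0
    have hw0 : (1+(Real.sqrt η:ℝ)*Complex.I)^1*v ≠ 0 := by
      refine mul_ne_zero (pow_ne_zero _ ?_) hv0
      intro h; have := congrArg Complex.re h; simp at this
    have i3 := fr_iter hG heq hlow (-Real.sqrt η) 1 _ hw0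
    have ew : (1+((-Real.sqrt η:ℝ):ℂ)*Complex.I)^1*((1+(Real.sqrt η:ℝ)*Complex.I)^1*v) = ((1+η:ℝ):ℂ)*v := by
      have hq : ((Real.sqrt η:ℝ):ℂ)^2 = ((η:ℝ):ℂ) := by rw [← Complex.ofReal_pow, Real.sq_sqrt hη.le]
      push_cast
      linear_combination (-(Complex.I^2) * hq - (η:ℂ) * Complex.I_sq) * v
    rw [ew] at i3
    set w := ((1+η:ℝ):ℂ)*v with hw
    have hre : u.re*w.re+u.im*w.im = -1 := by
      rw [← h3, Complex.normSq_apply, hw, hv, hs]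
      simp [-Complex.ofReal_cos, -Complex.ofReal_sin]
      ring
    have hF := KK_frame hG u.re u.im w.re w.im hre
    have hns : Complex.normSq w = ((1+η)^2*L^2) * Complex.normSq u := by
      rw [hw, hv, hs]
      simp only [map_mul, Complex.normSq_ofReal]
      have : Complex.normSq ((Real.cos (k*θ):ℂ) + Real.sin (k*θ) * Complex.I) = 1 := by
        rw [Complex.normSq_add_mul_I]; exact Real.cos_sq_add_sin_sq _
      rw [this]; ring
    have hpos3 : 0 < (u.im - w.im)^2+(w.re-u.re)^2+(u.re*w.im-u.im*w.re)^2 := by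
      have : (u.im - w.im)^2+(w.re-u.re)^2+(u.re*w.im-u.im*w.re)^2 = (u.re^2+u.im^2+1)*(w.re^2+w.im^2+1) := by
        linear_combination (-(u.re*w.re+u.im*w.im)-1) * hre
      rw [this]; positivity
    have hD3 := hD _ _ _ hpos3
    have hlb := lam_bound (Complex.normSq u) ((1+η)^2*L^2) η hun.le (one_le_mul_of_one_le_of_one_le (one_le_pow₀ (by linarith)) (one_le_pow₀ hp.1))
      ((mul_le_mul_of_nonneg_left hp.2 (by positivity)).trans_eq (by ring)) hη.le hη1 a A ha
    rw [← hns] at hlb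
    have k1 : KK G a w.re w.im 1 ≤ KK G a u.re u.im 1 + e := by
      unfold KK
      rw [cnormSq, cnormSq, one_pow, add_comm (Complex.normSq u), add_comm (Complex.normSq w), mul_one_div, mul_one_div]
      have := (abs_le.1 hlb).2
      simp only [Nat.cast_one, one_mul] at i2 i3
      rw [he]; linarith
    have := (abs_le.1 hD3)
    linarith [this.1, this.2]
  -- upward
  have UC : ∀ u : ℂ, 1+η ≤ Complex.normSq u → KK G a u.re u.im 1 ≤ (D+e)/2 := by
    intro u hu
    have hun : 0 < Complex.normSq u := lt_of_lt_of_le (by positivity) hu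
    have hu0 : u ≠ 0 := Complex.normSq_pos.1 hun
    have hL1 := hpow (Real.pi/k) (by positivity) le_rfl
    have : ∃ θ, 0 ≤ θ ∧ θ ≤ Real.pi/k ∧ Complex.normSq u * (((1/Real.cos θ)^k)⁻¹ * Real.cos (k*θ)) = -1 := by
      have hcont : ContinuousOn (fun θ => Complex.normSq u * (((1/Real.cos θ)^k)⁻¹ * Real.cos (k*θ))) (Set.Icc 0 (Real.pi/k)) := by
        have : (fun θ => Complex.normSq u * (((1/Real.cos θ)^k)⁻¹ * Real.cos (k*θ))) = (fun θ => Complex.normSq u * ((Real.cos θ)^k * Real.cos (k*θ))) := by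
          funext θ; simp
        rw [this]; fun_prop
      have := intermediate_value_Icc' (by positivity) hcont
      have hm : (-1:ℝ) ∈ Set.Icc (Complex.normSq u * (((1/Real.cos (Real.pi/k))^k)⁻¹ * Real.cos (k*(Real.pi/k)))) (Complex.normSq u * (((1/Real.cos 0)^k)⁻¹ * Real.cos (k*0))) := by
        have e : (k:ℝ)*(Real.pi/k) = Real.pi := by field_simp
        rw [e]; simp only [Real.cos_pi, mul_zero, Real.cos_zero, div_one, one_pow, mul_one, inv_one]
        constructor
        · have h5 : (1/Real.cos (Real.pi/k))^k ≤ Complex.normSq u := by nlinarith [hL1.1, hL1.2]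
          have h6 : 1 ≤ Complex.normSq u * ((1/Real.cos (Real.pi/k))^k)⁻¹ := by
            rw [← div_eq_mul_inv, one_le_div (by linarith [hL1.1])]; exact h5
          linarith
        · linarith
      obtain ⟨θ, hθ, h2⟩ := this hm
      exact ⟨θ, hθ.1, hθ.2, h2⟩
    obtain ⟨θ, h1, h2, h3⟩ := this
    have hc := hcpos θ h1 h2
    have hp := hpow θ h1 h2
    have hs := cexp_pow k θ hc.ne'
    set L := (1/Real.cos θ)^k with hL
    have hL0 : L ≠ 0 := by linarith [hp.1]
    have hm0 : ((1:ℂ) + (Real.tan θ:ℝ)*Complex.I)^k ≠ 0 := by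
      refine pow_ne_zero _ ?_
      intro h; have := congrArg Complex.re h; simp at this
    set w : ℂ := ((L⁻¹ : ℝ):ℂ) * (Real.cos (k*θ) - Real.sin (k*θ)*Complex.I) * u with hw
    have hLc : (L:ℂ) ≠ 0 := by exact_mod_cast hL0
    have hww : ((1:ℂ) + (Real.tan θ:ℝ)*Complex.I)^k * w = u := by
      rw [hs, hw]
      have h7 : ((Real.cos (k*θ):ℝ):ℂ)^2 + ((Real.sin (k*θ):ℝ):ℂ)^2 = 1 := by
        exact_mod_cast Real.cos_sq_add_sin_sq (k*θ)
      have h8 : (L:ℂ) * ((L⁻¹:ℝ):ℂ) = 1 := by push_cast; exact mul_inv_cancel₀ hLc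
      generalize ((Real.cos (k*θ):ℝ):ℂ) = cc at *
      generalize ((Real.sin (k*θ):ℝ):ℂ) = ss at *
      calc (L:ℂ) * (cc + ss*Complex.I) * (((L⁻¹:ℝ):ℂ) * (cc - ss*Complex.I) * u) = ((L:ℂ) * ((L⁻¹:ℝ):ℂ)) * (cc^2 - ss^2*Complex.I^2) * u := by ring
        _ = u := by rw [h8, Complex.I_sq]; linear_combination u * h7
    have hw0 : w ≠ 0 := by rintro h; rw [h, mul_zero] at hww; exact hu0 hww.symm
    have i1 := fr_iter hG heq hlow (Real.tan θ) k w hw0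
    rw [hww] at i1
    have hre : u.re*w.re+u.im*w.im = -1 := by
      rw [← h3, Complex.normSq_apply, hw]
      simp [-Complex.ofReal_cos, -Complex.ofReal_sin]
      ring
    have hF := KK_frame hG u.re u.im w.re w.im hre
    have hns : Complex.normSq u = L^2 * Complex.normSq w := by
      conv_lhs => rw [← hww, hs]
      simp only [map_mul, Complex.normSq_ofReal]
      have : Complex.normSq ((Real.cos (k*θ):ℂ) + Real.sin (k*θ) * Complex.I) = 1 := by
        rw [Complex.normSq_add_mul_I]; exact Real.cos_sq_add_sin_sq _
      rw [this]; ring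
    have hpos3 : 0 < (u.im - w.im)^2+(w.re-u.re)^2+(u.re*w.im-u.im*w.re)^2 := by
      have : (u.im - w.im)^2+(w.re-u.re)^2+(u.re*w.im-u.im*w.re)^2 = (u.re^2+u.im^2+1)*(w.re^2+w.im^2+1) := by
        linear_combination (-(u.re*w.re+u.im*w.im)-1) * hre
      rw [this]; positivity
    have hD3 := hD _ _ _ hpos3
    have hlb := lam_bound (Complex.normSq w) (L^2) η (Complex.normSq_nonneg _) (one_le_pow₀ hp.1) (hp.2.trans (le_self_pow₀ (by linarith) (by norm_num))) hη.le hη1 a A ha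
    rw [← hns] at hlb
    have k1 : KK G a u.re u.im 1 ≤ KK G a w.re w.im 1 + e := by
      unfold KK
      rw [cnormSq, cnormSq, one_pow, add_comm (Complex.normSq u), add_comm (Complex.normSq w), mul_one_div, mul_one_div]
      have := (abs_le.1 hlb).2
      rw [he]; linarith
    have := (abs_le.1 hD3)
    linarith [this.1, this.2]
  have hperp : ∀ x y : ℝ, 0 < x^2+y^2 → KK G a x y 1 + KK G a (-x/(x^2+y^2)) (-y/(x^2+y^2)) 1 = 0 := by
    intro x y hr
    have h1 := fr_perp hG heq x y 1 one_ne_zero hr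
    have h2 := hG.hom (-1/(x^2+y^2)) (x*1) (y*1) (-(x^2+y^2)) (by simp; positivity)
    have e1 : -1/(x^2+y^2)*(x*1) = -x/(x^2+y^2) := by ring
    have e2 : -1/(x^2+y^2)*(y*1) = -y/(x^2+y^2) := by ring
    have e3 : -1/(x^2+y^2)*(-(x^2+y^2)) = 1 := by field_simp
    rw [e1,e2,e3] at h2
    unfold KK
    rw [h2]
    have : (1:ℝ)^2/(x^2+y^2+1^2) + 1^2/((-x/(x^2+y^2))^2+(-y/(x^2+y^2))^2+1^2) = 1 := by
      have : (-x/(x^2+y^2))^2+(-y/(x^2+y^2))^2+1^2 = (x^2+y^2+1)/(x^2+y^2) := by field_simp; ring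
      rw [this]; field_simp
      try ring
    linear_combination h1 - a * this
  have main1 : ∀ x y : ℝ, |KK G a x y 1| ≤ (D+e)/2 := by
    intro x y
    rcases eq_or_lt_of_le (by positivity : 0 ≤ x^2+y^2) with hr | hr
    · have hx : x = 0 := by nlinarith [sq_nonneg x, sq_nonneg y]
      have hy : y = 0 := by nlinarith [sq_nonneg x, sq_nonneg y]
      subst hx hy
      unfold KK; rw [hpole]; simp; linarith
    have hp := hperp x y hr
    have n1 : Complex.normSq ⟨x,y⟩ = x^2+y^2 := by rw [← cnormSq]
    have n2 : Complex.normSq ⟨-x/(x^2+y^2),-y/(x^2+y^2)⟩ = 1/(x^2+y^2) := by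
      rw [← cnormSq]; field_simp
    have A1 := DC ⟨x,y⟩
    have A2 := DC ⟨-x/(x^2+y^2),-y/(x^2+y^2)⟩
    have A3 := UC ⟨x,y⟩
    have A4 := UC ⟨-x/(x^2+y^2),-y/(x^2+y^2)⟩
    rw [n1] at A1 A3; rw [n2] at A2 A4
    simp only at A1 A2 A3 A4
    rw [abs_le]
    constructor
    · by_cases h : 1/(1+η) ≤ x^2+y^2
      · linarith [A1 h]
      · push Not at h
        have : 1+η ≤ 1/(x^2+y^2) := by
          rw [le_div_iff₀ hr]; rw [lt_div_iff₀ (by linarith)] at h; linarith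
        linarith [A4 this]
    · by_cases h : 1+η ≤ x^2+y^2
      · exact A3 h
      · push Not at h
        have : 1/(1+η) ≤ 1/(x^2+y^2) := one_div_le_one_div_of_le hr h.le
        linarith [A2 this]
  by_cases hz : z = 0
  · subst hz
    unfold KK; rw [heq x y (by linarith)]; simp; linarith
  · have h2 := main1 (x/z) (y/z)
    have h3 := hG.hom z (x/z) (y/z) 1 hz
    rw [mul_div_cancel₀ _ hz, mul_div_cancel₀ _ hz, mul_one] at h3
    have : KK G a x y z = KK G a (x/z) (y/z) 1 := by
      unfold KK; rw [h3]; congr 2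
      field_simp
    rw [this]; exact h2


theorem propA (ε : ℝ) (hε : 0 < ε) : ∃ δ > 0, ∀ (f : ℝ → ℝ → ℝ → ℝ) (W : ℝ), Fr f W →
    (∀ x y z, 0 < x^2+y^2+z^2 → |f x y z| ≤ 2) →
    (∀ x y z, 0 < x^2+y^2+z^2 → f x y z ≤ f 0 0 1 + δ) →
    ∀ x y z, 0 < x^2+y^2+z^2 → 
      |f x y z + f (-y) x z - ((W - f 0 0 1) + (3 * f 0 0 1 - W) * (z^2/(x^2+y^2+z^2)))| ≤ ε := by
  set η := min 1 (ε/168) with hη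
  have hη0 : 0 < η := by rw [hη]; positivity
  obtain ⟨k, hk, hkη⟩ := exists_k η hη0
  refine ⟨ε/(4*(k+2)), by positivity, ?_⟩
  intro f W hf hb hmax
  set δ := ε/(4*(k+2)) with hδ
  have hδ0 : 0 < δ := by positivity
  set a := 3 * f 0 0 1 - W with ha
  set G : ℝ → ℝ → ℝ → ℝ := fun x y z => f x y z + f (-y) x z - (W - f 0 0 1) with hGdef
  have hG : Fr G a := by
    constructor
    · intro c x y z hc
      have h1 := hf.hom c x y z hc
      have h2 := hf.hom c (-y) x z hc
      simp only [hGdef]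
      rw [h1, ← h2]; ring_nf
    · intro x y z x' y' z' x'' y'' z'' p1 p2 p3 o1 o2 o3
      have h1 := hf.add x y z x' y' z' x'' y'' z'' p1 p2 p3 o1 o2 o3
      have h2 := hf.add (-y) x z (-y') x' z' (-y'') x'' z'' (by linarith) (by linarith) (by linarith)
        (by linarith) (by linarith) (by linarith)
      simp only [hGdef]; linarith
  have heq : ∀ x y, 0 < x^2+y^2 → G x y 0 = 0 := by
    intro x y h
    have := hf.add x y 0 (-y) x 0 0 0 1 (by linarith) (by linarith) (by norm_num) (by ring) (by ring) (by ring)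
    simp only [hGdef]; linarith
  have hpole : G 0 0 1 = a := by simp only [hGdef, neg_zero]; linarith
  have hup : ∀ x y z, 0 < x^2+y^2+z^2 → G x y z ≤ a + 2*δ := by
    intro x y z h
    have h1 := hmax x y z h
    have h2 := hmax (-y) x z (by linarith)
    simp only [hGdef]; linarith
  have hlow : ∀ x y z, 0 < x^2+y^2+z^2 → -(2*δ) ≤ G x y z := by
    intro x y z h
    have ha0 : -(2*δ) ≤ a := by
      have := hup 1 0 0 (by norm_num); rw [heq 1 0 (by norm_num)] at this; linarith
    by_cases hz : z = 0
    · subst hz; rw [heq x y (by linarith)]; linarith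
    rcases eq_or_lt_of_le (by positivity : 0 ≤ x^2+y^2) with hr | hr
    · have hx : x = 0 := by nlinarith [sq_nonneg x, sq_nonneg y]
      have hy : y = 0 := by nlinarith [sq_nonneg x, sq_nonneg y]
      have := hG.hom z 0 0 1 hz
      simp only [mul_zero, mul_one] at this
      rw [hx, hy, this, hpole]; exact ha0
    · have h1 := fr_perp hG heq x y z hz hr
      have h2 := hup (x*z) (y*z) (-(x^2+y^2)) (perp_pos x y z hr)
      linarith
  have hf1 := abs_le.1 (hb 0 0 1 (by norm_num))
  have hf2 := abs_le.1 (hb 0 1 0 (by norm_num))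
  have hf3 := abs_le.1 (hb 1 0 0 (by norm_num))
  have hW := hf.add 1 0 0 0 1 0 0 0 1 (by norm_num) (by norm_num) (by norm_num) (by norm_num) (by norm_num) (by norm_num)
  have haA : |a| ≤ 8 := by rw [abs_le]; constructor <;> linarith [hf1.1, hf1.2, hf2.1, hf2.2, hf3.1, hf3.2]
  set e := (k+2)*(2*δ) + 7*8*η with he
  have hee : e ≤ ε := by
    have h1 : (k+2)*(2*δ) = ε/2 := by rw [hδ]; field_simp; norm_num
    have h2 : η ≤ ε/168 := min_le_right _ _
    rw [he, h1]; linarith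
  have hbd : ∀ x y z, 0 < x^2+y^2+z^2 → |KK G a x y z| ≤ 100 := by
    intro x y z h
    have h1 := abs_le.1 (hb x y z h)
    have h2 := abs_le.1 (hb (-y) x z (by linarith))
    have h3 : z^2/(x^2+y^2+z^2) ≤ 1 := by rw [div_le_one h]; nlinarith [sq_nonneg x, sq_nonneg y]
    have h4 : 0 ≤ z^2/(x^2+y^2+z^2) := by positivity
    have h5 := abs_le.1 haA
    have h6 : |a * (z^2/(x^2+y^2+z^2))| ≤ 8 := by
      rw [abs_mul, abs_of_nonneg h4]; nlinarith [abs_nonneg a]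
    have h7 := abs_le.1 h6
    unfold KK
    simp only [hGdef]
    rw [abs_le]; constructor <;> linarith [hf1.1, hf1.2, hf2.1, hf2.2, hf3.1, hf3.2]
  set S := {d : ℝ | ∃ x y z, 0 < x^2+y^2+z^2 ∧ d = |KK G a x y z|} with hS
  have hSb : BddAbove S := ⟨100, by rintro d ⟨x,y,z,h,rfl⟩; exact hbd x y z h⟩
  have hSn : S.Nonempty := ⟨_, 1, 0, 0, by norm_num, rfl⟩
  have hle : ∀ x y z, 0 < x^2+y^2+z^2 → |KK G a x y z| ≤ sSup S := fun x y z h => le_csSup hSb ⟨x,y,z,h,rfl⟩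
  have hcon : sSup S ≤ (sSup S + e)/2 := by
    refine csSup_le hSn ?_
    rintro d ⟨x,y,z,h,rfl⟩
    exact KK_contract hG heq hpole hlow (by linarith) hη0 (min_le_left _ _) haA k hk hkη hle x y z h
  intro x y z h
  have := hle x y z h
  have e1 : f x y z + f (-y) x z - ((W - f 0 0 1) + a * (z^2/(x^2+y^2+z^2))) = KK G a x y z := by
    unfold KK; simp only [hGdef]; ring
  rw [e1]; linarith

/-- orthonormal triples -/
structure ON (a b c a' b' c' a'' b'' c'' : ℝ) : Prop where
  n1 : a^2+b^2+c^2 = 1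
  n2 : a'^2+b'^2+c'^2 = 1
  n3 : a''^2+b''^2+c''^2 = 1
  o12 : a*a'+b*b'+c*c' = 0
  o13 : a*a''+b*b''+c*c'' = 0
  o23 : a'*a''+b'*b''+c'*c'' = 0

theorem gram_transpose (a b c a' b' c' a'' b'' c'' : ℝ) (p1 : 0 < a^2+b^2+c^2) (p2 : 0 < a'^2+b'^2+c'^2)
    (p3 : 0 < a''^2+b''^2+c''^2) (o12 : a*a'+b*b'+c*c' = 0) (o13 : a*a''+b*b''+c*c'' = 0)
    (o23 : a'*a''+b'*b''+c'*c'' = 0) :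
    (a^2/(a^2+b^2+c^2) + a'^2/(a'^2+b'^2+c'^2) + a''^2/(a''^2+b''^2+c''^2) = 1 ∧
     b^2/(a^2+b^2+c^2) + b'^2/(a'^2+b'^2+c'^2) + b''^2/(a''^2+b''^2+c''^2) = 1 ∧
     c^2/(a^2+b^2+c^2) + c'^2/(a'^2+b'^2+c'^2) + c''^2/(a''^2+b''^2+c''^2) = 1) ∧
    (a*b/(a^2+b^2+c^2) + a'*b'/(a'^2+b'^2+c'^2) + a''*b''/(a''^2+b''^2+c''^2) = 0 ∧
     a*c/(a^2+b^2+c^2) + a'*c'/(a'^2+b'^2+c'^2) + a''*c''/(a''^2+b''^2+c''^2) = 0 ∧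
     b*c/(a^2+b^2+c^2) + b'*c'/(a'^2+b'^2+c'^2) + b''*c''/(a''^2+b''^2+c''^2) = 0) := by
  set N := a^2+b^2+c^2 with hN
  set N' := a'^2+b'^2+c'^2 with hN'
  set N'' := a''^2+b''^2+c''^2 with hN''
  have h : (!![a,b,c;a',b',c';a'',b'',c''] : Matrix (Fin 3) (Fin 3) ℝ) *
      !![a/N,a'/N',a''/N'';b/N,b'/N',b''/N'';c/N,c'/N',c''/N''] = 1 := by
    ext i j
    fin_cases i <;> fin_cases j <;> simp [Matrix.mul_apply, Fin.sum_univ_three] <;> field_simp <;> linarith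
  have h2 := mul_eq_one_comm.1 h
  have g := fun i j => congrFun (congrFun h2 i) j
  have g00 := g 0 0
  have g11 := g 1 1
  have g22 := g 2 2
  have g01 := g 0 1
  have g02 := g 0 2
  have g12 := g 1 2
  simp [Matrix.mul_apply, Fin.sum_univ_three] at g00 g11 g22 g01 g02 g12
  refine ⟨⟨?_,?_,?_⟩,?_,?_,?_⟩
  · rw [← g00]; ring
  · rw [← g11]; ring
  · rw [← g22]; ring
  · rw [← g01]; ring
  · rw [← g02]; ring
  · rw [← g12]; ring

theorem ON.transpose {a b c a' b' c' a'' b'' c'' : ℝ} (h : ON a b c a' b' c' a'' b'' c'') :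
    ON a a' a'' b b' b'' c c' c'' := by
  obtain ⟨⟨h1,h2,h3⟩,h4,h5,h6⟩ := gram_transpose a b c a' b' c' a'' b'' c'' (by rw [h.n1]; norm_num)
    (by rw [h.n2]; norm_num) (by rw [h.n3]; norm_num) h.o12 h.o13 h.o23
  rw [h.n1, h.n2, h.n3] at *
  simp only [div_one] at *
  exact ⟨h1,h2,h3,h4,h5,h6⟩

/-- change of frame -/
def pull (f : ℝ → ℝ → ℝ → ℝ) (a b c a' b' c' a'' b'' c'' : ℝ) : ℝ → ℝ → ℝ → ℝ :=
  fun x y z => f (x*a+y*a'+z*a'') (x*b+y*b'+z*b'') (x*c+y*c'+z*c'')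

theorem ON.normSq {a b c a' b' c' a'' b'' c'' : ℝ} (h : ON a b c a' b' c' a'' b'' c'') (x y z : ℝ) :
    (x*a+y*a'+z*a'')^2 + (x*b+y*b'+z*b'')^2 + (x*c+y*c'+z*c'')^2 = x^2+y^2+z^2 := by
  linear_combination x^2*h.n1+y^2*h.n2+z^2*h.n3+2*x*y*h.o12+2*x*z*h.o13+2*y*z*h.o23

theorem ON.dot {a b c a' b' c' a'' b'' c'' : ℝ} (h : ON a b c a' b' c' a'' b'' c'') (x y z X Y Z : ℝ) :
    (x*a+y*a'+z*a'')*(X*a+Y*a'+Z*a'') + (x*b+y*b'+z*b'')*(X*b+Y*b'+Z*b'') + (x*c+y*c'+z*c'')*(X*c+Y*c'+Z*c'')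
      = x*X+y*Y+z*Z := by
  linear_combination x*X*h.n1+y*Y*h.n2+z*Z*h.n3+(x*Y+y*X)*h.o12+(x*Z+z*X)*h.o13+(y*Z+z*Y)*h.o23

theorem Fr.pull {f W a b c a' b' c' a'' b'' c''} (hf : Fr f W) (h : ON a b c a' b' c' a'' b'' c'') :
    Fr (pull f a b c a' b' c' a'' b'' c'') W := by
  constructor
  · intro k x y z hk
    have := hf.hom k (x*a+y*a'+z*a'') (x*b+y*b'+z*b'') (x*c+y*c'+z*c'') hk
    unfold _root_.pull
    rw [← this]; ring_nf
  · intro x y z x' y' z' x'' y'' z'' p1 p2 p3 o1 o2 o3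
    unfold _root_.pull
    apply hf.add <;> first | (rw [h.normSq]; assumption) | (rw [h.dot]; assumption)

theorem pull_inv (f : ℝ → ℝ → ℝ → ℝ) {a b c a' b' c' a'' b'' c'' : ℝ} (h : ON a b c a' b' c' a'' b'' c'') (x y z : ℝ) :
    pull f a b c a' b' c' a'' b'' c'' (x*a+y*b+z*c) (x*a'+y*b'+z*c') (x*a''+y*b''+z*c'') = f x y z := by
  have t := h.transpose
  unfold pull
  congr 1
  · linear_combination x*t.n1 + y*t.o12+z*t.o13
  · linear_combination y*t.n2 + x*t.o12+z*t.o23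
  · linear_combination z*t.n3 + x*t.o13+y*t.o23

theorem ON.cross {a b c a' b' c' : ℝ} (n1 : a^2+b^2+c^2 = 1) (n2 : a'^2+b'^2+c'^2 = 1) (o : a*a'+b*b'+c*c' = 0) :
    ON a b c a' b' c' (b*c'-c*b') (c*a'-a*c') (a*b'-b*a') := by
  refine ⟨n1,n2,?_,o,by ring,by ring⟩
  linear_combination (a'^2+b'^2+c'^2)*n1 + n2 - (a*a'+b*b'+c*c')*o

theorem ON.rot {a b c a' b' c' a'' b'' c'' : ℝ} (h : ON a b c a' b' c' a'' b'' c'') :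
    ON a' b' c' a'' b'' c'' a b c :=
  ⟨h.n2,h.n3,h.n1,h.o23,by linarith [h.o12],by linarith [h.o13]⟩

theorem exists_orth (a b c : ℝ) (n1 : a^2+b^2+c^2 = 1) : ∃ a' b' c' : ℝ, a'^2+b'^2+c'^2 = 1 ∧ a*a'+b*b'+c*c' = 0 := by
  rcases eq_or_lt_of_le (by positivity : 0 ≤ a^2+b^2) with hr | hr
  · have hx : a = 0 := by nlinarith [sq_nonneg a, sq_nonneg b]
    exact ⟨1,0,0,by norm_num,by rw [hx]; ring⟩
  · refine ⟨-b/√(a^2+b^2), a/√(a^2+b^2), 0, ?_, by ring⟩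
    rw [div_pow, div_pow, Real.sq_sqrt hr.le]; field_simp; ring

theorem exists_ON (a b c : ℝ) (n1 : a^2+b^2+c^2 = 1) : ∃ a' b' c' a'' b'' c'', ON a' b' c' a'' b'' c'' a b c := by
  obtain ⟨a',b',c',h1,h2⟩ := exists_orth a b c n1
  exact ⟨_,_,_,_,_,_,(ON.cross n1 h1 h2).rot⟩

/-- coordinate free consequence -/
theorem propA' (ε : ℝ) (hε : 0 < ε) : ∃ δ > 0, ∀ (f : ℝ → ℝ → ℝ → ℝ) (W M : ℝ), Fr f W →
    (∀ x y z, 0 < x^2+y^2+z^2 → |f x y z| ≤ 2) → ∀ a b c, a^2+b^2+c^2 = 1 → 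
    (∀ x y z, 0 < x^2+y^2+z^2 → f x y z ≤ f a b c + δ) → (∀ x y z, 0 < x^2+y^2+z^2 → f x y z ≤ M) →
    ∀ x y z, x^2+y^2+z^2 = 1 → 
      (W - f a b c) + (3 * f a b c - W) * (x*a+y*b+z*c)^2 - ε - M ≤ f x y z := by
  obtain ⟨δ, hδ, H⟩ := propA ε hε
  refine ⟨δ, hδ, ?_⟩
  intro f W M hf hb a b c n1 hmax hM x y z hn
  obtain ⟨a',b',c',a'',b'',c'',hON⟩ := exists_ON a b c n1
  have h001 : pull f a' b' c' a'' b'' c'' a b c 0 0 1 = f a b c := by unfold pull; simp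
  have h1 := H (pull f a' b' c' a'' b'' c'' a b c) W (hf.pull hON)
    (fun x y z h => hb _ _ _ (by rw [hON.normSq]; exact h))
    (fun x y z h => by rw [h001]; exact hmax _ _ _ (by rw [hON.normSq]; exact h))
  have hT := hON.transpose
  have hns := hT.normSq x y z
  have h2 := h1 (x*a'+y*b'+z*c') (x*a''+y*b''+z*c'') (x*a+y*b+z*c) (by rw [hns, hn]; norm_num)
  rw [pull_inv f hON, h001, hns, hn, div_one] at h2
  have h3 : pull f a' b' c' a'' b'' c'' a b c (-(x*a''+y*b''+z*c'')) (x*a'+y*b'+z*c') (x*a+y*b+z*c) ≤ M := by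
    apply hM
    rw [hON.normSq]
    have : (-(x*a''+y*b''+z*c''))^2 + (x*a'+y*b'+z*c')^2 + (x*a+y*b+z*c)^2 = 1 := by linarith
    rw [this]; norm_num
  have := (abs_le.1 h2).1
  linarith


/-- quadratic model -/
noncomputable def qd (A B C D E F x y z : ℝ) : ℝ := (A*x^2+B*y^2+C*z^2+2*D*(x*y)+2*E*(x*z)+2*F*(y*z))/(x^2+y^2+z^2)

theorem Fr.qdiag (A B C : ℝ) : Fr (qd A B C 0 0 0) (A+B+C) := by
  constructor
  · intro c x y z hc
    unfold qd
    rw [show A*(c*x)^2+B*(c*y)^2+C*(c*z)^2+2*0*(c*x*(c*y))+2*0*(c*x*(c*z))+2*0*(c*y*(c*z)) = c^2*(A*x^2+B*y^2+C*z^2) by ring,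
      show (c*x)^2+(c*y)^2+(c*z)^2 = c^2*(x^2+y^2+z^2) by ring, mul_div_mul_left _ _ (by positivity)]
    ring
  · intro x y z x' y' z' x'' y'' z'' p1 p2 p3 o1 o2 o3
    obtain ⟨⟨h1,h2,h3⟩,h4,h5,h6⟩ := gram_transpose x y z x' y' z' x'' y'' z'' p1 p2 p3 o1 o2 o3
    unfold qd
    linear_combination A*h1+B*h2+C*h3

theorem Fr.sub {f g U V} (hf : Fr f U) (hg : Fr g V) : Fr (fun x y z => f x y z - g x y z) (U-V) := by
  constructor
  · intro c x y z hc; simp only [hf.hom c x y z hc, hg.hom c x y z hc]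
  · intro x y z x' y' z' x'' y'' z'' p1 p2 p3 o1 o2 o3
    linarith [hf.add x y z x' y' z' x'' y'' z'' p1 p2 p3 o1 o2 o3, hg.add x y z x' y' z' x'' y'' z'' p1 p2 p3 o1 o2 o3]

theorem Fr.cmul {f U} (hf : Fr f U) (k : ℝ) : Fr (fun x y z => k * f x y z) (k*U) := by
  constructor
  · intro c x y z hc; simp only [hf.hom c x y z hc]
  · intro x y z x' y' z' x'' y'' z'' p1 p2 p3 o1 o2 o3
    linear_combination k * hf.add x y z x' y' z' x'' y'' z'' p1 p2 p3 o1 o2 o3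

theorem near_max {f W B} (hf : Fr f W) (hb : ∀ x y z, 0 < x^2+y^2+z^2 → |f x y z| ≤ B) (δ : ℝ) (hδ : 0 < δ) :
    ∃ a b c, a^2+b^2+c^2 = 1 ∧ ∀ x y z, 0 < x^2+y^2+z^2 → f x y z ≤ f a b c + δ := by
  set S := {d : ℝ | ∃ x y z, 0 < x^2+y^2+z^2 ∧ d = f x y z} with hS
  have hSb : BddAbove S := ⟨B, by rintro d ⟨x,y,z,h,rfl⟩; exact (abs_le.1 (hb x y z h)).2⟩
  have hSn : S.Nonempty := ⟨_, 1, 0, 0, by norm_num, rfl⟩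
  obtain ⟨d, ⟨x,y,z,h,rfl⟩, hd⟩ := exists_lt_of_lt_csSup hSn (show sSup S - δ < sSup S by linarith)
  set n := √(x^2+y^2+z^2) with hn
  have hn0 : 0 < n := Real.sqrt_pos.2 h
  have hn2 : n^2 = x^2+y^2+z^2 := Real.sq_sqrt h.le
  refine ⟨n⁻¹*x, n⁻¹*y, n⁻¹*z, ?_, ?_⟩
  · have : (n⁻¹*x)^2+(n⁻¹*y)^2+(n⁻¹*z)^2 = (n⁻¹)^2*(x^2+y^2+z^2) := by ring
    rw [this, ← hn2]; field_simp
  · intro x' y' z' h'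
    rw [hf.hom _ _ _ _ (by positivity)]
    have := le_csSup hSb ⟨x',y',z',h',rfl⟩
    linarith

theorem decomp (a b c s1 s2 s3 : ℝ) (n : a^2+b^2+c^2 = 1) (ns : s1^2+s2^2+s3^2 = 1) :
    ∃ u v w α β, u^2+v^2+w^2 = 1 ∧ a*u+b*v+c*w = 0 ∧ s1 = α*a+β*u ∧ s2 = α*b+β*v ∧ s3 = α*c+β*w := by
  set α := a*s1+b*s2+c*s3 with hα
  set N := (s1-α*a)^2+(s2-α*b)^2+(s3-α*c)^2 with hN
  rcases eq_or_lt_of_le (by positivity : 0 ≤ N) with h | h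
  · obtain ⟨u,v,w,h1,h2⟩ := exists_orth a b c n
    have e1 : s1-α*a = 0 := by nlinarith [sq_nonneg (s1-α*a), sq_nonneg (s2-α*b), sq_nonneg (s3-α*c)]
    have e2 : s2-α*b = 0 := by nlinarith [sq_nonneg (s1-α*a), sq_nonneg (s2-α*b), sq_nonneg (s3-α*c)]
    have e3 : s3-α*c = 0 := by nlinarith [sq_nonneg (s1-α*a), sq_nonneg (s2-α*b), sq_nonneg (s3-α*c)]
    exact ⟨u,v,w,α,0,h1,h2,by linarith,by linarith,by linarith⟩
  · have hs : 0 < √N := Real.sqrt_pos.2 h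
    refine ⟨(s1-α*a)/√N, (s2-α*b)/√N, (s3-α*c)/√N, α, √N, ?_, ?_, ?_, ?_, ?_⟩
    · rw [div_pow, div_pow, div_pow, Real.sq_sqrt h.le, ← add_div, ← add_div, div_self h.ne']
    · field_simp
      linear_combination (-α)*n - hα
    all_goals field_simp; ring

theorem comb (a b c : ℝ) (n : a^2+b^2+c^2 = 1) (h1 : ∀ σ : ℝ, σ^2 = 1 → (2*(a*b)+σ*c^2)^2 ≤ 0.36)
    (h2 : ∀ σ : ℝ, σ^2 = 1 → (2*(b*c)+σ*a^2)^2 ≤ 0.36) (h3 : ∀ σ : ℝ, σ^2 = 1 → (2*(a*c)+σ*b^2)^2 ≤ 0.36) : False := by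
  have key : ∀ x y z : ℝ, (∀ σ : ℝ, σ^2 = 1 → (2*(x*y)+σ*z^2)^2 ≤ 0.36) → 2*(|x| * |y|)+z^2 ≤ 0.6 := by
    intro x y z h
    have e1 := abs_le_of_sq_le_sq' (show (2*(x*y)+1*z^2)^2 ≤ (0.6:ℝ)^2 by
      have := h 1 (by norm_num); norm_num at this ⊢; linarith) (by norm_num : (0:ℝ) ≤ 0.6)
    have e2 := abs_le_of_sq_le_sq' (show (2*(x*y)+(-1)*z^2)^2 ≤ (0.6:ℝ)^2 by
      have := h (-1) (by norm_num); norm_num at this ⊢; linarith) (by norm_num : (0:ℝ) ≤ 0.6)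
    rw [← abs_mul]
    rcases abs_cases (x*y) with ⟨h1,-⟩ | ⟨h1,-⟩ <;> rw [h1] <;> linarith [e1.1, e1.2, e2.1, e2.2]
  have k1 := key a b c h1
  have k2 := key b c a h2
  have k3 := key a c b h3
  rw [← sq_abs a, ← sq_abs b, ← sq_abs c] at n
  rw [← sq_abs c] at k1; rw [← sq_abs a] at k2; rw [← sq_abs b] at k3
  have p1 := abs_nonneg a
  have p2 := abs_nonneg b
  have p3 := abs_nonneg c
  generalize |a| = x at *
  generalize |b| = y at *
  generalize |c| = z at *
  have hS : x*y+y*z+x*z ≤ 0.4 := by linarith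
  have q1 : 0 ≤ x*y := by positivity
  have q2 : 0 ≤ y*z := by positivity
  have q3 : 0 ≤ x*z := by positivity
  have hS2 : (x*y+y*z+x*z)^2 ≤ 0.16 := by nlinarith
  have hS3 : (x*y)^2+(y*z)^2+(x*z)^2 ≤ 0.16 := by nlinarith [mul_nonneg q1 q2, mul_nonneg q1 q3, mul_nonneg q2 q3]
  have h4 : x^2*x^2+y^2*y^2+z^2*z^2 ≤ 0.6 := by
    nlinarith [sq_nonneg x, sq_nonneg y, sq_nonneg z, mul_nonneg (sq_nonneg x) (by linarith : 0 ≤ 0.6-x^2), mul_nonneg (sq_nonneg y) (by linarith : 0 ≤ 0.6-y^2), mul_nonneg (sq_nonneg z) (by linarith : 0 ≤ 0.6-z^2)]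
  have h5 : (x^2+y^2+z^2)^2 = 1 := by rw [n]; norm_num
  nlinarith

theorem anti_small (ε : ℝ) (hε : 0 < ε) (h : ℝ → ℝ → ℝ → ℝ) (hf : Fr h 0)
    (hb : ∀ x y z, 0 < x^2+y^2+z^2 → |h x y z| ≤ 2)
    (R1 : ∀ x y z, 0 < x^2+y^2+z^2 → |h x y z + h x (-z) y| ≤ ε)
    (R3 : ∀ x y z, 0 < x^2+y^2+z^2 → |h x y z + h (-y) x z| ≤ ε) :
    ∀ x y z, 0 < x^2+y^2+z^2 → |h x y z| ≤ 225*ε := by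
  obtain ⟨δ, hδ, H⟩ := propA' ε hε
  obtain ⟨a,b,c,n,hmax⟩ := near_max hf hb (min δ ε) (lt_min hδ hε)
  have hmaxδ : ∀ x y z, 0 < x^2+y^2+z^2 → h x y z ≤ h a b c + δ := fun x y z p => by
    linarith [hmax x y z p, min_le_left δ ε]
  have hmaxε : ∀ x y z, 0 < x^2+y^2+z^2 → h x y z ≤ h a b c + ε := fun x y z p => by
    linarith [hmax x y z p, min_le_right δ ε]
  have H1 := H h 0 (h a b c + ε) hf hb a b c n hmaxδ hmaxε
  have fx : ∀ x y z, 0 < x^2+y^2+z^2 → |h (-x) y z - h x y z| ≤ 2*ε := by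
    intro x y z p
    have e1 := abs_le.1 (R1 x y z p)
    have e2 := abs_le.1 (R1 x (-z) y (by linarith))
    have e3 := hf.hom (-1) x (-y) (-z) (by norm_num)
    simp only [neg_mul, one_mul, neg_neg] at e3
    rw [e3, abs_le]; constructor <;> linarith [e1.1, e1.2, e2.1, e2.2]
  have fz : ∀ x y z, 0 < x^2+y^2+z^2 → |h x y (-z) - h x y z| ≤ 2*ε := by
    intro x y z p
    have e1 := abs_le.1 (R3 x y z p)
    have e2 := abs_le.1 (R3 (-y) x z (by linarith))
    have e3 := hf.hom (-1) (-x) (-y) z (by norm_num)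
    simp only [neg_mul, one_mul, neg_neg] at e3
    rw [e3, abs_le]; constructor <;> linarith [e1.1, e1.2, e2.1, e2.2]
  have fy : ∀ x y z, 0 < x^2+y^2+z^2 → |h x (-y) z - h x y z| ≤ 4*ε := by
    intro x y z p
    have e1 := abs_le.1 (fx x y (-z) (by linarith))
    have e2 := abs_le.1 (fz x y z p)
    have e3 := hf.hom (-1) (-x) y (-z) (by norm_num)
    simp only [neg_mul, one_mul, neg_neg] at e3
    rw [e3, abs_le]; constructor <;> linarith [e1.1, e1.2, e2.1, e2.2]
  have sxy : ∀ x y z, 0 < x^2+y^2+z^2 → |h y x z + h x y z| ≤ 3*ε := by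
    intro x y z p
    have e1 := abs_le.1 (R3 x y z p)
    have e2 := abs_le.1 (fx y x z (by linarith))
    rw [abs_le]; constructor <;> linarith [e1.1, e1.2, e2.1, e2.2]
  have syz : ∀ x y z, 0 < x^2+y^2+z^2 → |h x z y + h x y z| ≤ 5*ε := by
    intro x y z p
    have e1 := abs_le.1 (R1 x y z p)
    have e2 := abs_le.1 (fy x z y (by linarith))
    rw [abs_le]; constructor <;> linarith [e1.1, e1.2, e2.1, e2.2]
  have sxz : ∀ x y z, 0 < x^2+y^2+z^2 → |h z y x + h x y z| ≤ 11*ε := by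
    intro x y z p
    have e1 := abs_le.1 (sxy x y z p)
    have e2 := abs_le.1 (syz y x z (by linarith))
    have e3 := abs_le.1 (sxy y z x (by linarith))
    rw [abs_le]; constructor <;> linarith [e1.1, e1.2, e2.1, e2.2, e3.1, e3.2]
  have n0 : 0 < a^2+b^2+c^2 := by rw [n]; norm_num
  have hm : h a b c ≤ 220*ε := by
    by_contra hcon
    push Not at hcon
    have fin : ∀ t : ℝ, -(h a b c) + 3 * h a b c * t^2 - ε - (h a b c + ε) ≤ - h a b c + 15*ε → t^2 ≤ 0.36 := by
      intro t ht
      by_contra h2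
      push Not at h2
      nlinarith
    have sg : ∀ σ : ℝ, σ^2 = 1 → σ = 1 ∨ σ = -1 := fun σ h => by
      have : (σ-1)*(σ+1) = 0 := by linear_combination h
      rcases mul_eq_zero.1 this with h | h
      · left; linarith
      · right; linarith
    apply comb a b c n
    · intro σ hσ
      have e1 := H1 b a (σ*c) (by rw [mul_pow, hσ]; linarith)
      have e2 := abs_le.1 (sxy a b c n0)
      have e3 := abs_le.1 (fz b a c (by linarith))
      apply fin
      rw [show b*a+a*b+σ*c*c = 2*(a*b)+σ*c^2 by ring] at e1
      rcases sg σ hσ with rfl | rfl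
      · simp only [one_mul] at e1 ⊢; linarith [e2.1, e2.2, e3.1, e3.2]
      · rw [show (-1:ℝ)*c = -c by ring] at e1; linarith [e2.1, e2.2, e3.1, e3.2]
    · intro σ hσ
      have e1 := H1 (σ*a) c b (by rw [mul_pow, hσ]; linarith)
      have e2 := abs_le.1 (syz a b c n0)
      have e3 := abs_le.1 (fx a c b (by linarith))
      apply fin
      rw [show σ*a*a+c*b+b*c = 2*(b*c)+σ*a^2 by ring] at e1
      rcases sg σ hσ with rfl | rfl
      · simp only [one_mul] at e1 ⊢; linarith [e2.1, e2.2, e3.1, e3.2]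
      · rw [show (-1:ℝ)*a = -a by ring] at e1; linarith [e2.1, e2.2, e3.1, e3.2]
    · intro σ hσ
      have e1 := H1 c (σ*b) a (by rw [mul_pow, hσ]; linarith)
      have e2 := abs_le.1 (sxz a b c n0)
      have e3 := abs_le.1 (fy c b a (by linarith))
      apply fin
      rw [show c*a+σ*b*b+a*c = 2*(a*c)+σ*b^2 by ring] at e1
      rcases sg σ hσ with rfl | rfl
      · simp only [one_mul] at e1 ⊢; linarith [e2.1, e2.2, e3.1, e3.2]
      · rw [show (-1:ℝ)*b = -b by ring] at e1; linarith [e2.1, e2.2, e3.1, e3.2]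
  intro x y z p
  have e1 := hmaxε x y z p
  have e2 := hmaxε x (-z) y (by linarith)
  have e3 := abs_le.1 (R1 x y z p)
  rw [abs_le]; constructor <;> linarith [e3.1]

theorem stepB {f W} (hf : Fr f W) (hb : ∀ x y z, 0 < x^2+y^2+z^2 → |f x y z| ≤ 1) (ε : ℝ) (hε : 0 < ε) :
    ∃ A B C D E F, ∀ x y z, 0 < x^2+y^2+z^2 → |f x y z - qd A B C D E F x y z| ≤ 225*ε := by
  obtain ⟨δ, hδ, H⟩ := propA ε hε
  obtain ⟨a,b,c,n,hmax⟩ := near_max hf hb (δ/2) (by linarith)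
  obtain ⟨s1,s2,s3,ns,hmin⟩ := near_max (hf.cmul (-1)) (B := 1) (by intro x y z p; rw [neg_one_mul, abs_neg]; exact hb x y z p)
    (δ/2) (by linarith)
  obtain ⟨a'',b'',c'',α,β,n'',o,d1,d2,d3⟩ := decomp a b c s1 s2 s3 n ns
  have hON := ON.cross n'' n (by linarith)
  set a' := b''*c-c''*b
  set b' := c''*a-a''*c
  set c' := a''*b-b''*a
  have hON2 : ON a b c a' b' c' a'' b'' c'' := hON.rot
  have hαβ : α^2+β^2 = 1 := by
    rw [← ns, d1, d2, d3]; linear_combination (-α^2)*n - β^2*n'' - 2*α*β*o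
  have hr : ∀ x y z, 0 < x^2+y^2+z^2 → f a'' b'' c'' ≤ f x y z + δ := by
    intro x y z p
    have e1 := hf.add a b c a' b' c' a'' b'' c'' (by rw [n]; norm_num) (by rw [hON2.n2]; norm_num) (by rw [n'']; norm_num)
      hON2.o12 hON2.o13 hON2.o23
    have n4 : (-β*a+α*a'')^2+(-β*b+α*b'')^2+(-β*c+α*c'')^2 = 1 := by
      rw [← hαβ]; linear_combination β^2*n+α^2*n''-2*α*β*o
    have e2 := hf.add s1 s2 s3 a' b' c' (-β*a+α*a'') (-β*b+α*b'') (-β*c+α*c'') (by rw [ns]; norm_num) (by rw [hON2.n2]; norm_num)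
      (by rw [n4]; norm_num) (by rw [d1, d2, d3]; linear_combination α*hON2.o12+β*hON2.o23)
      (by rw [d1, d2, d3]; linear_combination (-α*β)*n + α*β*n'' + (α^2-β^2)*o)
      (by linear_combination (-β)*hON2.o12+α*hON2.o23)
    have e3 := hmax _ _ _ (by rw [n4]; norm_num : 0 < (-β*a+α*a'')^2+(-β*b+α*b'')^2+(-β*c+α*c'')^2)
    have e4 := hmin x y z p
    linarith
  set F := pull f a b c a' b' c' a'' b'' c'' with hF
  have hFr : Fr F W := hf.pull hON2
  have F1 : F 1 0 0 = f a b c := by rw [hF]; unfold pull; simp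
  have F3 : F 0 0 1 = f a'' b'' c'' := by rw [hF]; unfold pull; simp
  have hFb : ∀ x y z, 0 < x^2+y^2+z^2 → |F x y z| ≤ 1 := fun x y z p => hb _ _ _ (by rw [hON2.normSq]; exact p)
  have hFW := hFr.add 1 0 0 0 1 0 0 0 1 (by norm_num) (by norm_num) (by norm_num) (by norm_num) (by norm_num) (by norm_num)
  have A3 := H (fun x y z => (-1) * F x y z) _ (hFr.cmul (-1)) (by
    intro x y z p; rw [neg_one_mul, abs_neg]; linarith [hFb x y z p]) (by
    intro x y z p; have := hr _ _ _ (show 0 < _ by rw [hON2.normSq x y z]; exact p)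
    rw [F3]; change f a'' b'' c'' ≤ F x y z + δ at this; linarith)
  have A1 := H (fun x y z => F z x y) W (by
    constructor
    · intro k x y z hk; exact hFr.hom k z x y hk
    · intro x y z x' y' z' x'' y'' z'' p1 p2 p3 o1 o2 o3
      exact hFr.add z x y z' x' y' z'' x'' y'' (by linarith) (by linarith) (by linarith) (by linarith) (by linarith) (by linarith)) (by
    intro x y z p; linarith [hFb z x y (by linarith)]) (by
    intro x y z p; have := hmax _ _ _ (show 0 < _ by rw [hON2.normSq z x y]; linarith)
    rw [F1]; change F z x y ≤ f a b c + δ/2 at this; linarith)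
  have hq := Fr.qdiag (F 1 0 0) (F 0 1 0) (F 0 0 1)
  have hh := hFr.sub hq
  rw [hFW, sub_self] at hh
  have hs := anti_small ε hε _ hh (by
    intro x y z p
    have e1 := hFb x y z p
    have e2 : |qd (F 1 0 0) (F 0 1 0) (F 0 0 1) 0 0 0 x y z| ≤ 1 := by
      have p1 := abs_le.1 (hFb 1 0 0 (by norm_num))
      have p2 := abs_le.1 (hFb 0 1 0 (by norm_num))
      have p3 := abs_le.1 (hFb 0 0 1 (by norm_num))
      unfold qd
      rw [abs_le, le_div_iff₀ p, div_le_iff₀ p]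
      constructor <;> nlinarith [sq_nonneg x, sq_nonneg y, sq_nonneg z]
    calc _ ≤ |F x y z| + |qd (F 1 0 0) (F 0 1 0) (F 0 0 1) 0 0 0 x y z| := abs_sub _ _
      _ ≤ 2 := by linarith) (by
    intro x y z p
    have e := A1 y z x (by linarith)
    have p' : y^2+z^2+x^2 ≠ 0 := by linarith
    have p'' : x^2+y^2+z^2 ≠ 0 := by linarith
    have p''' : x^2+(-z)^2+y^2 ≠ 0 := by nlinarith
    convert e using 2
    unfold qd
    rw [← hFW]
    rw [show y^2+z^2+x^2 = x^2+y^2+z^2 by ring, show x^2+(-z)^2+y^2 = x^2+y^2+z^2 by ring]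
    field_simp
    ring) (by
    intro x y z p
    have e := A3 x y z (by linarith)
    have p'' : x^2+y^2+z^2 ≠ 0 := by linarith
    rw [← abs_neg]
    convert e using 2
    unfold qd
    rw [← hFW]
    rw [show (-y)^2+x^2+z^2 = x^2+y^2+z^2 by ring]
    field_simp
    ring)
  refine ⟨F 1 0 0*a^2+F 0 1 0*a'^2+F 0 0 1*a''^2, F 1 0 0*b^2+F 0 1 0*b'^2+F 0 0 1*b''^2, F 1 0 0*c^2+F 0 1 0*c'^2+F 0 0 1*c''^2,
    F 1 0 0*a*b+F 0 1 0*a'*b'+F 0 0 1*a''*b'', F 1 0 0*a*c+F 0 1 0*a'*c'+F 0 0 1*a''*c'',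
    F 1 0 0*b*c+F 0 1 0*b'*c'+F 0 0 1*b''*c'', ?_⟩
  intro x y z p
  have hns := hON2.transpose.normSq x y z
  have := hs (x*a+y*b+z*c) (x*a'+y*b'+z*c') (x*a''+y*b''+z*c'') (by rw [hns]; exact p)
  have hpi := pull_inv f hON2 x y z
  rw [← hF] at hpi
  simp only [hpi] at this
  convert this using 3
  unfold qd
  rw [hns]
  congr 1
  ring

set_option maxHeartbeats 1000000 in
/-- Gleason's theorem for ℝ³ (bounded frame functions), polarised form -/
theorem gleason3 {f W B} (hf : Fr f W) (hb : ∀ x y z, 0 < x^2+y^2+z^2 → |f x y z| ≤ B) (x y z : ℝ) :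
    (x^2+y^2+z^2) * f x y z = x^2 * f 1 0 0 + y^2 * f 0 1 0 + z^2 * f 0 0 1 + x*y*(f 1 1 0 - f 1 (-1) 0)
      + x*z*(f 1 0 1 - f 1 0 (-1)) + y*z*(f 0 1 1 - f 0 1 (-1)) := by
  rcases eq_or_lt_of_le (by positivity : 0 ≤ x^2+y^2+z^2) with h | hp
  · have hx : x = 0 := by nlinarith [sq_nonneg x, sq_nonneg y, sq_nonneg z]
    have hy : y = 0 := by nlinarith [sq_nonneg x, sq_nonneg y, sq_nonneg z]
    have hz : z = 0 := by nlinarith [sq_nonneg x, sq_nonneg y, sq_nonneg z]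
    subst hx hy hz; ring
  set B' := max B 1 with hB'
  have hB0 : 0 < B' := lt_of_lt_of_le one_pos (le_max_right _ _)
  have hf' := hf.cmul B'⁻¹
  have hb' : ∀ x y z, 0 < x^2+y^2+z^2 → |B'⁻¹ * f x y z| ≤ 1 := by
    intro x y z p
    rw [abs_mul, abs_of_pos (by positivity), inv_mul_le_iff₀ hB0, mul_one]
    exact (hb x y z p).trans (le_max_left _ _)
  set g := fun x y z => B'⁻¹ * f x y z with hg
  suffices hT : (x^2+y^2+z^2) * g x y z - (x^2 * g 1 0 0 + y^2 * g 0 1 0 + z^2 * g 0 0 1 + x*y*(g 1 1 0 - g 1 (-1) 0)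
      + x*z*(g 1 0 1 - g 1 0 (-1)) + y*z*(g 0 1 1 - g 0 1 (-1))) = 0 by
    simp only [hg] at hT
    have : B'⁻¹ * ((x^2+y^2+z^2) * f x y z - (x^2 * f 1 0 0 + y^2 * f 0 1 0 + z^2 * f 0 0 1 + x*y*(f 1 1 0 - f 1 (-1) 0)
      + x*z*(f 1 0 1 - f 1 0 (-1)) + y*z*(f 0 1 1 - f 0 1 (-1)))) = 0 := by linear_combination hT
    rcases mul_eq_zero.1 this with h | h
    · exact absurd h (by positivity)
    · linarith
  by_contra hne
  set T := (x^2+y^2+z^2) * g x y z - (x^2 * g 1 0 0 + y^2 * g 0 1 0 + z^2 * g 0 0 1 + x*y*(g 1 1 0 - g 1 (-1) 0)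
      + x*z*(g 1 0 1 - g 1 0 (-1)) + y*z*(g 0 1 1 - g 0 1 (-1))) with hTdef
  have hTp : 0 < |T| := abs_pos.2 hne
  obtain ⟨A,B1,C,D,E,F,hq⟩ := stepB hf' hb' (|T|/(225*(8*(x^2+y^2+z^2)))) (by positivity)
  set e := |T|/(8*(x^2+y^2+z^2)) with he
  have hee : 225*(|T|/(225*(8*(x^2+y^2+z^2)))) = e := by rw [he]; field_simp
  rw [hee] at hq
  have he0 : 0 < e := by positivity
  set k := fun x y z => g x y z - qd A B1 C D E F x y z with hk
  have hkb : ∀ x y z, 0 < x^2+y^2+z^2 → |k x y z| ≤ e := hq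
  have hTk : T = (x^2+y^2+z^2) * k x y z - (x^2 * k 1 0 0 + y^2 * k 0 1 0 + z^2 * k 0 0 1 + x*y*(k 1 1 0 - k 1 (-1) 0)
      + x*z*(k 1 0 1 - k 1 0 (-1)) + y*z*(k 0 1 1 - k 0 1 (-1))) := by
    have hqq : (x^2+y^2+z^2) * qd A B1 C D E F x y z = A*x^2+B1*y^2+C*z^2+2*D*(x*y)+2*E*(x*z)+2*F*(y*z) := by
      unfold qd; field_simp
    rw [hTdef]
    simp only [hk]
    rw [mul_sub (x^2+y^2+z^2), hqq]
    unfold qd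
    norm_num
    ring
  have b0 := hkb x y z hp
  have b1 := hkb 1 0 0 (by norm_num)
  have b2 := hkb 0 1 0 (by norm_num)
  have b3 := hkb 0 0 1 (by norm_num)
  have b4 := hkb 1 1 0 (by norm_num)
  have b5 := hkb 1 (-1) 0 (by norm_num)
  have b6 := hkb 1 0 1 (by norm_num)
  have b7 := hkb 1 0 (-1) (by norm_num)
  have b8 := hkb 0 1 1 (by norm_num)
  have b9 := hkb 0 1 (-1) (by norm_num)
  have mb : ∀ s t : ℝ, |t| ≤ e → |s * t| ≤ |s| * e := fun s t h => by rw [abs_mul]; gcongr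
  have db : ∀ s t : ℝ, |s| ≤ e → |t| ≤ e → |s-t| ≤ 2*e := fun s t h h' => by
    calc _ ≤ |s| + |t| := abs_sub _ _
      _ ≤ _ := by linarith
  have mb2 : ∀ u v t : ℝ, |t| ≤ 2*e → |u*v*t| ≤ (u^2+v^2)*e := fun u v t h => by
    rw [abs_mul, abs_mul]
    have : 2*(|u| * |v|) ≤ u^2+v^2 := by rw [← sq_abs u, ← sq_abs v]; nlinarith [sq_nonneg (|u|-|v|)]
    have : |u| * |v| * |t| ≤ |u| * |v| * (2*e) := by gcongr
    nlinarith
  have c0 := mb (x^2+y^2+z^2) _ b0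
  have c1 := mb (x^2) _ b1
  have c2 := mb (y^2) _ b2
  have c3 := mb (z^2) _ b3
  have c4 := mb2 x y _ (db _ _ b4 b5)
  have c5 := mb2 x z _ (db _ _ b6 b7)
  have c6 := mb2 y z _ (db _ _ b8 b9)
  rw [abs_of_nonneg (show (0:ℝ) ≤ x^2+y^2+z^2 by positivity)] at c0
  rw [abs_of_nonneg (sq_nonneg x)] at c1
  rw [abs_of_nonneg (sq_nonneg y)] at c2
  rw [abs_of_nonneg (sq_nonneg z)] at c3
  have hTe : |T| = 8*(x^2+y^2+z^2)*e := by rw [he]; field_simp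
  have hlt : |T| ≤ 4*(x^2+y^2+z^2)*e := by
    rw [hTk, abs_le]
    rw [abs_le] at c0 c1 c2 c3 c4 c5 c6
    constructor <;> linarith [c0.1, c0.2, c1.1, c1.2, c2.1, c2.2, c3.1, c3.2, c4.1, c4.2, c5.1, c5.2, c6.1, c6.2]
  have : 0 < (x^2+y^2+z^2)*e := by positivity
  nlinarith

section BdSec
set_option linter.unusedSectionVars false
variable {A : Type*} [CStarAlgebra A] [PartialOrder A] [StarOrderedRing A]

/-- the projection of an isometry -/
theorem isom_proj {V : A} (h : star V * V = 1) : IsStarProjection (V * star V) := by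
  refine ⟨?_, ?_⟩
  · show V * star V * (V * star V) = V * star V
    rw [show V * star V * (V * star V) = V * (star V * V) * star V by noncomm_ring, h, mul_one]
  · show star (V * star V) = _
    simp

theorem conj_proj {V p : A} (h : star V * V = 1) (hp : IsStarProjection p) :
    IsStarProjection (V * p * star V) := by
  refine ⟨?_, ?_⟩
  · show V * p * star V * (V * p * star V) = V * p * star V
    rw [show V * p * star V * (V * p * star V) = V * (p * (star V * V) * p) * star V by noncomm_ring, h,
      mul_one, hp.1.eq]
  · show star (V * p * star V) = _
    simp [hp.2.star_eq, mul_assoc]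

theorem bd_rot {φ : A →ₗ[ℂ] ℂ} {C : ℝ} (hC : ∀ p, IsStarProjection p → ‖φ p‖ ≤ C)
    {s t : A} (hs : star s * s = 1) (ht : star t * t = 1) (hst : star s * t = 0)
    {x : A} (h0 : 0 ≤ x) (h1 : x ≤ 1) :
    ‖φ (s * x * star s) + φ (t * (1 - x) * star t)‖ ≤ C := by
  have hts : star t * s = 0 := by rw [← star_star (star t * s)]; simp [hst]
  have h1' : 0 ≤ 1 - x := sub_nonneg.2 h1
  set c := CFC.sqrt x
  set d := CFC.sqrt (1 - x)
  have hc : star c = c := (CFC.sqrt_nonneg x).isSelfAdjoint.star_eq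
  have hd : star d = d := (CFC.sqrt_nonneg (1-x)).isSelfAdjoint.star_eq
  have hcc : c * c = x := CFC.sqrt_mul_sqrt_self x
  have hdd : d * d = 1 - x := CFC.sqrt_mul_sqrt_self (1-x)
  have hV : star (s * c + t * d) * (s * c + t * d) = 1 := by
    simp only [star_add, star_mul, hc, hd]
    rw [show (c * star s + d * star t) * (s * c + t * d) = c * (star s * s) * c + c * (star s * t) * d
      + d * (star t * s) * c + d * (star t * t) * d by noncomm_ring, hs, ht, hst, hts]
    simp [hcc, hdd]
  have hV' : star (s * c - t * d) * (s * c - t * d) = 1 := by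
    simp only [star_sub, star_mul, hc, hd]
    rw [show (c * star s - d * star t) * (s * c - t * d) = c * (star s * s) * c - c * (star s * t) * d
      - d * (star t * s) * c + d * (star t * t) * d by noncomm_ring, hs, ht, hst, hts]
    simp [hcc, hdd]
  have e : φ (s * x * star s) + φ (t * (1 - x) * star t) =
    (1/2:ℂ) * (φ ((s * c + t * d) * star (s * c + t * d)) + φ ((s * c - t * d) * star (s * c - t * d))) := by
    rw [← map_add, ← map_add, ← smul_eq_mul (1/2:ℂ), ← map_smul]
    congr 1
    have : (s * c + t * d) * star (s * c + t * d) + (s * c - t * d) * star (s * c - t * d)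
      = (2:ℂ) • (s * x * star s + t * (1-x) * star t) := by
      simp only [star_add, star_sub, star_mul, hc, hd, two_smul]
      rw [← hdd, ← hcc]
      noncomm_ring
    rw [this, smul_smul]; norm_num
  rw [e, norm_mul]
  have a1 := hC _ (isom_proj hV)
  have a2 := hC _ (isom_proj hV')
  have := norm_add_le (φ ((s * c + t * d) * star (s * c + t * d))) (φ ((s * c - t * d) * star (s * c - t * d)))
  have e2 : ‖(1/2:ℂ)‖ = 1/2 := by norm_num
  rw [e2]
  linarith

/-- any element of a C*-algebra is a combination of four elements of the unit interval -/
theorem bd_four {L : A →ₗ[ℂ] ℂ} {C : ℝ} (h : ∀ x : A, 0 ≤ x → x ≤ 1 → ‖L x‖ ≤ C) (x : A) :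
    ‖L x‖ ≤ 4 * C * ‖x‖ := by
  have hC : 0 ≤ C := (norm_nonneg _).trans (h 0 le_rfl zero_le_one)
  have pos : ∀ x : A, 0 ≤ x → ‖L x‖ ≤ C * ‖x‖ := by
    intro x hx
    rcases eq_or_ne x 0 with rfl | hne
    · simp
    have hn : 0 < ‖x‖ := norm_pos_iff.2 hne
    have h1 : ((‖x‖⁻¹ : ℝ) • x) ≤ 1 := by
      have : ‖(‖x‖⁻¹ : ℝ) • x‖ ≤ 1 := by rw [norm_smul]; simp [hn.ne']
      exact (CStarAlgebra.norm_le_one_iff_of_nonneg _ (smul_nonneg (by positivity) hx)).1 this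
    have := h _ (smul_nonneg (by positivity) hx) h1
    rw [show ((‖x‖⁻¹ : ℝ) • x) = ((‖x‖⁻¹ : ℝ) : ℂ) • x from (Complex.coe_smul _ _).symm, map_smul, norm_smul] at this
    simp only [Complex.norm_real, norm_inv, norm_norm] at this
    rw [inv_mul_le_iff₀ hn] at this
    linarith
  have sa : ∀ x : A, IsSelfAdjoint x → ‖L x‖ ≤ 2 * C * ‖x‖ := by
    intro x hx
    have e := CFC.posPart_sub_negPart x hx
    have n1 : ‖x⁺‖ ≤ ‖x‖ := CStarAlgebra.norm_posPart_le x
    have n2 : ‖x⁻‖ ≤ ‖x‖ := CStarAlgebra.norm_negPart_le x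
    have p1 := pos x⁺ (CFC.posPart_nonneg x)
    have p2 := pos x⁻ (CFC.negPart_nonneg x)
    calc ‖L x‖ = ‖L x⁺ - L x⁻‖ := by rw [← map_sub, e]
      _ ≤ _ := norm_sub_le _ _
      _ ≤ _ := by nlinarith
  have e := realPart_add_I_smul_imaginaryPart x
  have n1 : ‖(realPart x : A)‖ ≤ ‖x‖ := realPart.norm_le x
  have n2 : ‖(imaginaryPart x : A)‖ ≤ ‖x‖ := imaginaryPart.norm_le x
  have p1 := sa _ (realPart x).2
  have p2 := sa _ (imaginaryPart x).2
  calc ‖L x‖ = ‖L (realPart x) + Complex.I * L (imaginaryPart x)‖ := by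
        rw [← smul_eq_mul, ← map_smul, ← map_add, e]
    _ ≤ ‖L (realPart x)‖ + ‖L (imaginaryPart x)‖ := (norm_add_le _ _).trans (by simp)
    _ ≤ _ := by nlinarith

/-- conjugation as a linear map -/
def cnj (r : A) : A →ₗ[ℂ] A where
  toFun x := r * x * star r
  map_add' x y := by noncomm_ring
  map_smul' c x := by simp

theorem cnj_apply (r x : A) : cnj r x = r * x * star r := rfl

theorem bd_diff {φ : A →ₗ[ℂ] ℂ} {C : ℝ} (hC : ∀ p, IsStarProjection p → ‖φ p‖ ≤ C)
    {s t : A} (hs : star s * s = 1) (ht : star t * t = 1) (hst : star s * t = 0) (x : A) :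
    ‖φ (s * x * star s) - φ (t * x * star t)‖ ≤ 8 * C * ‖x‖ := by
  have := bd_four (L := φ.comp (cnj s) - φ.comp (cnj t)) (C := 2 * C) (fun x h0 h1 => by
    have a := bd_rot hC hs ht hst h0 h1
    have b := hC _ (isom_proj ht)
    simp only [LinearMap.sub_apply, LinearMap.comp_apply, cnj_apply]
    have e : φ (s * x * star s) - φ (t * x * star t) =
      (φ (s * x * star s) + φ (t * (1 - x) * star t)) - φ (t * star t) := by
      rw [mul_sub, sub_mul, map_sub, mul_one]; ring
    rw [e]
    exact (norm_sub_le _ _).trans (by linarith)) x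
  simp only [LinearMap.sub_apply, LinearMap.comp_apply, cnj_apply] at this
  linarith

/-- the endomorphism attached to two orthogonal isometries -/
def amp (s t : A) (hs : star s * s = 1) (ht : star t * t = 1) (hst : star s * t = 0) :
    A →⋆ₙₐ[ℂ] A where
  toFun x := s * x * star s + t * x * star t
  map_smul' c x := by simp
  map_zero' := by simp
  map_add' x y := by noncomm_ring
  map_mul' x y := by
    have hts : star t * s = 0 := by rw [← star_star (star t * s)]; simp [hst]
    rw [show (s * x * star s + t * x * star t) * (s * y * star s + t * y * star t) =
      s * x * (star s * s) * y * star s + s * x * (star s * t) * y * star t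
      + t * x * (star t * s) * y * star s + t * x * (star t * t) * y * star t by noncomm_ring,
      hs, ht, hst, hts]
    noncomm_ring
  map_star' x := by simp [mul_assoc]

theorem amp_inv {s t : A} (hs : star s * s = 1) (ht : star t * t = 1) (hst : star s * t = 0) :
    ∃ N : A →L[ℂ] A, ∀ x, x = N x - (1/2:ℂ) • (s * N x * star s + t * N x * star t) ∧
      x = N x - (1/2:ℂ) • N (s * x * star s + t * x * star t) ∧ ‖N x‖ ≤ 2 * ‖x‖ := by
  have hT : ∀ x, ‖amp s t hs ht hst x‖ ≤ ‖x‖ := fun x => NonUnitalStarAlgHom.norm_apply_le _ x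
  let T : A →L[ℂ] A := LinearMap.mkContinuous (amp s t hs ht hst : A →ₗ[ℂ] A) 1 (fun x => by
    simpa using hT x)
  have hTx : ∀ x, T x = s * x * star s + t * x * star t := fun x => rfl
  have hn : ‖(1/2:ℂ) • T‖ < 1 := by
    rw [norm_smul]
    have : ‖T‖ ≤ 1 := LinearMap.mkContinuous_norm_le _ zero_le_one _
    have e2 : ‖(1/2:ℂ)‖ = 1/2 := by norm_num
    rw [e2]; linarith
  obtain ⟨u, hu⟩ := isUnit_one_sub_of_norm_lt_one hn
  refine ⟨(↑u⁻¹ : A →L[ℂ] A), fun x => ?_⟩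
  have h1 : (u : A →L[ℂ] A) * (↑u⁻¹ : A →L[ℂ] A) = 1 := u.mul_inv
  have h2 : (↑u⁻¹ : A →L[ℂ] A) * (u : A →L[ℂ] A) = 1 := u.inv_mul
  rw [hu] at h1 h2
  have h1' := congrArg (fun f : A →L[ℂ] A => f x) h1
  have h2' := congrArg (fun f : A →L[ℂ] A => f x) h2
  simp only [mul_apply_eq_comp, sub_apply, one_apply_eq_self,
    smul_apply, map_sub, map_smul] at h1' h2'
  refine ⟨?_, ?_, ?_⟩
  · rw [← hTx]; exact h1'.symm
  · rw [← hTx]; exact h2'.symm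
  · set y := (↑u⁻¹ : A →L[ℂ] A) x
    have : ‖y‖ ≤ ‖x‖ + 1/2 * ‖y‖ := by
      calc ‖y‖ = ‖x + (1/2:ℂ) • T y‖ := by rw [← h1']; simp
        _ ≤ ‖x‖ + ‖(1/2:ℂ) • T y‖ := norm_add_le _ _
        _ ≤ _ := by
          have e2 : ‖(1/2:ℂ)‖ = 1/2 := by norm_num
          rw [norm_smul, e2]
          have := hT y
          have : ‖T y‖ ≤ ‖y‖ := hT y
          linarith
    linarith

/-- inclusion-exclusion over corners -/
theorem incl_excl {a b c : A} (hab : a * b = 0) (hba : b * a = 0) (hac : a * c = 0) (hca : c * a = 0)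
    (hbc : b * c = 0) (hcb : c * b = 0) (x : A) :
    x = (1-a)*x*(1-a) + (1-b)*x*(1-b) + (1-c)*x*(1-c)
      - (1-a)*((1-b)*x*(1-b))*(1-a) - (1-b)*((1-c)*x*(1-c))*(1-b) - (1-c)*((1-a)*x*(1-a))*(1-c)
      + (1-a)*((1-b)*((1-c)*x*(1-c))*(1-b))*(1-a) := by
  have e1 : ∀ y : A, a * (b * y) = 0 := fun y => by rw [← mul_assoc, hab, zero_mul]
  have e2 : ∀ y : A, b * (a * y) = 0 := fun y => by rw [← mul_assoc, hba, zero_mul]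
  have e3 : ∀ y : A, a * (c * y) = 0 := fun y => by rw [← mul_assoc, hac, zero_mul]
  have e4 : ∀ y : A, c * (a * y) = 0 := fun y => by rw [← mul_assoc, hca, zero_mul]
  have e5 : ∀ y : A, b * (c * y) = 0 := fun y => by rw [← mul_assoc, hbc, zero_mul]
  have e6 : ∀ y : A, c * (b * y) = 0 := fun y => by rw [← mul_assoc, hcb, zero_mul]
  simp only [mul_sub, sub_mul, mul_one, one_mul, mul_assoc, e1, e2, e3, e4, e5, e6, hab, hba, hac, hca, hbc, hcb,
    mul_zero, zero_mul]
  abel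

theorem bd_corner {φ : A →ₗ[ℂ] ℂ} {C : ℝ} (hC : ∀ p, IsStarProjection p → ‖φ p‖ ≤ C)
    {s t : A} (hs : star s * s = 1) (ht : star t * t = 1) (hst : star s * t = 0)
    {r a : A} (hr : star r * r = 1) (ha : star a * a = 1) (hra : star r * a = 0) (x : A) :
    ‖φ (r * x * star r)‖ ≤ 32 * C * ‖x‖ := by
  obtain ⟨N, hN⟩ := amp_inv hs ht hst
  obtain ⟨h1, -, h3⟩ := hN x
  set y := N x
  have hiso : ∀ v : A, star v * v = 1 → star (r * v) * (r * v) = 1 ∧ star (r*v) * a = 0 := fun v hv => by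
    constructor
    · rw [star_mul, show star v * star r * (r * v) = star v * (star r * r) * v by noncomm_ring, hr, mul_one, hv]
    · rw [star_mul, mul_assoc, hra, mul_zero]
  have d0 := bd_diff hC hr ha hra y
  have d1 := bd_diff hC (hiso s hs).1 ha (hiso s hs).2 y
  have d2 := bd_diff hC (hiso t ht).1 ha (hiso t ht).2 y
  have e : φ (r * x * star r) = (φ (r * y * star r) - φ (a * y * star a))
    - (1/2:ℂ) * (φ ((r*s) * y * star (r*s)) - φ (a * y * star a))
    - (1/2:ℂ) * (φ ((r*t) * y * star (r*t)) - φ (a * y * star a)) := by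
    have : r * x * star r = r * y * star r - (1/2:ℂ) • ((r*s) * y * star (r*s))
      - (1/2:ℂ) • ((r*t) * y * star (r*t)) := by
      rw [h1]
      simp only [star_mul, mul_sub, sub_mul, mul_add, add_mul, smul_add, mul_smul_comm, smul_mul_assoc]
      simp only [← mul_assoc]
      abel
    rw [this, map_sub, map_sub, map_smul, map_smul, smul_eq_mul, smul_eq_mul]; ring
  have e2 : ‖(1/2:ℂ)‖ = 1/2 := by norm_num
  have hC0 : 0 ≤ C := (norm_nonneg _).trans (hC _ (isom_proj hs))
  calc ‖φ (r * x * star r)‖ ≤ 8 * C * ‖y‖ + 1/2 * (8 * C * ‖y‖) + 1/2 * (8 * C * ‖y‖) := by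
        rw [e]
        refine (norm_sub_le _ _).trans (add_le_add ((norm_sub_le _ _).trans (add_le_add d0 ?_)) ?_)
        · rw [norm_mul, e2]; gcongr
        · rw [norm_mul, e2]; gcongr
    _ ≤ _ := by nlinarith

/-- the isometry squeezing `1` into the complement of (part of) the range of `a` -/
def rr (a s : A) : A := 1 - a * star a + a * s * star a

theorem rr_isom {a s : A} (ha : star a * a = 1) (hs : star s * s = 1) : star (rr a s) * rr a s = 1 := by
  unfold rr
  have h : ∀ u v w : A, star (u) * u = 1 → u * star u * (u * star u) = u * star u := fun u v w h => (isom_proj h).1.eq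
  simp only [star_add, star_sub, star_mul, star_one, star_star]
  rw [show (1 - a * star a + a * (star s * star a)) * (1 - a * star a + a * s * star a)
    = 1 - a * star a - a * star a + a * (star a * a) * star a + (a - a * (star a * a)) * s * star a
     + a * star s * (star a - (star a * a) * star a) + a * star s * (star a * a) * s * star a by noncomm_ring, ha]
  rw [show a * star s * 1 * s * star a = a * (star s * s) * star a by noncomm_ring, hs]
  noncomm_ring

theorem rr_orth {a s t : A} (ha : star a * a = 1) (hst : star s * t = 0) : star (rr a s) * (a * t) = 0 := by
  unfold rr
  simp only [star_add, star_sub, star_mul, star_one, star_star]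
  rw [show (1 - a * star a + a * (star s * star a)) * (a * t) = a * t - a * (star a * a) * t +
    a * star s * (star a * a) * t by noncomm_ring, ha, mul_one, mul_one, mul_assoc a, hst]
  simp

theorem rr_fix {a s x : A} (ha : star a * x = 0) (hx : x * a = 0) : rr a s * x * star (rr a s) = x := by
  unfold rr
  simp only [star_add, star_sub, star_mul, star_one, star_star]
  rw [show (1 - a * star a + a * s * star a) * x * (1 - a * star a + a * (star s * star a))
    = x - a * (star a * x) - (x * a) * star a + a * (star a * x) * a * star a
     + a * s * (star a * x) * (1 - a * star a + a * (star s * star a))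
     + (x * a) * star s * star a - a * star a * (x * a) * star s * star a by noncomm_ring, ha, hx]
  simp

theorem corner_orth {a : A} (ha : star a * a = 1) (x : A) :
    star a * ((1 - a * star a) * x * (1 - a * star a)) = 0 ∧ ((1 - a * star a) * x * (1 - a * star a)) * a = 0 := by
  constructor
  · rw [show star a * ((1 - a * star a) * x * (1 - a * star a)) =
      (star a - (star a * a) * star a) * x * (1 - a * star a) by noncomm_ring, ha]; simp
  · rw [show ((1 - a * star a) * x * (1 - a * star a)) * a =
      (1 - a * star a) * x * (a - a * (star a * a)) by noncomm_ring, ha]; simp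

theorem norm_one_sub_isom {a : A} (ha : star a * a = 1) : ‖1 - a * star a‖ ≤ 1 :=
  ((isom_proj ha).one_sub).norm_le

theorem norm_corner {a : A} (ha : star a * a = 1) (x : A) :
    ‖(1 - a * star a) * x * (1 - a * star a)‖ ≤ ‖x‖ := by
  have h := norm_one_sub_isom ha
  calc _ ≤ ‖1 - a * star a‖ * ‖x‖ * ‖1 - a * star a‖ := norm_mul₃_le
    _ ≤ 1 * ‖x‖ * 1 := by gcongr
    _ = _ := by ring

theorem bd_inf {s t : A} (hs : star s * s = 1) (ht : star t * t = 1) (hst : star s * t = 0)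
    {φ : A →ₗ[ℂ] ℂ} {C : ℝ} (hC : ∀ p, IsStarProjection p → ‖φ p‖ ≤ C) (x : A) :
    ‖φ x‖ ≤ 224 * C * ‖x‖ := by
  have key : ∀ a, star a * a = 1 → ∀ x, ‖φ ((1 - a * star a) * x * (1 - a * star a))‖ ≤ 32 * C * ‖x‖ := by
    intro a ha x
    have h := corner_orth ha x
    rw [← rr_fix (s := s) h.1 h.2]
    have hat : star (a * t) * (a * t) = 1 := by
      rw [star_mul, show star t * star a * (a * t) = star t * (star a * a) * t by noncomm_ring, ha, mul_one, ht]
    refine (bd_corner hC hs ht hst (rr_isom ha hs) hat (rr_orth ha hst) _).trans ?_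
    have hC0 : 0 ≤ C := (norm_nonneg _).trans (hC _ (isom_proj hs))
    have := norm_corner ha x
    gcongr
  have hts : star t * s = 0 := by rw [← star_star (star t * s)]; simp [hst]
  have iso : ∀ u v : A, star u * u = 1 → star v * v = 1 → star (u*v) * (u*v) = 1 := fun u v hu hv => by
    rw [star_mul, show star v * star u * (u * v) = star v * (star u * u) * v by noncomm_ring, hu, mul_one, hv]
  have z : ∀ u v : A, star u * v = 0 → (u * star u) * (v * star v) = 0 := fun u v h => by
    rw [show (u * star u) * (v * star v) = u * (star u * v) * star v by noncomm_ring, h]; simp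
  have z1 : star s * (t * s) = 0 := by rw [← mul_assoc, hst, zero_mul]
  have z2 : star s * (t * t) = 0 := by rw [← mul_assoc, hst, zero_mul]
  have z3 : star (t * s) * s = 0 := by rw [star_mul, mul_assoc, hts, mul_zero]
  have z4 : star (t * t) * s = 0 := by rw [star_mul, mul_assoc, hts, mul_zero]
  have z5 : star (t * s) * (t * t) = 0 := by
    rw [star_mul, show star s * star t * (t * t) = star s * (star t * t) * t by noncomm_ring, ht, mul_one, hst]
  have z6 : star (t * t) * (t * s) = 0 := by
    rw [star_mul, show star t * star t * (t * s) = star t * (star t * t) * s by noncomm_ring, ht, mul_one, hts]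
  have hC0 : 0 ≤ C := (norm_nonneg _).trans (hC _ (isom_proj hs))
  have e := incl_excl (z _ _ z1) (z _ _ z3) (z _ _ z2) (z _ _ z4) (z _ _ z5) (z _ _ z6) x
  have k1 := key s hs
  have k2 := key (t*s) (iso _ _ ht hs)
  have k3 := key (t*t) (iso _ _ ht ht)
  have n1 := norm_corner hs x
  have n2 := norm_corner (iso _ _ ht hs) x
  have n3 := norm_corner (iso _ _ ht ht) x
  have n2' := norm_corner (iso _ _ ht hs)
  generalize s * star s = a at *
  generalize t * s * star (t * s) = b at *
  generalize t * t * star (t * t) = c at *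
  have m1 : ‖φ ((1-a)*((1-b)*x*(1-b))*(1-a))‖ ≤ 32 * C * ‖x‖ := (k1 _).trans (by gcongr)
  have m2 : ‖φ ((1-b)*((1-c)*x*(1-c))*(1-b))‖ ≤ 32 * C * ‖x‖ := (k2 _).trans (by gcongr)
  have m3 : ‖φ ((1-c)*((1-a)*x*(1-a))*(1-c))‖ ≤ 32 * C * ‖x‖ := (k3 _).trans (by gcongr)
  have m4 : ‖φ ((1-a)*((1-b)*((1-c)*x*(1-c))*(1-b))*(1-a))‖ ≤ 32 * C * ‖x‖ := (k1 _).trans (by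
    have := n2' ((1-c)*x*(1-c))
    gcongr
    linarith)
  calc ‖φ x‖ ≤ 32*C*‖x‖ + 32*C*‖x‖ + 32*C*‖x‖ + 32*C*‖x‖ + 32*C*‖x‖ + 32*C*‖x‖ + 32*C*‖x‖ := by
        conv_lhs => rw [e]
        simp only [map_add, map_sub]
        refine (norm_add_le _ _).trans (add_le_add ((norm_sub_le _ _).trans (add_le_add ((norm_sub_le _ _).trans (add_le_add
          ((norm_sub_le _ _).trans (add_le_add ((norm_add_le _ _).trans (add_le_add
          ((norm_add_le _ _).trans (add_le_add (k1 x) (k2 x))) (k3 x))) m1)) m2)) m3)) m4)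
    _ = _ := by ring
end BdSec

section FrameSec
set_option linter.unusedSectionVars false
variable {A : Type*} [Ring A] [StarRing A] [Algebra ℝ A] [StarModule ℝ A]

/-- bounded finitely additive measures on projections -/
structure PMeas (m : A → ℂ) (C : ℝ) : Prop where
  add : ∀ p q, IsStarProjection p → IsStarProjection q → p * q = 0 → m (p + q) = m p + m q
  bd : ∀ p, IsStarProjection p → ‖m p‖ ≤ C

/-- Three by three matrix units -/
structure MU3 (e : Fin 3 → Fin 3 → A) : Prop where
  st : ∀ i j, star (e i j) = e j i
  mu : ∀ i j k l, e i j * e k l = if j = k then e i l else 0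

noncomputable def MM (e : Fin 3 → Fin 3 → A) (X : Matrix (Fin 3) (Fin 3) ℝ) : A := ∑ i, ∑ j, X i j • e i j

theorem MM_add (e : Fin 3 → Fin 3 → A) (X Y) : MM e (X + Y) = MM e X + MM e Y := by
  simp [MM, add_smul, Finset.sum_add_distrib]

theorem MM_zero (e : Fin 3 → Fin 3 → A) : MM e 0 = 0 := by simp [MM]

theorem MM_mul {e : Fin 3 → Fin 3 → A} (h : MU3 e) (X Y) : MM e (X * Y) = MM e X * MM e Y := by
  simp only [MM, Matrix.mul_apply, Fin.sum_univ_three, add_mul, mul_add, smul_mul_smul_comm, h.mu, add_smul]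
  simp
  abel

theorem MM_star {e : Fin 3 → Fin 3 → A} (h : MU3 e) (X) : star (MM e X) = MM e X.transpose := by
  simp only [MM, star_sum, star_smul, h.st, star_trivial, Matrix.transpose_apply]
  rw [Finset.sum_comm]

/-- rank one real projection matrix -/
noncomputable def rk (x y z : ℝ) : Matrix (Fin 3) (Fin 3) ℝ :=
  !![x*x/(x^2+y^2+z^2), x*y/(x^2+y^2+z^2), x*z/(x^2+y^2+z^2);
     x*y/(x^2+y^2+z^2), y*y/(x^2+y^2+z^2), y*z/(x^2+y^2+z^2);
     x*z/(x^2+y^2+z^2), y*z/(x^2+y^2+z^2), z*z/(x^2+y^2+z^2)]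

theorem rk_tr (x y z : ℝ) : (rk x y z).transpose = rk x y z := by
  ext i j; fin_cases i <;> fin_cases j <;> simp [rk]

theorem rk_idem (x y z : ℝ) (h : 0 < x^2+y^2+z^2) : rk x y z * rk x y z = rk x y z := by
  set N := x^2+y^2+z^2 with hN
  have h0 := h.ne'
  ext i j; fin_cases i <;> fin_cases j <;> simp [rk, Matrix.mul_apply, Fin.sum_univ_three, ← hN] <;> field_simp <;>
    rw [hN] <;> ring

theorem rk_orth (x y z x' y' z' : ℝ) (o : x*x'+y*y'+z*z' = 0) : rk x y z * rk x' y' z' = 0 := by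
  set N := x^2+y^2+z^2 with hN
  set N' := x'^2+y'^2+z'^2 with hN'
  have key : ∀ a b : ℝ, a*x/N*(x'*b/N') + a*y/N*(y'*b/N') + a*z/N*(z'*b/N') = 0 := fun a b => by
    linear_combination (a/N*b/N') * o
  ext i j; fin_cases i <;> fin_cases j <;> simp [rk, Matrix.mul_apply, Fin.sum_univ_three, ← hN, ← hN']
  · linear_combination key x x'
  · linear_combination key x y'
  · linear_combination key x z'
  · linear_combination key y x'
  · linear_combination key y y'
  · linear_combination key y z'
  · linear_combination key z x'
  · linear_combination key z y'
  · linear_combination key z z'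

theorem rk_sum (a b c a' b' c' a'' b'' c'' : ℝ) (p1 : 0 < a^2+b^2+c^2) (p2 : 0 < a'^2+b'^2+c'^2)
    (p3 : 0 < a''^2+b''^2+c''^2) (o12 : a*a'+b*b'+c*c' = 0) (o13 : a*a''+b*b''+c*c'' = 0)
    (o23 : a'*a''+b'*b''+c'*c'' = 0) : rk a b c + rk a' b' c' + rk a'' b'' c'' = 1 := by
  obtain ⟨⟨h1,h2,h3⟩,h4,h5,h6⟩ := gram_transpose a b c a' b' c' a'' b'' c'' p1 p2 p3 o12 o13 o23
  ext i j; fin_cases i <;> fin_cases j <;> simp [rk]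
  · linear_combination h1
  · linear_combination h4
  · linear_combination h5
  · linear_combination h4
  · linear_combination h2
  · linear_combination h6
  · linear_combination h5
  · linear_combination h6
  · linear_combination h3

theorem rk_hom (c x y z : ℝ) (hc : c ≠ 0) : rk (c*x) (c*y) (c*z) = rk x y z := by
  have key : ∀ a b : ℝ, c*a*(c*b)/((c*x)^2+(c*y)^2+(c*z)^2) = a*b/(x^2+y^2+z^2) := fun a b => by
    rw [show (c*x)^2+(c*y)^2+(c*z)^2 = c^2*(x^2+y^2+z^2) by ring, show c*a*(c*b) = c^2*(a*b) by ring,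
      mul_div_mul_left _ _ (by positivity)]
  unfold rk
  simp only [key]

theorem frame_gleason {e : Fin 3 → Fin 3 → A} (he : MU3 e) {m : A → ℂ} {C : ℝ} (hm : PMeas m C) (x y z : ℝ) :
    ((x^2+y^2+z^2 : ℝ) : ℂ) * m (MM e (rk x y z)) =
      x^2 * m (MM e (rk 1 0 0)) + y^2 * m (MM e (rk 0 1 0)) + z^2 * m (MM e (rk 0 0 1))
      + x*y*(m (MM e (rk 1 1 0)) - m (MM e (rk 1 (-1) 0)))
      + x*z*(m (MM e (rk 1 0 1)) - m (MM e (rk 1 0 (-1))))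
      + y*z*(m (MM e (rk 0 1 1)) - m (MM e (rk 0 1 (-1)))) := by
  have pr : ∀ x y z : ℝ, 0 < x^2+y^2+z^2 → IsStarProjection (MM e (rk x y z)) := fun x y z h =>
    ⟨by show _ * _ = _; rw [← MM_mul he, rk_idem x y z h], by show star _ = _; rw [MM_star he, rk_tr]⟩
  have hadd : ∀ x y z x' y' z' x'' y'' z'', 0 < x^2+y^2+z^2 → 0 < x'^2+y'^2+z'^2 →
    0 < x''^2+y''^2+z''^2 → x*x'+y*y'+z*z' = 0 → x*x''+y*y''+z*z'' = 0 →
    x'*x''+y'*y''+z'*z'' = 0 → m (MM e (rk x y z)) + m (MM e (rk x' y' z')) + m (MM e (rk x'' y'' z'')) =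
      m (MM e 1) := by
    intro x y z x' y' z' x'' y'' z'' p1 p2 p3 o1 o2 o3
    have q1 := pr _ _ _ p1
    have q2 := pr _ _ _ p2
    have q3 := pr _ _ _ p3
    have z12 : MM e (rk x y z) * MM e (rk x' y' z') = 0 := by rw [← MM_mul he, rk_orth _ _ _ _ _ _ o1, MM_zero]
    have z21 : MM e (rk x' y' z') * MM e (rk x y z) = 0 := by
      rw [← MM_mul he, rk_orth _ _ _ _ _ _ (by linarith), MM_zero]
    have z13 : MM e (rk x y z) * MM e (rk x'' y'' z'') = 0 := by rw [← MM_mul he, rk_orth _ _ _ _ _ _ o2, MM_zero]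
    have z23 : MM e (rk x' y' z') * MM e (rk x'' y'' z'') = 0 := by rw [← MM_mul he, rk_orth _ _ _ _ _ _ o3, MM_zero]
    rw [← rk_sum x y z x' y' z' x'' y'' z'' p1 p2 p3 o1 o2 o3, MM_add, MM_add,
      hm.add _ _ ?_ q3 (by rw [add_mul, z13, z23, add_zero]), hm.add _ _ q1 q2 z12]
    refine ⟨?_, ?_⟩
    · show _ * _ = _
      rw [add_mul, mul_add, mul_add, z12, z21, q1.1.eq, q2.1.eq]; simp
    · exact q1.2.add q2.2
  have f1 : Fr (fun x y z => (m (MM e (rk x y z))).re) (m (MM e 1)).re :=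
    ⟨fun c x y z hc => by simp only [rk_hom c x y z hc], fun x y z x' y' z' x'' y'' z'' p1 p2 p3 o1 o2 o3 => by
      rw [← hadd x y z x' y' z' x'' y'' z'' p1 p2 p3 o1 o2 o3]; simp⟩
  have f2 : Fr (fun x y z => (m (MM e (rk x y z))).im) (m (MM e 1)).im :=
    ⟨fun c x y z hc => by simp only [rk_hom c x y z hc], fun x y z x' y' z' x'' y'' z'' p1 p2 p3 o1 o2 o3 => by
      rw [← hadd x y z x' y' z' x'' y'' z'' p1 p2 p3 o1 o2 o3]; simp⟩
  have g1 := gleason3 f1 (B := C) (fun x y z h => (Complex.abs_re_le_norm _).trans (hm.bd _ (pr x y z h))) x y z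
  have g2 := gleason3 f2 (B := C) (fun x y z h => (Complex.abs_im_le_norm _).trans (hm.bd _ (pr x y z h))) x y z
  simp only [← Complex.ofReal_pow, ← Complex.ofReal_mul]
  apply Complex.ext
  · simp only [Complex.add_re, Complex.re_ofReal_mul, Complex.sub_re, g1]
  · simp only [Complex.add_im, Complex.im_ofReal_mul, Complex.sub_im, g2]

theorem frame_lin {e : Fin 3 → Fin 3 → A} (he : MU3 e) {m : A → ℂ} {C : ℝ} (hm : PMeas m C) (α β : ℝ)
    (h : α^2+β^2 = 1) :
    m (MM e (rk 1 α β)) - m (MM e (rk 1 (-α) (-β))) =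
      α * (m (MM e (rk 1 1 0)) - m (MM e (rk 1 (-1) 0))) + β * (m (MM e (rk 1 0 1)) - m (MM e (rk 1 0 (-1)))) := by
  have h1 := frame_gleason he hm 1 α β
  have h2 := frame_gleason he hm 1 (-α) (-β)
  rw [show (1:ℝ)^2+α^2+β^2 = 2 by linarith] at h1
  rw [show (1:ℝ)^2+(-α)^2+(-β)^2 = 2 by linarith] at h2
  push_cast at h1 h2
  linear_combination (1/2) * h1 - (1/2) * h2
end FrameSec

section LocAdd
variable {X : Type*} [NormedAddCommGroup X] [NormedSpace ℝ X]

theorem local_add_ext {f : X → ℂ} {δ M : ℝ} (hδ : 0 < δ)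
    (hadd : ∀ x y, ‖x‖ < δ → ‖y‖ < δ → f (x + y) = f x + f y) (hM : ∀ x, ‖x‖ < δ → ‖f x‖ ≤ M) :
    ∃ G : X →L[ℝ] ℂ, ∀ x, ‖x‖ < δ → G x = f x := by
  have hsm : ∀ (x : X) (n : ℕ), 0 < n → ‖x‖ < δ * n → ‖(n:ℝ)⁻¹ • x‖ < δ := by
    intro x n hn h
    have : (0:ℝ) < n := by exact_mod_cast hn
    rw [norm_smul, norm_inv, Real.norm_of_nonneg this.le, inv_mul_lt_iff₀ this]; linarith
  have hmul : ∀ (n : ℕ) (x : X), ‖(n:ℝ) • x‖ < δ → f ((n:ℝ) • x) = n * f x := by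
    have f0 : f 0 = 0 := by
      have := hadd 0 0 (by simpa) (by simpa)
      simpa using this
    intro n x
    induction n with
    | zero => intro _; simp [f0]
    | succ k ih =>
      intro h
      rw [norm_smul] at h
      have e : ‖((k+1 : ℕ):ℝ)‖ = k + 1 := by rw [Real.norm_of_nonneg (by positivity)]; push_cast; ring
      rw [e] at h
      have hx := norm_nonneg x
      have hk : ‖(k:ℝ) • x‖ < δ := by
        rw [norm_smul, Real.norm_of_nonneg (by positivity)]; nlinarith
      have hx' : ‖x‖ < δ := by
        have : (0:ℝ) ≤ k := by positivity
        nlinarith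
      push_cast
      rw [add_smul, one_smul, hadd _ _ hk hx', ih hk]; ring
  -- large index
  have hN : ∀ x : X, ∃ n : ℕ, 0 < n ∧ ‖x‖ < δ * n := fun x => by
    obtain ⟨n, hn⟩ := exists_nat_gt (‖x‖ / δ)
    refine ⟨n + 1, by positivity, ?_⟩
    rw [div_lt_iff₀ hδ] at hn
    push_cast; nlinarith
  have hcmp : ∀ (x : X) (n k : ℕ), 0 < n → 0 < k → ‖x‖ < δ * n → ‖x‖ < δ * k →
      (n:ℂ) * f ((n:ℝ)⁻¹ • x) = k * f ((k:ℝ)⁻¹ • x) := by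
    have main : ∀ (x : X) (n k : ℕ), 0 < n → 0 < k → ‖x‖ < δ * n →
      (n:ℂ) * f ((n:ℝ)⁻¹ • x) = (n * k : ℂ) * f (((n * k : ℕ):ℝ)⁻¹ • x) := by
      intro x n k hn hk h
      have hk' : (k:ℝ) ≠ 0 := by positivity
      have e : (n:ℝ)⁻¹ • x = (k:ℝ) • (((n * k : ℕ):ℝ)⁻¹ • x) := by
        rw [smul_smul]; congr 1; push_cast; field_simp
      have h' := hsm x n hn h
      rw [e] at h' ⊢
      rw [hmul _ _ h']; ring
    intro x n k hn hk h1 h2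
    rw [main x n k hn hk h1, main x k n hk hn h2, mul_comm n k, mul_comm (n:ℂ)]
  choose N hN0 hN1 using hN
  have hG : ∀ (x : X) (n : ℕ), 0 < n → ‖x‖ < δ * n → (N x:ℂ) * f ((N x:ℝ)⁻¹ • x) = n * f ((n:ℝ)⁻¹ • x) :=
    fun x n hn h => hcmp x _ _ (hN0 x) hn (hN1 x) h
  let G0 : X →+ ℂ := AddMonoidHom.mk' (fun x => (N x:ℂ) * f ((N x:ℝ)⁻¹ • x)) (by
    intro x y
    set n := N x + N y + N (x+y)
    have hn : 0 < n := by have := hN0 x; omega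
    have hc : ((N x:ℝ) ≤ n) ∧ ((N y:ℝ) ≤ n) ∧ ((N (x+y):ℝ) ≤ n) := by
      refine ⟨?_, ?_, ?_⟩ <;> · norm_cast; omega
    have b1 : ‖x‖ < δ * n := (hN1 x).trans_le (by gcongr; exact_mod_cast hc.1)
    have b2 : ‖y‖ < δ * n := (hN1 y).trans_le (by gcongr; exact_mod_cast hc.2.1)
    have b3 : ‖x+y‖ < δ * n := (hN1 _).trans_le (by gcongr; exact_mod_cast hc.2.2)
    show (N (x+y):ℂ) * f ((N (x+y):ℝ)⁻¹ • (x+y)) = (N x:ℂ) * f ((N x:ℝ)⁻¹ • x) + (N y:ℂ) * f ((N y:ℝ)⁻¹ • y)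
    rw [hG x n hn b1, hG y n hn b2, hG _ n hn b3, smul_add, hadd _ _ (hsm x n hn b1) (hsm y n hn b2)]
    ring)
  have hG1 : ∀ x, ‖x‖ < δ → G0 x = f x := by
    intro x hx
    have := hG x 1 one_pos (by simpa using hx)
    show (N x:ℂ) * f ((N x:ℝ)⁻¹ • x) = f x
    simpa using this
  have hcont : Continuous G0 := by
    apply continuous_of_continuousAt_zero
    rw [ContinuousAt, map_zero, Metric.tendsto_nhds_nhds]
    intro ε hε
    obtain ⟨n, hn⟩ := exists_nat_gt (M / ε)
    refine ⟨δ / (n+1), by positivity, fun {x} hx => ?_⟩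
    rw [dist_zero_right] at hx ⊢
    have hx2 : ‖((n+1:ℕ):ℝ) • x‖ < δ := by
      rw [norm_smul, Real.norm_of_nonneg (by positivity)]
      rw [lt_div_iff₀ (by positivity)] at hx
      push_cast; linarith
    have hx1 : ‖x‖ < δ := hx.trans_le (by
      apply div_le_self hδ.le
      have : (0:ℝ) ≤ n := by positivity
      linarith)
    have h1 := hM _ hx2
    rw [hmul _ _ hx2, norm_mul] at h1
    rw [hG1 x hx1]
    rw [Complex.norm_natCast] at h1
    rw [div_lt_iff₀ hε] at hn
    push_cast at h1
    by_contra hcon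
    push Not at hcon
    have : (0:ℝ) ≤ n := by positivity
    nlinarith
  exact ⟨G0.toRealLinearMap hcont, fun x hx => hG1 x hx⟩
end LocAdd

section LemL
set_option linter.unusedSectionVars false
variable {A : Type*} [CStarAlgebra A] [PartialOrder A] [StarOrderedRing A]

structure GLin (g : A → ℂ) (B : ℝ) : Prop where
  lin : ∀ X Y : A, star X * X = 1 → star Y * Y = 1 → star X * Y = 0 → ∀ α β : ℝ, α^2 + β^2 = 1 →
    g (α • X + β • Y) = α * g X + β * g Y
  neg : ∀ X : A, star X * X = 1 → g (-X) = - g X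
  bd : ∀ X : A, star X * X = 1 → ‖g X‖ ≤ B

noncomputable def r2 : ℝ := (Real.sqrt 2)⁻¹
theorem r2_sq : r2 * r2 = 1/2 := by
  unfold r2; rw [← mul_inv, Real.mul_self_sqrt (by norm_num)]; norm_num
theorem r2_sq' : r2^2 + r2^2 = 1 := by have := r2_sq; nlinarith
theorem r2_pos : 0 < r2 := by unfold r2; positivity
theorem r2_sqC : (r2:ℂ) * (r2:ℂ) = 1/2 := by rw [← Complex.ofReal_mul, r2_sq]; norm_num

theorem iso_mul {u v : A} (hu : star u * u = 1) (hv : star v * v = 1) : star (u*v) * (u*v) = 1 := by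
  rw [star_mul, show star v * star u * (u * v) = star v * (star u * u) * v by noncomm_ring, hu, mul_one, hv]

theorem orth_mul {u v : A} (huv : star u * v = 0) (a b : A) : star (u*a) * (v*b) = 0 := by
  rw [star_mul, show star a * star u * (v * b) = star a * (star u * v) * b by noncomm_ring, huv]; simp

theorem orth_symm {u v : A} (huv : star u * v = 0) : star v * u = 0 := by
  rw [← star_star (star v * u)]; simp [huv]

theorem iso_I {u : A} (hu : star u * u = 1) : star (Complex.I • u) * (Complex.I • u) = 1 := by
  simp [star_smul, smul_smul, hu]

theorem iso_lin {X Y : A} (hX : star X * X = 1) (hY : star Y * Y = 1) (hXY : star X * Y = 0) {α β : ℝ}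
    (h : α^2 + β^2 = 1) : star (α • X + β • Y) * (α • X + β • Y) = 1 := by
  have hYX := orth_symm hXY
  simp only [star_add, star_smul, star_trivial, add_mul, mul_add, smul_mul_smul_comm, hX, hY, hXY, hYX]
  rw [smul_zero, smul_zero, add_zero, zero_add, ← add_smul, ← sq, ← sq, h, one_smul]

variable {g : A → ℂ} {B : ℝ}

/-- the basic rotation identity -/
theorem GU (hg : GLin g B) {U V e : A} (hU : star U * U = 1) (hV : star V * V = 1) (hUV : star U * V = 0)
    (h1 : star e * e = 1) (h2 : e * star e = 1) :
    g ((1/2:ℂ) • (U * (e + star e)) + (-(Complex.I/2)) • (V * (e - star e))) =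
      1/2 * (g (U * e) + g (U * star e)) + 1/2 * (g (Complex.I • (V * star e)) + g (-(Complex.I • (V * e)))) := by
  have hVU := orth_symm hUV
  have h2' : star (star e) * star e = 1 := by rw [star_star, h2]
  have i1 := iso_mul hU h1
  have i2 := iso_mul hU h2'
  have i3 := iso_I (iso_mul hV h1)
  have i3' : star (-(Complex.I • (V * e))) * (-(Complex.I • (V * e))) = 1 := by rw [star_neg, neg_mul_neg, i3]
  have i4 := iso_I (iso_mul hV h2')
  have o1 : star (U * e) * (-(Complex.I • (V * e))) = 0 := by
    rw [mul_neg, mul_smul_comm, orth_mul hUV]; simp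
  have o2 : star (U * star e) * (Complex.I • (V * star e)) = 0 := by
    rw [mul_smul_comm, orth_mul hUV]; simp
  have iX := iso_lin i1 i3' o1 r2_sq'
  have iY := iso_lin i2 i4 o2 r2_sq'
  have gX := hg.lin _ _ i1 i3' o1 _ _ r2_sq'
  have gY := hg.lin _ _ i2 i4 o2 _ _ r2_sq'
  have oXY : star (r2 • (U * e) + r2 • (-(Complex.I • (V * e)))) *
      (r2 • (U * star e) + r2 • (Complex.I • (V * star e))) = 0 := by
    simp only [star_add, star_smul, star_trivial, add_mul, mul_add, smul_mul_smul_comm, star_neg, star_mul,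
      mul_smul_comm, smul_mul_assoc, neg_mul]
    rw [show star e * star U * (U * star e) = star e * (star U * U) * star e by noncomm_ring, hU,
     show star e * star U * (V * star e) = star e * (star U * V) * star e by noncomm_ring, hUV,
     show star e * star V * (U * star e) = star e * (star V * U) * star e by noncomm_ring, hVU,
     show star e * star V * (V * star e) = star e * (star V * V) * star e by noncomm_ring, hV]
    simp only [mul_one, mul_zero, zero_mul, smul_zero, add_zero, star_neg, neg_zero]
    simp [smul_smul]
    rw [smul_comm Complex.I r2]
    simp only [smul_smul, Complex.I_mul_I, neg_smul, one_smul, smul_neg, add_neg_cancel]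
  have gXY := hg.lin _ _ iX iY oXY _ _ r2_sq'
  rw [gX, gY] at gXY
  have hee : r2 • (r2 • (U * e) + r2 • (-(Complex.I • (V * e)))) +
      r2 • (r2 • (U * star e) + r2 • (Complex.I • (V * star e)))
      = (1/2:ℂ) • (U * (e + star e)) + (-(Complex.I/2)) • (V * (e - star e)) := by
    simp only [smul_add, smul_smul, r2_sq, mul_add, mul_sub, smul_sub, smul_neg]
    have hr : ∀ y : A, ((1/2:ℝ)) • y = (1/2:ℂ) • y := fun y => by
      rw [← Complex.coe_smul]; norm_num
    simp only [hr, smul_smul, neg_smul]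
    rw [show (1/2:ℂ) * Complex.I = Complex.I/2 by ring]
    abel
  rw [hee] at gXY
  rw [gXY]
  linear_combination (g (U * e) + g (-(Complex.I • (V * e))) + g (U * star e) + g (Complex.I • (V * star e))) * r2_sqC

def nice (T : A) : Prop := ‖1 - (2:ℝ) • (star T * T)‖ < 1

/-- the polar data of a nice element -/
theorem nice_pos {t : A} (hs : IsSelfAdjoint t) (h : ‖1 - (2:ℝ) • t‖ < 1) : 0 ≤ t ∧ IsUnit t := by
  constructor
  · have sa : IsSelfAdjoint (1 - (2:ℝ) • t) := (IsSelfAdjoint.one A).sub ((IsSelfAdjoint.all (2:ℝ)).smul hs)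
    have h1 := sa.le_algebraMap_norm_self
    have h2 : algebraMap ℝ A ‖1 - (2:ℝ) • t‖ ≤ algebraMap ℝ A 1 := algebraMap_mono A h.le
    rw [map_one] at h2
    have h3 := h1.trans h2
    have h4 : 0 ≤ (2:ℝ) • t := by simpa using h3
    have := smul_nonneg (show (0:ℝ) ≤ 1/2 by norm_num) h4
    rwa [smul_smul, show (1/2:ℝ)*2 = 1 by norm_num, one_smul] at this
  · have h1 := isUnit_one_sub_of_norm_lt_one h
    rw [sub_sub_cancel] at h1
    have e : t = (algebraMap ℝ A (1/2)) * ((2:ℝ) • t) := by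
      rw [← Algebra.smul_def, smul_smul, show (1/2:ℝ)*2 = 1 by norm_num, one_smul]
    rw [e]
    exact (IsUnit.map (algebraMap ℝ A) (isUnit_iff_ne_zero.2 (by norm_num))).mul h1

theorem nice_compl {T R : A} (hT : nice T) (h : star T * T + star R * R = 1) : nice R := by
  unfold nice at *
  rw [show star R * R = 1 - star T * T from by rw [← h]; abel]
  rw [show 1 - (2:ℝ) • (1 - star T * T) = -(1 - (2:ℝ) • (star T * T)) by
    rw [smul_sub, two_smul ℝ (1:A)]; abel, norm_neg]
  exact hT

structure CS (c s : A) : Prop where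
  hc : star c = c
  hs : star s = s
  sq : c * c + s * s = 1
  comm : c * s = s * c
  uc : IsUnit c
  us : IsUnit s

theorem isUnit_of_mul_self {c t : A} (h : c * c = t) (ht : IsUnit t) : IsUnit c := by
  rw [← h] at ht
  exact isUnit_mul_self_iff.1 ht
end LemL

section LemL2
set_option linter.unusedSectionVars false
variable {A : Type*} [CStarAlgebra A] [PartialOrder A] [StarOrderedRing A]
variable {g : A → ℂ} {B : ℝ}

noncomputable def cT (T : A) : A := CFC.sqrt (star T * T)
noncomputable def sT (T : A) : A := CFC.sqrt (1 - star T * T)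
noncomputable def eT (T : A) : A := cT T + Complex.I • sT T
noncomputable def uT (T : A) : A := T * Ring.inverse (cT T)
noncomputable def gam (g : A → ℂ) (T : A) : ℂ := 1/2 * (g (uT T * eT T) + g (uT T * star (eT T)))

theorem nice_cs {T : A} (h : nice T) : CS (cT T) (sT T) := by
  have h1 := nice_pos (IsSelfAdjoint.star_mul_self T) h
  have h2 : 0 ≤ 1 - star T * T ∧ IsUnit (1 - star T * T) := by
    apply nice_pos ((IsSelfAdjoint.one A).sub (IsSelfAdjoint.star_mul_self T))
    rw [show 1 - (2:ℝ) • (1 - star T * T) = -(1 - (2:ℝ) • (star T * T)) by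
      rw [smul_sub, two_smul ℝ (1:A)]; abel, norm_neg]
    exact h
  have e1 : cT T * cT T = star T * T := CFC.sqrt_mul_sqrt_self _ h1.1
  have e2 : sT T * sT T = 1 - star T * T := CFC.sqrt_mul_sqrt_self _ h2.1
  refine ⟨(CFC.sqrt_nonneg _).isSelfAdjoint.star_eq, (CFC.sqrt_nonneg _).isSelfAdjoint.star_eq, ?_, ?_, ?_, ?_⟩
  · rw [e1, e2]; abel
  · have c1 : Commute (star T * T) (1 - star T * T) := (Commute.one_right _).sub_right (Commute.refl _)
    have c2 : Commute (cT T) (1 - star T * T) := by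
      unfold cT; rw [CFC.sqrt_eq_cfc]; exact c1.cfc_nnreal _
    have c3 : Commute (sT T) (cT T) := by
      unfold sT; rw [CFC.sqrt_eq_cfc]; exact c2.symm.cfc_nnreal _
    exact c3.symm.eq
  · exact isUnit_of_mul_self e1 h1.2
  · exact isUnit_of_mul_self e2 h2.2

theorem cT_sq {T : A} : cT T * cT T = star T * T := CFC.sqrt_mul_sqrt_self _ (star_mul_self_nonneg T)

theorem uT_mul {T : A} (h : nice T) : uT T * cT T = T := by
  unfold uT; rw [mul_assoc, Ring.inverse_mul_cancel _ (nice_cs h).uc, mul_one]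

theorem uT_iso {T : A} (h : nice T) : star (uT T) * uT T = 1 := by
  have hc := nice_cs h
  unfold uT
  rw [star_mul, ← Ring.inverse_star, hc.hc, show Ring.inverse (cT T) * star T * (T * Ring.inverse (cT T)) =
    Ring.inverse (cT T) * (star T * T) * Ring.inverse (cT T) by noncomm_ring, ← cT_sq, ← mul_assoc,
    Ring.inverse_mul_cancel _ hc.uc, one_mul, Ring.mul_inverse_cancel _ hc.uc]

theorem CS.unit {c s : A} (h : CS c s) : star (c + Complex.I • s) * (c + Complex.I • s) = 1 ∧
    (c + Complex.I • s) * star (c + Complex.I • s) = 1 := by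
  have := h.sq
  constructor
  · simp only [star_add, star_smul, h.hc, h.hs, add_mul, mul_add, smul_mul_smul_comm, mul_smul_comm, smul_mul_assoc,
      h.comm]
    simp [smul_smul, this]
  · simp only [star_add, star_smul, h.hc, h.hs, add_mul, mul_add, smul_mul_smul_comm, mul_smul_comm, smul_mul_assoc,
      h.comm]
    simp [smul_smul, this]

theorem CS.estar {c s : A} (h : CS c s) : star (c + Complex.I • s) = c - Complex.I • s := by
  simp [h.hc, h.hs, sub_eq_add_neg]

theorem gam_bd (hg : GLin g B) {T : A} (h : nice T) : ‖gam g T‖ ≤ B := by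
  have hc := (nice_cs h).unit
  have h1 := hg.bd _ (iso_mul (uT_iso h) hc.1)
  have h2 := hg.bd _ (iso_mul (uT_iso h) (v := star (eT T)) (by rw [star_star]; exact hc.2))
  unfold gam
  rw [norm_mul]
  have h3 := norm_add_le (g (uT T * eT T)) (g (uT T * star (eT T)))
  have : ‖(1/2:ℂ)‖ = 1/2 := by norm_num
  rw [this]
  unfold eT at *
  linarith

theorem gam_neg (hg : GLin g B) {T : A} (h : nice T) : gam g (-T) = - gam g T := by
  have hc := (nice_cs h).unit
  have h1 := hg.neg _ (iso_mul (uT_iso h) hc.1)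
  have h2 := hg.neg _ (iso_mul (uT_iso h) (v := star (eT T)) (by rw [star_star]; exact hc.2))
  have c1 : cT (-T) = cT T := by simp [cT]
  have c2 : sT (-T) = sT T := by simp [sT]
  have c3 : uT (-T) = - uT T := by simp [uT, c1]
  have c4 : eT (-T) = eT T := by simp [eT, c1, c2]
  unfold gam
  rw [c3, c4, neg_mul, neg_mul, h2]
  unfold eT at *
  rw [h1]; ring

theorem gam_add (hg : GLin g B) {T R : A} (hT : nice T) (ho : star T * R = 0) (hs : star T * T + star R * R = 1) :
    g (T + R) = gam g T + gam g R := by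
  have hR := nice_compl hT hs
  have hcs := nice_cs hT
  have c1 : cT R = sT T := by unfold cT sT; rw [← hs, add_sub_cancel_left]
  have c2 : sT R = cT T := by unfold cT sT; rw [← hs, add_sub_cancel_right]
  have hUV : star (uT T) * uT R = 0 := by
    unfold uT; exact orth_mul ho _ _
  have := GU hg (uT_iso hT) (uT_iso hR) hUV (e := eT T) hcs.unit.1 hcs.unit.2
  have es : star (eT T) = cT T - Complex.I • sT T := hcs.estar
  have e1 : eT T + star (eT T) = (2:ℂ) • cT T := by rw [es, eT, two_smul]; abel
  have e2 : eT T - star (eT T) = (2 * Complex.I) • sT T := by rw [es, eT, mul_smul, two_smul]; abel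
  have e3 : eT R = Complex.I • star (eT T) := by
    rw [es, eT, c1, c2, smul_sub, smul_smul, Complex.I_mul_I]; simp [add_comm]
  have e4 : star (eT R) = -(Complex.I • eT T) := by rw [e3]; simp
  rw [e1, e2] at this
  simp only [mul_smul_comm, smul_smul] at this
  rw [uT_mul hT, ← c1, uT_mul hR] at this
  rw [show (1/2:ℂ)*2 = 1 by norm_num, show -(Complex.I/2) * (2 * Complex.I) = 1 by
    linear_combination -Complex.I_mul_I, one_smul, one_smul] at this
  rw [this]
  unfold gam
  rw [e4, e3, mul_neg, mul_smul_comm, mul_smul_comm]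

theorem gam_iso {J a : A} (hJ : star J * J = 1) : gam g (J * a) =
    1/2 * (g (J * (uT a * eT a)) + g (J * (uT a * star (eT a)))) := by
  have e : star (J * a) * (J * a) = star a * a := by
    rw [star_mul, show star a * star J * (J * a) = star a * (star J * J) * a by noncomm_ring, hJ, mul_one]
  have c1 : cT (J * a) = cT a := by unfold cT; rw [e]
  have c2 : sT (J * a) = sT a := by unfold sT; rw [e]
  unfold gam eT uT
  rw [c1, c2]
  simp only [mul_assoc]

theorem nice_iso {J a : A} (hJ : star J * J = 1) (ha : nice a) : nice (J * a) := by
  have e : star (J * a) * (J * a) = star a * a := by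
    rw [star_mul, show star a * star J * (J * a) = star a * (star J * J) * a by noncomm_ring, hJ, mul_one]
  unfold nice; rw [e]; exact ha

theorem gam_lin (hg : GLin g B) {s t a : A} (hs : star s * s = 1) (ht : star t * t = 1) (hst : star s * t = 0)
    (ha : nice a) {α β : ℝ} (h : α^2+β^2=1) :
    gam g ((α • s + β • t) * a) = α * gam g (s * a) + β * gam g (t * a) := by
  have hc := (nice_cs ha).unit
  have i1 := iso_mul (uT_iso ha) (v := eT a) hc.1
  have i2 := iso_mul (uT_iso ha) (v := star (eT a)) (by rw [star_star]; exact hc.2)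
  rw [gam_iso (iso_lin hs ht hst h), gam_iso hs, gam_iso ht]
  simp only [add_mul, smul_mul_assoc]
  rw [hg.lin _ _ (iso_mul hs i1) (iso_mul ht i1) (orth_mul hst _ _) _ _ h,
   hg.lin _ _ (iso_mul hs i2) (iso_mul ht i2) (orth_mul hst _ _) _ _ h]
  ring

theorem three_slot (hg : GLin g B) {T R S : A} (hT : nice T) (hR : nice R) (hS : nice S)
    (h1 : star T * R = 0) (h2 : star T * S = 0) (h3 : star R * S = 0)
    (h : star T * T + star R * R + star S * S = 1) : gam g (T + R) = gam g T + gam g R := by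
  have h1' := orth_symm h1
  have h2' := orth_symm h2
  have h3' := orth_symm h3
  have k1 := gam_add hg (T := S) (R := T + R) hS (by rw [mul_add, h2', h3', add_zero])
    (by rw [← h]; simp only [star_add, add_mul, mul_add, h1, h1']; abel)
  have k2 := gam_add hg (T := T) (R := R + S) hT (by rw [mul_add, h1, h2, add_zero])
    (by rw [← h]; simp only [star_add, add_mul, mul_add, h3, h3']; abel)
  have k3 := gam_add hg (T := R) (R := T + S) hR (by rw [mul_add, h1', h3, add_zero])
    (by rw [← h]; simp only [star_add, add_mul, mul_add, h2, h2']; abel)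
  have nR : nice (-R) := by simpa [nice] using hR
  have nT : nice (-T) := by simpa [nice] using hT
  have hTR : nice (T - R) := by
    refine nice_compl hS ?_
    rw [← h]; simp only [star_sub, sub_mul, mul_sub, h1, h1']; abel
  have k4 := gam_add hg (T := S) (R := T - R) hS (by rw [mul_sub, h2', h3', sub_zero])
    (by rw [← h]; simp only [star_sub, sub_mul, mul_sub, h1, h1']; abel)
  have k5 := gam_add hg (T := -R) (R := T + S) nR (by rw [star_neg, neg_mul, mul_add, h1', h3, add_zero, neg_zero])
    (by rw [← h]; simp only [star_add, add_mul, mul_add, h2, h2', star_neg, neg_mul_neg]; abel)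
  have k6 := gam_add hg (T := S) (R := -(T - R)) hS (by rw [mul_neg, mul_sub, h2', h3', sub_zero, neg_zero])
    (by rw [← h]; simp only [star_sub, star_neg, neg_mul_neg, sub_mul, mul_sub, h1, h1']; abel)
  have k7 := gam_add hg (T := -T) (R := R + S) nT (by rw [star_neg, neg_mul, mul_add, h1, h2, add_zero, neg_zero])
    (by rw [← h]; simp only [star_add, add_mul, mul_add, h3, h3', star_neg, neg_mul_neg]; abel)
  rw [gam_neg hg hTR] at k6
  rw [gam_neg hg hR] at k5
  rw [gam_neg hg hT] at k7
  rw [show T + (R + S) = S + (T + R) by abel] at k2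
  rw [show R + (T + S) = S + (T + R) by abel] at k3
  rw [show -R + (T + S) = S + (T - R) by abel] at k5
  rw [show -T + (R + S) = S + -(T - R) by abel] at k7
  linear_combination (1/2) * ( -k1 + k2 - k1 + k3 + k4 - k5 + k6 - k7)

theorem rel_half (hg : GLin g B) {s1 s2 s3 : A} (i1 : star s1 * s1 = 1) (i2 : star s2 * s2 = 1) (i3 : star s3 * s3 = 1)
    (o12 : star s1 * s2 = 0) (o13 : star s1 * s3 = 0) (o23 : star s2 * s3 = 0) {p q : A}
    (hp : nice p) (hq : nice q) (hx : nice (r2 • (p + q))) (hy : nice (r2 • (p - q)))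
    (hz : ‖1 - (2:ℝ) • (1 - star p * p - star q * q)‖ < 1) :
    gam g (s1 * (r2 • (p + q))) + gam g (s2 * (r2 • (p - q))) =
      r2 * (gam g (s1 * p) + gam g (s2 * p)) + r2 * (gam g (s1 * q) - gam g (s2 * q)) := by
  obtain ⟨z0, -⟩ := nice_pos (((IsSelfAdjoint.one A).sub (IsSelfAdjoint.star_mul_self p)).sub
    (IsSelfAdjoint.star_mul_self q)) hz
  set z := CFC.sqrt (1 - star p * p - star q * q) with hzd
  have zs : star z = z := (CFC.sqrt_nonneg _).isSelfAdjoint.star_eq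
  have zz : z * z = 1 - star p * p - star q * q := CFC.sqrt_mul_sqrt_self _ z0
  have nz : nice z := by unfold nice; rw [zs, zz]; exact hz
  have iso_sq : ∀ {J a : A}, star J * J = 1 → star (J * a) * (J * a) = star a * a := by
    intro J a hJ
    rw [star_mul, show star a * star J * (J * a) = star a * (star J * J) * a by noncomm_ring, hJ, mul_one]
  have hxy : star (r2 • (p + q)) * (r2 • (p + q)) + star (r2 • (p - q)) * (r2 • (p - q)) = star p * p + star q * q := by
    simp only [star_smul, star_trivial, smul_mul_smul_comm, r2_sq, star_add, star_sub]
    rw [← smul_add, show (star p + star q) * (p + q) + (star p - star q) * (p - q) = (2:ℝ) • (star p * p + star q * q) by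
      rw [two_smul]; noncomm_ring]
    rw [smul_smul]; norm_num
  have r := r2_sq'
  have r' : r2^2 + (-r2)^2 = 1 := by rw [neg_sq]; exact r
  have iJ := iso_lin i1 i2 o12 r
  have iJ' := iso_lin i1 i2 o12 r'
  have oJ : star (r2 • s1 + r2 • s2) * (r2 • s1 + (-r2) • s2) = 0 := by
    simp only [star_add, star_smul, star_trivial, add_mul, mul_add, smul_mul_smul_comm, i1, i2, o12, orth_symm o12]
    simp
  have oJ3 : ∀ α β : ℝ, star (α • s1 + β • s2) * s3 = 0 := by
    intro α β
    simp only [star_add, star_smul, star_trivial, add_mul, smul_mul_assoc, o13, o23]; simp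
  have k1 := three_slot hg (nice_iso i1 hx) (nice_iso i2 hy) (nice_iso i3 nz) (orth_mul o12 _ _) (orth_mul o13 _ _)
    (orth_mul o23 _ _) (by
      rw [iso_sq i1, iso_sq i2, iso_sq i3, hxy, zs, zz]; abel)
  have k2 := three_slot hg (nice_iso iJ hp) (nice_iso iJ' hq) (nice_iso i3 nz) (orth_mul oJ _ _) (orth_mul (oJ3 _ _) _ _)
    (orth_mul (oJ3 _ _) _ _) (by
      rw [iso_sq iJ, iso_sq iJ', iso_sq i3, zs, zz]; abel)
  rw [gam_lin hg i1 i2 o12 hp r, gam_lin hg i1 i2 o12 hq r'] at k2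
  rw [← k1, show s1 * (r2 • (p + q)) + s2 * (r2 • (p - q)) = (r2 • s1 + r2 • s2) * p + (r2 • s1 + (-r2) • s2) * q by
    simp only [mul_smul_comm, add_mul, mul_add, mul_sub, smul_mul_assoc, smul_add, smul_sub, neg_smul, neg_mul]; abel, k2]
  push_cast; ring

theorem rel_full (hg : GLin g B) {s1 s2 s3 : A} (i1 : star s1 * s1 = 1) (i2 : star s2 * s2 = 1) (i3 : star s3 * s3 = 1)
    (o12 : star s1 * s2 = 0) (o13 : star s1 * s3 = 0) (o23 : star s2 * s3 = 0) {p q : A}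
    (hp : nice p) (hq : nice q) (hx : nice (r2 • (p + q))) (hy : nice (r2 • (p - q)))
    (hz : ‖1 - (2:ℝ) • (1 - star p * p - star q * q)‖ < 1) :
    gam g (s1 * (r2 • (p + q))) = r2 * (gam g (s1 * p) + gam g (s1 * q)) := by
  have k1 := rel_half hg i1 i2 i3 o12 o13 o23 hp hq hx hy hz
  have e : r2 • (q - p) = - (r2 • (p - q)) := by rw [← smul_neg, neg_sub]
  have k2 := rel_half hg i1 i2 i3 o12 o13 o23 hq hp (by rwa [add_comm]) (by rw [e]; simpa [nice] using hy)
    (by rwa [sub_right_comm])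
  rw [e, mul_neg, gam_neg hg (nice_iso i2 hy), add_comm q p] at k2
  linear_combination (1/2) * (k1 + k2)

end LemL2

section LemL3
set_option linter.unusedSectionVars false
variable {A : Type*} [CStarAlgebra A] [PartialOrder A] [StarOrderedRing A]
variable {g : A → ℂ} {B : ℝ}

theorem norm_one_le' : ‖(1:A)‖ ≤ 1 := by
  rcases subsingleton_or_nontrivial A with h | h
  · rw [Subsingleton.elim (1:A) 0]; simp
  · simp

theorem near_quarter {α : ℂ} {ζ : A} (hα : ‖α‖ = 1/2) (hζ : ‖ζ‖ < 1/5) :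
    ‖star (α • 1 + ζ) * (α • 1 + ζ) - (1/4:ℝ) • 1‖ < 1/4 := by
  have e : star (α • 1 + ζ) * (α • 1 + ζ) - (1/4:ℝ) • 1 = star α • ζ + α • star ζ + star ζ * ζ := by
    have : (star α * α) • (1:A) = (1/4:ℝ) • (1:A) := by
      have h : (star α * α : ℂ) = ((1/4:ℝ):ℂ) := by
        have := Complex.conj_mul' α
        rw [hα] at this
        rw [Complex.star_def, this]; push_cast; norm_num
      rw [h, Complex.coe_smul]
    rw [← this]
    simp only [star_add, star_smul, star_one, add_mul, mul_add, mul_one, smul_mul_assoc,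
      one_mul, mul_smul_comm, smul_add, smul_smul, mul_comm α (star α)]
    abel
  rw [e]
  have h1 : ‖star α • ζ‖ = 1/2 * ‖ζ‖ := by rw [norm_smul, norm_star, hα]
  have h2 : ‖α • star ζ‖ = 1/2 * ‖ζ‖ := by rw [norm_smul, norm_star, hα]
  have h3 : ‖star ζ * ζ‖ ≤ ‖ζ‖ * ‖ζ‖ := by
    have := norm_mul_le (star ζ) ζ; rwa [norm_star] at this
  have h4 := norm_add₃_le (a := star α • ζ) (b := α • star ζ) (c := star ζ * ζ)
  have := norm_nonneg ζ
  nlinarith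

theorem nice_near {α : ℂ} {ζ : A} (hα : ‖α‖ = 1/2) (hζ : ‖ζ‖ < 1/5) : nice (α • 1 + ζ) := by
  have h := near_quarter hα hζ
  unfold nice
  set t := star (α • 1 + ζ) * (α • 1 + ζ)
  rw [show 1 - (2:ℝ) • t = (1/2:ℝ) • (1:A) - (2:ℝ) • (t - (1/4:ℝ) • 1) by
    rw [smul_sub, smul_smul, show (2:ℝ)*(1/4) = 1/2 by norm_num]
    have : (1:A) = (1/2:ℝ) • 1 + (1/2:ℝ) • (1:A) := by rw [← add_smul]; norm_num
    nth_rewrite 1 [this]; abel]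
  have h1 := norm_sub_le ((1/2:ℝ) • (1:A)) ((2:ℝ) • (t - (1/4:ℝ) • 1))
  rw [norm_smul, norm_smul] at h1
  have := norm_one_le' (A := A)
  norm_num at h1
  linarith

theorem r2_lt : r2 < 3/4 := by
  have := r2_sq; have := r2_pos; nlinarith

theorem local_lin (hg : GLin g B) {s1 s2 s3 : A} (i1 : star s1 * s1 = 1) (i2 : star s2 * s2 = 1) (i3 : star s3 * s3 = 1)
    (o12 : star s1 * s2 = 0) (o13 : star s1 * s3 = 0) (o23 : star s2 * s3 = 0) :
    ∃ G : A →L[ℝ] ℂ, ∀ ξ : A, ‖ξ‖ < 1/14 → G ξ = gam g (s1 * ((1/2:ℂ) • 1 + ξ)) - gam g (s1 * ((1/2:ℂ) • 1)) := by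
  have n1 : ‖(1/2:ℂ)‖ = 1/2 := by norm_num
  have n2 : ‖(Complex.I/2:ℂ)‖ = 1/2 := by simp
  have key : ∀ ξ η : A, ‖ξ‖ < 1/7 → ‖η‖ < 1/7 → ‖ξ‖ + ‖η‖ < 1/7 → 
      gam g (s1 * (r2 • ((1/2 + Complex.I/2 : ℂ) • 1 + (ξ + η)))) =
        r2 * (gam g (s1 * ((1/2:ℂ) • 1 + ξ)) + gam g (s1 * ((Complex.I/2:ℂ) • 1 + η))) := by
    intro ξ η h1 h2 h3
    have hp := nice_near (A := A) n1 (show ‖ξ‖ < 1/5 by linarith)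
    have hq := nice_near (A := A) n2 (show ‖η‖ < 1/5 by linarith)
    have hp' := near_quarter (A := A) n1 (show ‖ξ‖ < 1/5 by linarith)
    have hq' := near_quarter (A := A) n2 (show ‖η‖ < 1/5 by linarith)
    have r0 := r2_pos
    have r1 := r2_lt
    have nr : ∀ ζ : A, ‖ζ‖ < 1/7 → ‖r2 • ζ‖ < 1/5 := by
      intro ζ hζ
      rw [norm_smul, Real.norm_of_nonneg r0.le]
      have := norm_nonneg ζ
      nlinarith
    have nα : ∀ σ : ℂ, ‖σ‖ = 1 → σ.re = 0 → ‖((r2:ℂ) * (1/2 + σ/2))‖ = 1/2 := by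
      intro σ h1 h2
      have q : ‖((r2:ℂ) * (1/2 + σ/2))‖^2 = (1/2)^2 := by
        have h3 : σ.im * σ.im = 1 := by
          have := Complex.sq_norm σ
          rw [h1, Complex.normSq_apply, h2] at this; linarith
        rw [Complex.sq_norm, Complex.normSq_apply]
        simp [h2]
        have := r2_sq
        linear_combination (r2*r2/4) * h3 + (1/2) * this
      exact (pow_left_inj₀ (norm_nonneg _) (by norm_num) (by norm_num)).1 q
    have ex : r2 • (((1/2:ℂ) • 1 + ξ) + ((Complex.I/2:ℂ) • 1 + η)) = ((r2:ℂ) * (1/2 + Complex.I/2)) • (1:A) + r2 • (ξ + η) := by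
      simp only [mul_smul, add_smul, Complex.coe_smul, smul_add]; abel
    have ey : r2 • (((1/2:ℂ) • 1 + ξ) - ((Complex.I/2:ℂ) • 1 + η)) = ((r2:ℂ) * (1/2 + (-Complex.I)/2)) • (1:A) + r2 • (ξ - η) := by
      simp only [mul_smul, add_smul, Complex.coe_smul, smul_add, smul_sub, neg_div, neg_smul, smul_neg]; abel
    have k := rel_full hg i1 i2 i3 o12 o13 o23 hp hq
      (by rw [ex]; exact nice_near (nα _ (by simp) (by simp)) (nr _ (lt_of_le_of_lt (norm_add_le _ _) h3)))
      (by rw [ey]; exact nice_near (nα _ (by simp) (by simp)) (nr _ (lt_of_le_of_lt (norm_sub_le _ _) h3)))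
      (by
        set P := star ((1/2:ℂ) • 1 + ξ) * ((1/2:ℂ) • 1 + ξ)
        set Q := star ((Complex.I/2:ℂ) • 1 + η) * ((Complex.I/2:ℂ) • 1 + η)
        rw [show 1 - (2:ℝ) • (1 - P - Q) = (2:ℝ) • ((P - (1/4:ℝ) • 1) + (Q - (1/4:ℝ) • 1)) by
          simp only [smul_sub, smul_add, smul_smul]
          have : (1:A) = (2*(1/4):ℝ) • 1 + (2*(1/4):ℝ) • (1:A) := by rw [← add_smul]; norm_num
          have h' : (2:ℝ) • (1:A) = 1 + 1 := by rw [two_smul]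
          rw [h']
          nth_rewrite 3 [this]
          abel]
        rw [norm_smul]
        have := norm_add_le (P - (1/4:ℝ) • 1) (Q - (1/4:ℝ) • 1)
        norm_num at this hp' hq' ⊢
        linarith)
    rw [← k]
    congr 3
    rw [add_smul]; abel
  set a : A → ℂ := fun ξ => gam g (s1 * ((1/2:ℂ) • 1 + ξ)) with ha
  set b : A → ℂ := fun ξ => gam g (s1 * ((Complex.I/2:ℂ) • 1 + ξ)) with hb
  have rC : (r2:ℂ) ≠ 0 := by exact_mod_cast r2_pos.ne'
  have key2 : ∀ ξ η : A, ‖ξ‖ < 1/14 → ‖η‖ < 1/14 → a ξ + b η = a (ξ + η) + b 0 := by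
    intro ξ η h1 h2
    have h3 : ‖ξ + η‖ < 1/7 := lt_of_le_of_lt (norm_add_le _ _) (by linarith)
    have k1 := key ξ η (by linarith) (by linarith) (by linarith)
    have k2 := key (ξ + η) 0 h3 (by simp) (by simpa using h3)
    rw [add_zero] at k2
    rw [k1] at k2
    exact mul_left_cancel₀ rC k2
  have key3 : ∀ ξ : A, ‖ξ‖ < 1/14 → ‖a ξ - a 0‖ ≤ 2 * B := by
    intro ξ h
    have h1 := gam_bd hg (nice_iso i1 (nice_near (A := A) n1 (show ‖ξ‖ < 1/5 by linarith)))
    have h2 := gam_bd hg (nice_iso i1 (nice_near (A := A) n1 (show ‖(0:A)‖ < 1/5 by simp)))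
    have := norm_sub_le (a ξ) (a 0)
    simp only [ha] at this ⊢
    linarith
  obtain ⟨G, hG⟩ := local_add_ext (f := fun ξ => a ξ - a 0) (δ := 1/14) (M := 2 * B) (by norm_num) (by
    intro ξ η h1 h2
    have k1 := key2 ξ η h1 h2
    have k2 := key2 0 η (by simp) h2
    rw [zero_add] at k2
    linear_combination -k1 + k2) key3
  refine ⟨G, fun ξ h => ?_⟩
  rw [hG ξ h]
  simp [ha]

theorem unit_e {w : A} (hw : star w = w) (hww : w * w = 1) {α β : ℝ} (h : α^2+β^2 = 1) :
    star (α • 1 + (Complex.I * β) • w) = α • 1 - (Complex.I * β) • w ∧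
    star (α • 1 + (Complex.I * β) • w) * (α • 1 + (Complex.I * β) • w) = 1 ∧
    (α • 1 + (Complex.I * β) • w) * star (α • 1 + (Complex.I * β) • w) = 1 := by
  have es : star (α • 1 + (Complex.I * β) • w) = α • 1 - (Complex.I * β) • w := by
    simp [hw, sub_eq_add_neg, mul_comm]
  have hC : ((α:ℂ))^2 + (β:ℂ)^2 = 1 := by exact_mod_cast h
  have h1 : (α * α - (Complex.I * β) * (Complex.I * β) : ℂ) • (1:A) = 1 := by
    rw [show (α * α - (Complex.I * β) * (Complex.I * β) : ℂ) = 1 by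
      linear_combination -(β:ℂ)^2 * Complex.I_mul_I + hC, one_smul]
  refine ⟨es, ?_, ?_⟩
  · rw [es, ← Complex.coe_smul]
    refine Eq.trans ?_ h1
    simp only [sub_mul, mul_add, smul_mul_smul_comm, one_mul, mul_one, hww, sub_smul]
    rw [mul_comm (Complex.I * _)]
    abel
  · rw [es, ← Complex.coe_smul]
    refine Eq.trans ?_ h1
    simp only [add_mul, mul_sub, smul_mul_smul_comm, one_mul, mul_one, hww, sub_smul]
    rw [mul_comm (Complex.I * _)]
    abel

theorem cos_id (hg : GLin g B) {U V w : A} (hU : star U * U = 1) (hV : star V * V = 1) (hUV : star U * V = 0)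
    (hw : star w = w) (hww : w * w = 1) {α β : ℝ} (h : α^2+β^2 = 1) :
    g (U * (α • 1 + (Complex.I * β) • w)) + g (U * (α • 1 - (Complex.I * β) • w)) = 2 * α * g U := by
  set e : A := α • 1 + (Complex.I * β) • w with he
  obtain ⟨es, e1, e2⟩ := unit_e hw hww h
  rw [← he] at es e1 e2
  have rs : ∀ x : A, α • x = (α:ℂ) • x := fun x => (Complex.coe_smul α x).symm
  have hw1 : star w * w = 1 := by rw [hw, hww]
  have gen : ∀ V : A, star V * V = 1 → star U * V = 0 → α * g U + β * g (V * w) =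
      1/2 * (g (U * e) + g (U * star e)) + 1/2 * (g (Complex.I • (V * star e)) + g (-(Complex.I • (V * e)))) := by
    intro V hV hUV
    rw [← GU hg hU hV hUV e1 e2, ← hg.lin _ _ hU (iso_mul hV hw1) (by rw [← mul_assoc, hUV, zero_mul]) _ _ h]
    congr 1
    rw [es, he]
    rw [show (α • 1 + (Complex.I * β) • w + (α • 1 - (Complex.I * β) • w)) = (2 * α : ℂ) • (1:A) by
      rw [mul_smul (2:ℂ), two_smul, ← rs]; abel]
    rw [show (α • 1 + (Complex.I * β) • w - (α • 1 - (Complex.I * β) • w)) = (2 * (Complex.I * β) : ℂ) • w by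
      rw [mul_smul (2:ℂ), two_smul]; abel]
    rw [mul_smul_comm, mul_smul_comm, smul_smul, smul_smul, mul_one, ← Complex.coe_smul, ← Complex.coe_smul]
    congr 2
    · ring
    · linear_combination (β:ℂ) * Complex.I_mul_I
  have k1 := gen V hV hUV
  have k2 := gen (-V) (by simpa using hV) (by simp [hUV])
  have i3 := iso_I (iso_mul hV e1)
  have i4 := iso_I (iso_mul hV (v := star e) (by rw [star_star]; exact e2))
  have n1 := hg.neg _ i3
  have n2 := hg.neg _ i4
  have n3 := hg.neg _ (iso_mul hV hw1)
  simp only [neg_mul, smul_neg, neg_neg] at k2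
  rw [n2, n3] at k2
  rw [n1] at k1
  rw [← es]
  linear_combination -(k1 + k2)

theorem gam_scalar (hg : GLin g B) {U V u : A} (hU : star U * U = 1) (hV : star V * V = 1) (hUV : star U * V = 0)
    (hu : star u * u = 1) {l : ℝ} (h0 : 0 < l) (h1 : l ≤ 1) : gam g (U * (l • u)) = l * g (U * u) := by
  set μ := Real.sqrt (1 - l^2) with hμ
  have hl : l^2 + μ^2 = 1 := by rw [hμ, Real.sq_sqrt (by nlinarith)]; ring
  have t : star (l • u) * (l • u) = (l*l) • (1:A) := by
    rw [star_smul, smul_mul_smul_comm, hu]; simp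
  have c1 : cT (l • u) = l • (1:A) := by
    unfold cT; rw [t]
    exact CFC.sqrt_unique (by rw [smul_mul_smul_comm, mul_one]) (smul_nonneg h0.le zero_le_one)
  have c2 : sT (l • u) = μ • (1:A) := by
    unfold sT; rw [t]
    refine CFC.sqrt_unique ?_ (smul_nonneg (Real.sqrt_nonneg _) zero_le_one)
    rw [smul_mul_smul_comm, mul_one, eq_sub_iff_add_eq, ← add_smul, show μ*μ+l*l = 1 by linarith, one_smul]
  have c3 : uT (l • u) = u := by
    unfold uT; rw [c1]
    have hunit : IsUnit (l • (1:A)) := by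
      rw [← Algebra.algebraMap_eq_smul_one]; exact IsUnit.map (algebraMap ℝ A) (isUnit_iff_ne_zero.2 h0.ne')
    have := Ring.mul_inverse_cancel _ hunit
    rw [smul_mul_assoc, one_mul] at this
    rw [smul_mul_assoc, ← mul_smul_comm, this, mul_one]
  have c4 : eT (l • u) = l • 1 + (Complex.I * μ) • (1:A) := by
    unfold eT; rw [c1, c2, mul_smul, Complex.coe_smul]
  have c5 : star (eT (l • u)) = l • 1 - (Complex.I * μ) • (1:A) := by
    rw [c4]; simp [sub_eq_add_neg, mul_comm]
  rw [gam_iso hU, c5, c4, c3, ← mul_assoc, ← mul_assoc]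
  have := cos_id hg (U := U * u) (V := V * u) (w := 1) (iso_mul hU hu) (iso_mul hV hu) (orth_mul hUV _ _) (by simp)
    (by simp) hl
  rw [this]; ring

/-- LemmaL -/
theorem lemmaL (hg : GLin g B) {s1 s2 s3 : A} (i1 : star s1 * s1 = 1) (i2 : star s2 * s2 = 1) (i3 : star s3 * s3 = 1)
    (o12 : star s1 * s2 = 0) (o13 : star s1 * s3 = 0) (o23 : star s2 * s3 = 0) :
    ∃ G : A →L[ℝ] ℂ, ∀ w : A, star w = w → w * w = 1 → G (Complex.I • w) = g (s1 * (Complex.I • w)) := by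
  obtain ⟨G, hG⟩ := local_lin hg i1 i2 i3 o12 o13 o23
  refine ⟨G, fun w hw hww => ?_⟩
  have hw1 : star w * w = 1 := by rw [hw, hww]
  have nw : ‖w‖ ≤ 1 := by
    have := CStarRing.norm_star_mul_self (x := w)
    rw [hw1] at this
    have := norm_one_le' (A := A)
    have := norm_nonneg w
    nlinarith
  have rs : ∀ (r : ℝ) (x : A), r • x = (r:ℂ) • x := fun r x => (Complex.coe_smul r x).symm
  have hab : (399/401:ℝ)^2 + (40/401:ℝ)^2 = 1 := by norm_num
  have hba : (40/401:ℝ)^2 + (-(399/401):ℝ)^2 = 1 := by norm_num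
  have k1 := cos_id hg i1 i2 o12 hw hww hab
  have iw := iso_I hw1
  have k2 := cos_id hg (U := s1 * (Complex.I • w)) (V := s2) (iso_mul i1 iw) i2
    (by rw [star_mul, mul_assoc, o12, mul_zero]) hw hww hba
  set e : A := (399/401:ℝ) • 1 + (Complex.I * ((40/401:ℝ):ℂ)) • w with he
  set e' : A := (399/401:ℝ) • 1 - (Complex.I * ((40/401:ℝ):ℂ)) • w with he'
  have m1 : (Complex.I • w) * ((40/401:ℝ) • 1 + (Complex.I * ((-(399/401):ℝ):ℂ)) • w) = e := by
    rw [he, rs, rs, mul_add, smul_mul_smul_comm, smul_mul_smul_comm, hww, mul_one]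
    rw [add_comm]
    congr 2
    push_cast
    linear_combination (-399/401:ℂ) * Complex.I_mul_I
  have m2 : (Complex.I • w) * ((40/401:ℝ) • 1 - (Complex.I * ((-(399/401):ℝ):ℂ)) • w) = - e' := by
    rw [he', rs, rs, mul_sub, smul_mul_smul_comm, smul_mul_smul_comm, hww, mul_one, neg_sub]
    congr 2
    push_cast
    linear_combination (-399/401:ℂ) * Complex.I_mul_I
  rw [mul_assoc, m1, mul_assoc, m2, mul_neg] at k2
  obtain ⟨est, ee, ee2⟩ := unit_e hw hww hab
  rw [← he] at est ee ee2
  rw [← he'] at est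
  have ee' : star e' * e' = 1 := by rw [← est, star_star, ee2]
  rw [hg.neg _ (iso_mul i1 ee')] at k2
  have q := gam_scalar hg i1 i2 o12 ee (l := 401/798) (by norm_num) (by norm_num)
  have q0 := gam_scalar hg i1 i2 o12 (u := 1) (by simp) (l := 1/2) (by norm_num) (by norm_num)
  have hξ : ‖(20/399:ℝ) • (Complex.I • w)‖ < 1/14 := by
    rw [norm_smul, norm_smul]
    norm_num
    linarith
  have hq := hG _ hξ
  have ex : (1/2:ℂ) • 1 + (20/399:ℝ) • (Complex.I • w) = (401/798:ℝ) • e := by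
    rw [he, rs, rs, rs, smul_add, smul_smul, smul_smul, smul_smul]
    congr 2
    · push_cast; norm_num
    · push_cast; ring
  have ex0 : (1/2:ℂ) • (1:A) = (1/2:ℝ) • 1 := by rw [rs]; norm_num
  rw [ex, ex0, q, q0, mul_one, map_smul, Complex.real_smul] at hq
  push_cast at hq k1 k2
  linear_combination (399/20) * hq + (401/80) * (k1 + k2)
end LemL3

section LemD
set_option linter.unusedSectionVars false
variable {A : Type*} [CStarAlgebra A] [PartialOrder A] [StarOrderedRing A]

/-- Cuntz pair -/
structure Cuntz (s1 s2 : A) : Prop where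
  i1 : star s1 * s1 = 1
  i2 : star s2 * s2 = 1
  o : star s1 * s2 = 0
  full : s1 * star s1 + s2 * star s2 = 1

noncomputable def PP (m : A → ℂ) (V W : A) : ℂ :=
  m ((1/2:ℝ) • ((V + W) * star (V + W))) - m ((1/2:ℝ) • ((V - W) * star (V - W)))

theorem half_proj {V W : A} (hV : star V * V = 1) (hW : star W * W = 1) (h : star V * W = 0) :
    IsStarProjection ((1/2:ℝ) • ((V + W) * star (V + W))) := by
  have := isom_proj (iso_lin hV hW h r2_sq')
  rwa [← smul_add, star_smul, smul_mul_smul_comm, star_trivial, r2_sq] at this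

theorem half_proj' {V W : A} (hV : star V * V = 1) (hW : star W * W = 1) (h : star V * W = 0) :
    IsStarProjection ((1/2:ℝ) • ((V - W) * star (V - W))) := by
  have := half_proj hV (W := -W) (by simpa using hW) (by simp [h])
  simpa [sub_eq_add_neg] using this

theorem PP_lin {m : A → ℂ} {C : ℝ} (hm : PMeas m C) {V W W' : A} (hV : star V * V = 1) (hW : star W * W = 1)
    (hW' : star W' * W' = 1) (h1 : star V * W = 0) (h2 : star V * W' = 0) (h3 : star W * W' = 0) {α β : ℝ}
    (h : α^2+β^2=1) : PP m V (α • W + β • W') = α * PP m V W + β * PP m V W' := by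
  let v : Fin 3 → A := ![V, W, W']
  have o : ∀ i j, star (v i) * v j = if i = j then 1 else 0 := by
    intro i j
    fin_cases i <;> fin_cases j <;> simp [v, hV, hW, hW', h1, h2, h3, orth_symm h1, orth_symm h2, orth_symm h3]
  have he : MU3 (fun i j => v i * star (v j)) := by
    refine ⟨fun i j => by simp, fun i j k l => ?_⟩
    rw [show v i * star (v j) * (v k * star (v l)) = v i * (star (v j) * v k) * star (v l) by noncomm_ring, o]
    split_ifs <;> simp
  have hM : ∀ x y z : ℝ, x^2+y^2+z^2 = 2 → MM (fun i j => v i * star (v j)) (rk x y z) =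
      (1/2:ℝ) • ((x • V + (y • W + z • W')) * star (x • V + (y • W + z • W'))) := by
    intro x y z hh
    simp only [MM, Fin.sum_univ_three, rk, hh]
    simp [v, add_mul, mul_add, smul_mul_smul_comm, smul_smul]
    simp only [div_eq_inv_mul, smul_smul]
    ring_nf
    abel
  have k := frame_lin he hm α β h
  rw [hM 1 α β (by linarith), hM 1 (-α) (-β) (by linarith), hM 1 1 0 (by norm_num), hM 1 (-1) 0 (by norm_num),
    hM 1 0 1 (by norm_num), hM 1 0 (-1) (by norm_num)] at k
  unfold PP
  simp only [one_smul, zero_smul, add_zero, zero_add, neg_smul] at k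
  simp only [sub_eq_add_neg V, neg_add]
  exact k

theorem PP_glin {m : A → ℂ} {C : ℝ} (hm : PMeas m C) {V R : A} (hV : star V * V = 1) (hR : star R * R = 1)
    (h : star V * R = 0) : GLin (fun Z => PP m V (R * Z)) (2 * C) := by
  have hz : ∀ Z, star V * (R * Z) = 0 := fun Z => by rw [← mul_assoc, h, zero_mul]
  refine ⟨?_, ?_, ?_⟩
  · intro X Y hX hY hXY α β hab
    simp only [mul_add, mul_smul_comm]
    refine PP_lin hm hV (iso_mul hR hX) (iso_mul hR hY) (hz _) (hz _) ?_ hab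
    rw [star_mul, show star X * star R * (R * Y) = star X * (star R * R) * Y by noncomm_ring, hR, mul_one, hXY]
  · intro X hX
    simp only [PP, mul_neg, ← sub_eq_add_neg, sub_neg_eq_add]; ring
  · intro X hX
    have h1 := hm.bd _ (half_proj hV (iso_mul hR hX) (hz X))
    have h2 := hm.bd _ (half_proj' hV (iso_mul hR hX) (hz X))
    exact (norm_sub_le _ _).trans (by linarith)

/-- complexification of a real linear functional -/
theorem complexify (L : A →L[ℝ] ℂ) : ∃ φ : A →ₗ[ℂ] ℂ, ∀ x, star x = x → φ x = L x := by
  let H : A → ℂ := fun x => (1/2) * (L x + L (star x))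
  have Hadd : ∀ x y, H (x + y) = H x + H y := fun x y => by simp only [H, map_add, star_add]; ring
  have Hsm : ∀ (r : ℝ) x, H (r • x) = r * H x := fun r x => by
    simp only [H, map_smul, star_smul, star_trivial, Complex.real_smul]; ring
  have Hneg : ∀ x, H (-x) = - H x := fun x => by simp only [H, map_neg, star_neg]; ring
  refine ⟨⟨⟨fun x => H x + Complex.I * H (-(Complex.I • x)), fun x y => ?_⟩, fun c x => ?_⟩, fun x hx => ?_⟩
  · simp only [smul_add, neg_add, Hadd]; ring
  · simp only [RingHom.id_apply, smul_eq_mul, Hneg]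
    have e1 : c • x = c.re • x + c.im • (Complex.I • x) := by
      rw [← Complex.coe_smul, ← Complex.coe_smul, smul_smul, ← add_smul, Complex.re_add_im]
    have e2 : Complex.I • (c • x) = c.re • (Complex.I • x) + (-c.im) • x := by
      rw [← Complex.coe_smul, ← Complex.coe_smul, smul_smul, smul_smul, ← add_smul]
      congr 1
      nth_rewrite 1 [← Complex.re_add_im c]
      push_cast
      linear_combination (c.im:ℂ) * Complex.I_mul_I
    rw [e2, e1, Hadd, Hadd, Hsm, Hsm, Hsm, Hsm]
    nth_rewrite 5 [← Complex.re_add_im c]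
    push_cast
    linear_combination ((c.im:ℂ) * H (Complex.I • x)) * Complex.I_mul_I
  · show H x + Complex.I * H (-(Complex.I • x)) = L x
    rw [Hneg]
    simp only [H, star_smul, hx]
    simp
    ring

theorem lemmaD {m : A → ℂ} {C : ℝ} (hm : PMeas m C) {s1 s2 : A} (hc : Cuntz s1 s2) {s t y : A} (hs : star s * s = 1)
    (ht : star t * t = 1) (hy : star y * y = 1) (hst : star s * t = 0) (hsy : star s * y = 0) (hty : star t * y = 0) :
    ∃ φ : A →ₗ[ℂ] ℂ, ∀ p, IsStarProjection p → φ p = m (s * p * star s) - m (t * p * star t) := by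
  have r := r2_sq'
  have r' : r2^2 + (-r2)^2 = 1 := by rw [neg_sq]; exact r
  have iX := iso_lin hs ht hst r
  have iY := iso_lin hs ht hst r'
  have oXY : star (r2 • s + r2 • t) * (r2 • s + (-r2) • t) = 0 := by
    simp only [star_add, star_smul, star_trivial, add_mul, mul_add, smul_mul_smul_comm, hs, ht, hst, orth_symm hst]
    simp
  have oy : ∀ α β : ℝ, star (α • s + β • t) * y = 0 := by
    intro α β
    simp only [star_add, star_smul, star_trivial, add_mul, smul_mul_assoc, hsy, hty]; simp
  have oXy := oy r2 r2
  have oYy := oy r2 (-r2)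
  set X := r2 • s + r2 • t with hX
  set Y := r2 • s + (-r2) • t with hY
  set R := (-Complex.I) • (Y * star s1) + y * star s2 with hR
  have iR : star R * R = 1 := by
    rw [hR]
    simp only [star_add, star_smul, star_mul, star_star, add_mul, mul_add, smul_mul_smul_comm, mul_smul_comm, smul_mul_assoc]
    rw [show s1 * star Y * (Y * star s1) = s1 * (star Y * Y) * star s1 by noncomm_ring, iY,
      show s1 * star Y * (y * star s2) = s1 * (star Y * y) * star s2 by noncomm_ring, oYy,
      show s2 * star y * (Y * star s1) = s2 * (star y * Y) * star s1 by noncomm_ring, orth_symm oYy,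
      show s2 * star y * (y * star s2) = s2 * (star y * y) * star s2 by noncomm_ring, hy]
    simp [smul_smul, hc.full]
  have oXR : star X * R = 0 := by
    rw [hR, mul_add, mul_smul_comm, ← mul_assoc, oXY, ← mul_assoc, oXy]; simp
  have hg := PP_glin hm iX iR oXR
  obtain ⟨G, hG⟩ := lemmaL hg hc.i1 (iso_mul hc.i2 hc.i1) (iso_mul hc.i2 hc.i2)
    (by rw [← mul_assoc, hc.o, zero_mul]) (by rw [← mul_assoc, hc.o, zero_mul]) (by
      rw [star_mul, show star s1 * star s2 * (s2 * s2) = star s1 * (star s2 * s2) * s2 by noncomm_ring, hc.i2,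
        mul_one, hc.o])
  have hRs : ∀ w : A, R * (s1 * (Complex.I • w)) = Y * w := by
    intro w
    rw [hR, add_mul, mul_smul_comm, mul_smul_comm, ← mul_assoc, smul_mul_assoc, smul_mul_assoc,
      show Y * star s1 * s1 * w = Y * (star s1 * s1) * w by noncomm_ring, hc.i1, mul_one,
      show y * star s2 * (Complex.I • (s1 * w)) = Complex.I • (y * (star s2 * s1) * w) by
        rw [mul_smul_comm]; congr 1; noncomm_ring, orth_symm hc.o]
    simp [smul_smul]
  have hP : ∀ p : A, IsStarProjection p → m (s * p * star s) - m (t * p * star t) - (m (s * (1 - p) * star s) -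
     m (t * (1 - p) * star t)) = G (Complex.I • (p + p - 1)) := by
    intro p hp
    have hpp := hp.1.eq
    have hps := hp.2.star_eq
    rw [hG (p + p - 1) (by simp [hps]) (by
      rw [show (p + p - 1) * (p + p - 1) = (p * p - p) + (p * p - p) + (p * p - p) + (p * p - p) + 1 by noncomm_ring, hpp]; simp)]
    beta_reduce
    rw [hRs]
    have q := hp.one_sub
    have qq := q.1.eq
    have qs := q.2.star_eq
    have pq : p * (1 - p) = 0 := by rw [mul_sub, mul_one, hpp, sub_self]
    have qp : (1 - p) * p = 0 := by rw [sub_mul, one_mul, hpp, sub_self]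
    have gen : ∀ a b : A, a * a = a → b * b = b → star a = a → star b = b → a * b = 0 → b * a = 0 →
        (s * a + t * b) * star (s * a + t * b) = s * a * star s + t * b * star t := by
      intro a b h1 h2 h3 h4 h5 h6
      simp only [star_add, star_mul, h3, h4]
      rw [show (s * a + t * b) * (a * star s + b * star t) = s * (a * a) * star s + s * (a * b) * star t +
        t * (b * a) * star s + t * (b * b) * star t by noncomm_ring, h1, h2, h5, h6]
      simp
    have r4 : ∀ x : A, (1/2:ℝ) • (((2 * r2) • x) * star ((2 * r2) • x)) = x * star x := by
      intro x
      rw [star_smul, star_trivial, smul_mul_smul_comm, smul_smul,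
        show 1/2 * (2 * r2 * (2 * r2)) = (1:ℝ) by linear_combination 2 * r2_sq, one_smul]
    have e1 : X + Y * (p + p - 1) = (2 * r2) • (s * p + t * (1 - p)) := by
      rw [hX, hY, mul_smul, two_smul]
      simp only [add_mul, smul_mul_assoc, mul_sub, mul_add, mul_one, neg_smul, smul_add, smul_neg, mul_neg, neg_mul, sub_eq_add_neg]
      abel
    have e2 : X - Y * (p + p - 1) = (2 * r2) • (s * (1 - p) + t * p) := by
      rw [hX, hY, mul_smul, two_smul]
      simp only [add_mul, smul_mul_assoc, mul_sub, mul_add, mul_one, neg_smul, smul_add, smul_neg, mul_neg, neg_mul, sub_eq_add_neg]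
      abel
    unfold PP
    rw [e1, e2, r4, r4, gen _ _ hpp qq hps qs pq qp, gen _ _ qq hpp qs hps qp pq]
    have oo : ∀ a b : A, (s * a * star s) * (t * b * star t) = 0 := fun a b => by
      rw [show (s * a * star s) * (t * b * star t) = s * a * (star s * t) * b * star t by noncomm_ring, hst]; simp
    rw [hm.add _ _ (conj_proj hs hp) (conj_proj ht q) (oo _ _), hm.add _ _ (conj_proj hs q) (conj_proj ht hp) (oo _ _)]
    ring
  obtain ⟨φ, hφ⟩ := complexify (G.comp ((Complex.I • (ContinuousLinearMap.id ℝ A))))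
  refine ⟨φ, fun p hp => ?_⟩
  have hpp := hp.1.eq
  rw [hφ p hp.2.star_eq]
  have k1 := hP p hp
  have k2 := hP 1 (IsStarProjection.one A)
  have add1 : ∀ u : A, star u * u = 1 → m (u * 1 * star u) = m (u * p * star u) + m (u * (1 - p) * star u) := by
    intro u hu
    rw [← hm.add _ _ (conj_proj hu hp) (conj_proj hu hp.one_sub) (by
      rw [show u * p * star u * (u * (1 - p) * star u) = u * (p * (star u * u) * (1 - p)) * star u by noncomm_ring,
        hu, mul_one, mul_sub, mul_one, hpp, sub_self]; simp)]
    congr 1; noncomm_ring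
  have m0 : m 0 = 0 := by
    have := hm.add 0 0 (IsStarProjection.zero A) (IsStarProjection.zero A) (by simp)
    simpa using this
  rw [add1 s hs, add1 t ht] at k2
  simp only [sub_self, mul_zero, zero_mul, m0, sub_zero, add_sub_cancel_right] at k2
  rw [smul_sub, map_sub, smul_add, map_add] at k1
  show G (Complex.I • p) = _
  linear_combination -(1/2) * (k1 + k2)

theorem ext_cofull {m : A → ℂ} {C : ℝ} (hm : PMeas m C) {s1 s2 : A} (hc : Cuntz s1 s2) {a r : A} (ha : star a * a = 1)
    (hr : star r * r = 1) (har : star r * a = 0) :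
    ∃ φ : A →ₗ[ℂ] ℂ, ∀ p, IsStarProjection p → φ p = m (r * p * star r) := by
  have oa : star (a * s1) * (a * s2) = 0 := by
    rw [star_mul, show star s1 * star a * (a * s2) = star s1 * (star a * a) * s2 by noncomm_ring, ha, mul_one, hc.o]
  have ia1 := iso_mul ha hc.i1
  have ia2 := iso_mul ha hc.i2
  have o0 : ∀ x, star r * (a * x) = 0 := fun x => by rw [← mul_assoc, har, zero_mul]
  obtain ⟨f0, h0⟩ := lemmaD hm hc hr ia1 ia2 (o0 _) (o0 _) oa
  obtain ⟨f1, h1⟩ := lemmaD hm hc (iso_mul hr hc.i1) ia1 ia2 (orth_mul har _ _) (orth_mul har _ _) oa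
  obtain ⟨f2, h2⟩ := lemmaD hm hc (iso_mul hr hc.i2) ia1 ia2 (orth_mul har _ _) (orth_mul har _ _) oa
  obtain ⟨N, hN⟩ := amp_inv hc.i1 hc.i2 hc.o
  set lam : A →ₗ[ℂ] ℂ := f1 + f2 - (2:ℂ) • f0 with hlam
  have hT : ∀ p, IsStarProjection p → IsStarProjection (s1 * p * star s1 + s2 * p * star s2) := fun p hp => by
    have := hp.map (amp s1 s2 hc.i1 hc.i2 hc.o)
    exact this
  have hnu : ∀ p, IsStarProjection p → m (r * (s1 * p * star s1 + s2 * p * star s2) * star r) =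
      2 * m (r * p * star r) + lam p := by
    intro p hp
    rw [hlam, LinearMap.sub_apply, LinearMap.add_apply, LinearMap.smul_apply, smul_eq_mul, h0 p hp, h1 p hp, h2 p hp]
    rw [mul_add, add_mul, hm.add]
    · simp only [star_mul]
      rw [show r * s1 * p * (star s1 * star r) = r * (s1 * p * star s1) * star r by noncomm_ring,
        show r * s2 * p * (star s2 * star r) = r * (s2 * p * star s2) * star r by noncomm_ring]
      ring
    · exact conj_proj hr (conj_proj hc.i1 hp)
    · exact conj_proj hr (conj_proj hc.i2 hp)
    · rw [show r * (s1 * p * star s1) * star r * (r * (s2 * p * star s2) * star r) =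
        r * s1 * p * star s1 * (star r * r) * s2 * p * star s2 * star r by noncomm_ring, hr, mul_one,
        show r * s1 * p * star s1 * s2 * p * star s2 * star r = r * s1 * p * (star s1 * s2) * p * star s2 * star r by
          noncomm_ring, hc.o]
      simp
  have lb : ∀ p, IsStarProjection p → ‖lam p‖ ≤ 3 * C := by
    intro p hp
    have := hnu p hp
    have e : lam p = m (r * (s1 * p * star s1 + s2 * p * star s2) * star r) - 2 * m (r * p * star r) := by
      rw [this]; ring
    rw [e]
    have b1 := hm.bd _ (conj_proj hr hp)
    have b2 := hm.bd _ (conj_proj hr (hT p hp))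
    refine (norm_sub_le _ _).trans ?_
    rw [norm_mul]; norm_num; linarith
  have lb' := bd_inf hc.i1 hc.i2 hc.o lb
  refine ⟨-(1/2:ℂ) • (lam.comp (N : A →ₗ[ℂ] A)), ?_⟩
  set φ : A →ₗ[ℂ] ℂ := -(1/2:ℂ) • (lam.comp (N : A →ₗ[ℂ] A)) with hφ
  have φa : ∀ x, φ x = -(1/2) * lam (N x) := fun x => rfl
  have hφT : ∀ x, φ (s1 * x * star s1 + s2 * x * star s2) = 2 * φ x + lam x := by
    intro x
    rw [φa, φa]
    have := congrArg lam (hN x).2.1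
    rw [map_sub, map_smul, smul_eq_mul] at this
    linear_combination -this
  have C0 : 0 ≤ C := (norm_nonneg _).trans (hm.bd 0 (IsStarProjection.zero A))
  have eb : ∀ p, IsStarProjection p → ‖φ p - m (r * p * star r)‖ ≤ 1000 * C := by
    intro p hp
    have b1 := hm.bd _ (conj_proj hr hp)
    have b2 := lb' (N p)
    have b3 := (hN p).2.2
    have b4 := hp.norm_le
    refine (norm_sub_le _ _).trans ?_
    rw [φa, norm_mul]
    have : ‖(-(1/2):ℂ)‖ = 1/2 := by norm_num
    rw [this]
    nlinarith
  have iter : ∀ n : ℕ, ∀ p, IsStarProjection p → 2^n * ‖φ p - m (r * p * star r)‖ ≤ 1000 * C := by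
    intro n
    induction n with
    | zero => intro p hp; simpa using eb p hp
    | succ n ih =>
      intro p hp
      have := ih _ (hT p hp)
      rw [hφT, hnu p hp, show 2 * φ p + lam p - (2 * m (r * p * star r) + lam p) = 2 * (φ p - m (r * p * star r)) by ring,
        norm_mul] at this
      norm_num at this
      rw [pow_succ]; linarith
  intro p hp
  by_contra hne
  have hpos : 0 < ‖φ p - m (r * p * star r)‖ := norm_pos_iff.2 (sub_ne_zero.2 hne)
  obtain ⟨n, hn⟩ := pow_unbounded_of_one_lt (1000 * C / ‖φ p - m (r * p * star r)‖) (show (1:ℝ) < 2 by norm_num)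
  rw [div_lt_iff₀ hpos] at hn
  exact absurd (iter n p hp) (not_le.2 hn)

theorem ext_perp {m : A → ℂ} {C : ℝ} (hm : PMeas m C) {s1 s2 : A} (hc : Cuntz s1 s2) {a : A} (ha : star a * a = 1) :
    ∃ φ : A →ₗ[ℂ] ℂ, ∀ p, IsStarProjection p → star a * p = 0 → φ p = m p := by
  obtain ⟨φ, hφ⟩ := ext_cofull hm hc (iso_mul ha hc.i2) (rr_isom ha hc.i1) (rr_orth ha hc.o)
  refine ⟨φ, fun p hp h => ?_⟩
  rw [hφ p hp, rr_fix h]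
  rw [← star_star (p * a)]; simp [hp.2.star_eq, h]
end LemD

section Glue
variable {A : Type*} [CStarAlgebra A] [PartialOrder A] [StarOrderedRing A]

theorem glue_isP {a : A} (ha : star a * a = 1) : IsStarProjection (1 - a * star a) := (isom_proj ha).one_sub

theorem perp_conj {a p : A} (h : star a * p = 0) : (1 - a * star a) * p = p := by
  rw [sub_mul, mul_assoc, h]; simp

theorem perp_right {a p : A} (hp : IsStarProjection p) (h : star a * p = 0) : p * a = 0 := by
  rw [← star_star (p * a)]; simp [hp.2.star_eq, h]

theorem corner_perp {e f : A} (he : IsStarProjection e) (hf : IsStarProjection f) (hef : e * f = f * e) :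
    IsStarProjection (e * f) := by
  refine ⟨?_, ?_⟩
  · show e * f * (e * f) = e * f
    rw [show e * f * (e * f) = e * (f * e) * f by noncomm_ring, ← hef,
      show e * (e * f) * f = (e * e) * (f * f) by noncomm_ring, he.1.eq, hf.1.eq]
  · show star (e * f) = e * f
    rw [star_mul, he.2.star_eq, hf.2.star_eq, hef]

/-- corner property -/
def CornerProp (A : Type*) [CStarAlgebra A] : Prop :=
  ∀ e : A, IsStarProjection e → ∀ ω : A →ₗ[ℂ] ℂ, (∀ p, IsStarProjection p → e * p = p → ω p = 0) →
    ∀ x, ω (e * x * e) = 0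

theorem lemmaG (hcor : CornerProp A) {m : A → ℂ} {φ ψ : A →ₗ[ℂ] ℂ} {a1 a2 a3 M : A}
    (hM : star M * M = 1) (hψ : ∀ p, IsStarProjection p → star M * p = 0 → ψ p = m p)
    (i1 : star a1 * a1 = 1) (i2 : star a2 * a2 = 1) (i3 : star a3 * a3 = 1)
    (o12 : star a1 * a2 = 0) (o13 : star a1 * a3 = 0) (o23 : star a2 * a3 = 0)
    (g1 : ∀ p, IsStarProjection p → star a1 * p = 0 → φ p = m p)
    (g2 : ∀ p, IsStarProjection p → star a2 * p = 0 → φ p = m p)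
    (g3 : ∀ p, IsStarProjection p → star a3 * p = 0 → φ p = m p)
    (c1 : (a1 * star a1) * (M * star M) = (M * star M) * (a1 * star a1))
    (c2 : (a2 * star a2) * (M * star M) = (M * star M) * (a2 * star a2))
    (c3 : (a3 * star a3) * (M * star M) = (M * star M) * (a3 * star a3)) :
    ∀ p, IsStarProjection p → star M * p = 0 → φ p = m p := by
  have key : ∀ a : A, star a * a = 1 → (∀ p, IsStarProjection p → star a * p = 0 → φ p = m p) →
      (a * star a) * (M * star M) = (M * star M) * (a * star a) →
      ∀ x, star M * x = 0 → x * M = 0 → (ψ - φ) ((1 - a * star a) * x * (1 - a * star a)) = 0 := by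
    intro a ia ga ca x h1 h2
    have hc : (1 - a * star a) * (1 - M * star M) = (1 - M * star M) * (1 - a * star a) := by
      rw [sub_mul, mul_sub, mul_sub, sub_mul, mul_sub, mul_sub, ca]; simp only [one_mul, mul_one]; abel
    have := hcor _ (corner_perp (glue_isP ia) (glue_isP hM) hc) (ψ - φ) (by
      intro p hp hpe
      have e1 : star M * p = 0 := by
        rw [← hpe, hc]
        rw [show star M * ((1 - M * star M) * (1 - a * star a) * p) = (star M - (star M * M) * star M) * (1 - a * star a) * p by noncomm_ring, hM]; simp
      have e2 : star a * p = 0 := by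
        rw [← hpe]
        rw [show star a * ((1 - a * star a) * (1 - M * star M) * p) = (star a - (star a * a) * star a) * (1 - M * star M) * p by noncomm_ring, ia]; simp
      rw [LinearMap.sub_apply, hψ p hp e1, ga p hp e2, sub_self]) x
    rw [show (1 - a * star a) * x * (1 - a * star a) = (1 - a * star a) * (1 - M * star M) * x * ((1 - a * star a) * (1 - M * star M)) from ?_]
    · exact this
    · have k1 : (1 - M * star M) * x = x := by rw [sub_mul, mul_assoc, h1]; simp
      have k2 : x * (1 - M * star M) = x := by rw [mul_sub, ← mul_assoc, h2]; simp
      rw [mul_assoc (1 - a * star a) (1 - M * star M) x, k1, hc, ← mul_assoc, mul_assoc _ x (1 - M * star M), k2]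
  have st : ∀ a : A, (a * star a) * (M * star M) = (M * star M) * (a * star a) → ∀ x, star M * x = 0 → x * M = 0 →
      star M * ((1 - a * star a) * x * (1 - a * star a)) = 0 ∧ ((1 - a * star a) * x * (1 - a * star a)) * M = 0 := by
    intro a ca x h1 h2
    constructor
    · have : star M * (1 - a * star a) * x = 0 := by
        rw [show star M * (1 - a * star a) * x = star M * x - (star M * M) * star M * (a * star a) * x by rw [hM]; noncomm_ring,
          show star M * M * star M * (a * star a) * x = star M * (M * star M * (a * star a)) * x by noncomm_ring, ← ca,
          show star M * (a * star a * (M * star M)) * x = star M * (a * star a * M) * (star M * x) by noncomm_ring, h1]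
        simp
      rw [← mul_assoc, ← mul_assoc, this, zero_mul]
    · have : x * (1 - a * star a) * M = 0 := by
        rw [show x * (1 - a * star a) * M = x * M - x * (a * star a) * M * (star M * M) by rw [hM]; noncomm_ring,
          show x * (a * star a) * M * (star M * M) = x * ((a * star a) * (M * star M)) * M by noncomm_ring, ca,
          show x * (M * star M * (a * star a)) * M = (x * M) * star M * (a * star a) * M by noncomm_ring, h2]
        simp
      rw [show (1 - a * star a) * x * (1 - a * star a) * M = (1 - a * star a) * (x * (1 - a * star a) * M) by noncomm_ring, this, mul_zero]
  intro p hp h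
  have h' := perp_right hp h
  have oo : ∀ a b : A, star a * b = 0 → (a * star a) * (b * star b) = 0 := fun a b o => by
    rw [show (a * star a) * (b * star b) = a * (star a * b) * star b by noncomm_ring, o]; simp
  have ie := incl_excl (oo _ _ o12) (oo _ _ (orth_symm o12)) (oo _ _ o13) (oo _ _ (orth_symm o13)) (oo _ _ o23) (oo _ _ (orth_symm o23)) p
  have S1 := st a1 c1 p h h'
  have S2 := st a2 c2 p h h'
  have S3 := st a3 c3 p h h'
  have S23 := st a2 c2 _ S3.1 S3.2
  have : (ψ - φ) p = 0 := by
    rw [ie]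
    simp only [map_add, map_sub]
    rw [key a1 i1 g1 c1 p h h', key a2 i2 g2 c2 p h h', key a3 i3 g3 c3 p h h',
      key a1 i1 g1 c1 _ S2.1 S2.2, key a2 i2 g2 c2 _ S3.1 S3.2, key a3 i3 g3 c3 _ S1.1 S1.2,
      key a1 i1 g1 c1 _ S23.1 S23.2]
    simp
  rw [LinearMap.sub_apply, hψ p hp h] at this
  linear_combination -this
end Glue

section Glue2
variable {A : Type*} [CStarAlgebra A] [PartialOrder A] [StarOrderedRing A]

def dcor (a : A) : A →ₗ[ℂ] A where
  toFun x := (1 - a * star a) * x * (1 - a * star a)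
  map_add' x y := by noncomm_ring
  map_smul' c x := by simp

theorem dcor_apply (a x : A) : dcor a x = (1 - a * star a) * x * (1 - a * star a) := rfl

def Pp (a x : A) : Prop := star a * x = 0 ∧ x * a = 0

theorem Pp.fix {a x : A} (h : Pp a x) : dcor a x = x := by
  rw [dcor_apply, sub_mul, mul_assoc a, h.1]
  simp only [one_mul, mul_zero, sub_zero, mul_sub, mul_one]
  rw [← mul_assoc, h.2]; simp

theorem Pp.self {a : A} (ha : star a * a = 1) (x : A) : Pp a (dcor a x) := corner_orth ha x

theorem Pp.other {a b x : A} (h : Pp a x) (o : star a * b = 0) : Pp a (dcor b x) := by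
  have o' := orth_symm o
  constructor
  · rw [dcor_apply, show star a * ((1 - b * star b) * x * (1 - b * star b)) = (star a * x - (star a * b) * star b * x) * (1 - b * star b) by noncomm_ring, o, h.1]
    simp
  · rw [dcor_apply, show (1 - b * star b) * x * (1 - b * star b) * a = (1 - b * star b) * (x * a - x * b * (star b * a)) by noncomm_ring, o', h.2]
    simp

theorem corner_agree (hcor : CornerProp A) {m : A → ℂ} {φ ψ : A →ₗ[ℂ] ℂ} {a b : A}
    (ia : star a * a = 1) (ib : star b * b = 1) (o : star a * b = 0)
    (ga : ∀ p, IsStarProjection p → star a * p = 0 → φ p = m p)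
    (gb : ∀ p, IsStarProjection p → star b * p = 0 → ψ p = m p) (x : A) (hxa : Pp a x) (hxb : Pp b x) :
    φ x = ψ x := by
  have o' := orth_symm o
  have hc : (1 - a * star a) * (1 - b * star b) = (1 - b * star b) * (1 - a * star a) := by
    rw [show (1 - a * star a) * (1 - b * star b) = 1 - a * star a - b * star b + a * (star a * b) * star b by noncomm_ring,
      show (1 - b * star b) * (1 - a * star a) = 1 - a * star a - b * star b + b * (star b * a) * star a by noncomm_ring, o, o']
    simp
  have := hcor _ (corner_perp (glue_isP ia) (glue_isP ib) hc) (φ - ψ) (by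
    intro p hp hpe
    have e1 : star a * p = 0 := by
      rw [← hpe]
      rw [show star a * ((1 - a * star a) * (1 - b * star b) * p) = (star a - (star a * a) * star a) * (1 - b * star b) * p by noncomm_ring, ia]; simp
    have e2 : star b * p = 0 := by
      rw [← hpe, hc]
      rw [show star b * ((1 - b * star b) * (1 - a * star a) * p) = (star b - (star b * b) * star b) * (1 - a * star a) * p by noncomm_ring, ib]; simp
    rw [LinearMap.sub_apply, ga p hp e1, gb p hp e2, sub_self]) x
  rw [show (1 - a * star a) * (1 - b * star b) * x * ((1 - a * star a) * (1 - b * star b)) = x from ?_] at this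
  · exact sub_eq_zero.1 this
  · have h1 : (1 - a * star a) * ((1 - b * star b) * x * (1 - b * star b)) * (1 - a * star a) = x := by
      have h2 := hxb.fix; have h3 := hxa.fix
      rw [dcor_apply] at h2 h3
      rw [h2, h3]
    nth_rewrite 2 [hc]
    rw [← h1]
    rw [h1]
    calc _ = (1 - a * star a) * ((1 - b * star b) * x * (1 - b * star b)) * (1 - a * star a) := by simp only [mul_assoc]
      _ = x := h1

theorem glue_base (hcor : CornerProp A) {m : A → ℂ} {φ1 φ2 φ3 : A →ₗ[ℂ] ℂ} {a1 a2 a3 : A}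
    (i1 : star a1 * a1 = 1) (i2 : star a2 * a2 = 1) (i3 : star a3 * a3 = 1)
    (o12 : star a1 * a2 = 0) (o13 : star a1 * a3 = 0) (o23 : star a2 * a3 = 0)
    (g1 : ∀ p, IsStarProjection p → star a1 * p = 0 → φ1 p = m p)
    (g2 : ∀ p, IsStarProjection p → star a2 * p = 0 → φ2 p = m p)
    (g3 : ∀ p, IsStarProjection p → star a3 * p = 0 → φ3 p = m p) :
    ∃ φ : A →ₗ[ℂ] ℂ, (∀ p, IsStarProjection p → star a1 * p = 0 → φ p = m p) ∧
      (∀ p, IsStarProjection p → star a2 * p = 0 → φ p = m p) ∧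
      (∀ p, IsStarProjection p → star a3 * p = 0 → φ p = m p) := by
  have o21 := orth_symm o12
  have o31 := orth_symm o13
  have o32 := orth_symm o23
  have A12 := corner_agree hcor i1 i2 o12 g1 g2
  have A13 := corner_agree hcor i1 i3 o13 g1 g3
  have A23 := corner_agree hcor i2 i3 o23 g2 g3
  refine ⟨φ1 ∘ₗ dcor a1 + φ2 ∘ₗ dcor a2 + φ3 ∘ₗ dcor a3 - φ1 ∘ₗ dcor a1 ∘ₗ dcor a2 - φ2 ∘ₗ dcor a2 ∘ₗ dcor a3
    - φ3 ∘ₗ dcor a3 ∘ₗ dcor a1 + φ1 ∘ₗ dcor a1 ∘ₗ dcor a2 ∘ₗ dcor a3, ?_, ?_, ?_⟩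
  all_goals
    intro p hp h
    have P : Pp _ p := ⟨h, perp_right hp h⟩
    simp only [LinearMap.add_apply, LinearMap.sub_apply, LinearMap.comp_apply]
  · rw [P.fix, (P.other o12).fix, ((P.other o13).other o12).fix, A12 _ (P.other o12) (Pp.self i2 _),
      A12 _ ((P.other o13).other o12) (Pp.self i2 _), g1 p hp h]
    ring
  · rw [P.fix, (P.other o23).fix, A23 _ (P.other o23) (Pp.self i3 _), g2 p hp h,
      A13 _ (Pp.self i1 _) ((Pp.self i3 _).other o31)]
    have e : dcor a1 (dcor a3 p) = dcor a3 (dcor a1 p) := by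
      have k1 : star a1 * a3 = 0 := o13
      simp only [dcor_apply]
      have hc : (1 - a1 * star a1) * (1 - a3 * star a3) = (1 - a3 * star a3) * (1 - a1 * star a1) := by
        rw [show (1 - a1 * star a1) * (1 - a3 * star a3) = 1 - a1 * star a1 - a3 * star a3 + a1 * (star a1 * a3) * star a3 by noncomm_ring,
          show (1 - a3 * star a3) * (1 - a1 * star a1) = 1 - a1 * star a1 - a3 * star a3 + a3 * (star a3 * a1) * star a1 by noncomm_ring, o13, o31]
        simp
      calc _ = ((1 - a1 * star a1) * (1 - a3 * star a3)) * p * ((1 - a3 * star a3) * (1 - a1 * star a1)) := by simp only [mul_assoc]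
        _ = ((1 - a3 * star a3) * (1 - a1 * star a1)) * p * ((1 - a1 * star a1) * (1 - a3 * star a3)) := by rw [hc]
        _ = _ := by simp only [mul_assoc]
    rw [e]; ring
  · rw [P.fix, (P.other o31).fix, ← A13 _ (Pp.self i1 _) (P.other o31), g3 p hp h]
    ring

theorem glue_main (hcor : CornerProp A) {m : A → ℂ} {C : ℝ} (hm : PMeas m C) {s1 s2 : A} (hc : Cuntz s1 s2)
    (lz : ∀ W : A, ∃ a b : A, star a * a = 1 ∧ star b * b = 1 ∧ star b * W * a = 0)
    (dich : ∀ p : A, IsStarProjection p → ∃ a : A, star a * a = 1 ∧ (star a * p = 0 ∨ star a * (1 - p) = 0)) :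
    ∃ φ : A →ₗ[ℂ] ℂ, ∀ p, IsStarProjection p → φ p = m p := by
  have i1 : star s1 * s1 = 1 := hc.i1
  have i2 : star (s2 * s1) * (s2 * s1) = 1 := iso_mul hc.i2 hc.i1
  have i3 : star (s2 * s2) * (s2 * s2) = 1 := iso_mul hc.i2 hc.i2
  have o12 : star s1 * (s2 * s1) = 0 := by rw [← mul_assoc, hc.o, zero_mul]
  have o13 : star s1 * (s2 * s2) = 0 := by rw [← mul_assoc, hc.o, zero_mul]
  have o23 : star (s2 * s1) * (s2 * s2) = 0 := by
    rw [star_mul, show star s1 * star s2 * (s2 * s2) = star s1 * (star s2 * s2) * s2 by noncomm_ring, hc.i2, mul_one, hc.o]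
  generalize s2 * s1 = t2 at *
  generalize s2 * s2 = t3 at *
  obtain ⟨φ1, g1⟩ := ext_perp hm hc i1
  obtain ⟨φ2, g2⟩ := ext_perp hm hc i2
  obtain ⟨φ3, g3⟩ := ext_perp hm hc i3
  obtain ⟨φ, G1, G2, G3⟩ := glue_base hcor i1 i2 i3 o12 o13 o23 g1 g2 g3
  refine ⟨φ, ?_⟩
  have z : ∀ a b x y: A, star a * b = 0 → (x * star a) * (b * y) = 0 := fun a b x y o => by
    rw [show (x * star a) * (b * y) = x * (star a * b) * y by noncomm_ring, o]; simp
  have st1 : ∀ y : A, star y * y = 1 → ∀ p, IsStarProjection p → star (s1 * y) * p = 0 → φ p = m p := by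
    intro y hy
    obtain ⟨ψ, hψ⟩ := ext_perp hm hc (iso_mul i1 hy)
    have q2 := orth_mul o12 y 1
    have q3 := orth_mul o13 y 1
    rw [mul_one] at q2 q3
    refine lemmaG hcor (iso_mul i1 hy) hψ i1 i2 i3 o12 o13 o23 G1 G2 G3 ?_ ?_ ?_
    · simp only [star_mul]
      rw [show s1 * star s1 * (s1 * y * (star y * star s1)) = s1 * (star s1 * s1) * y * star y * star s1 by noncomm_ring,
        show (s1 * y * (star y * star s1)) * (s1 * star s1) = s1 * y * star y * (star s1 * s1) * star s1 by noncomm_ring, i1]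
      noncomm_ring
    · rw [z _ _ _ _ (orth_symm q2), z _ _ _ _ q2]
    · rw [z _ _ _ _ (orth_symm q3), z _ _ _ _ q3]
  have st2 : ∀ y N : A, star y * y = 1 → star N * N = 1 → star N * (s1 * y) = 0 →
      ∀ p, IsStarProjection p → star N * p = 0 → φ p = m p := by
    intro y N hy hN o
    obtain ⟨ψ, hψ⟩ := ext_perp hm hc hN
    have hs := iso_mul i1 hy
    have oo : ∀ a b : A, star a * b = 0 → star (s1 * (y * a)) * (s1 * (y * b)) = 0 := by
      intro a b h
      rw [← mul_assoc s1 y a, ← mul_assoc s1 y b, star_mul, show star a * star (s1 * y) * (s1 * y * b) = star a * (star (s1 * y) * (s1 * y)) * b by noncomm_ring, hs]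
      simpa using h
    have on : ∀ a : A, star N * (s1 * (y * a)) = 0 := fun a => by
      rw [← mul_assoc s1, ← mul_assoc, o, zero_mul]
    have cm : ∀ a : A, (s1 * (y * a)) * star (s1 * (y * a)) * (N * star N) = (N * star N) * ((s1 * (y * a)) * star (s1 * (y * a))) :=
      fun a => by rw [z _ _ _ _ (orth_symm (on a)), z _ _ _ _ (on a)]
    exact lemmaG hcor hN hψ (iso_mul i1 (iso_mul hy i1)) (iso_mul i1 (iso_mul hy i2)) (iso_mul i1 (iso_mul hy i3))
      (oo _ _ o12) (oo _ _ o13) (oo _ _ o23) (st1 _ (iso_mul hy i1)) (st1 _ (iso_mul hy i2)) (st1 _ (iso_mul hy i3))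
      (cm _) (cm _) (cm _)
  have good : ∀ N : A, star N * N = 1 → ∀ p, IsStarProjection p → star N * p = 0 → φ p = m p := by
    intro N hN p hp h
    obtain ⟨y, a, hy, ha, hya⟩ := lz (star N * s1)
    refine st2 y (N * a) hy (iso_mul hN ha) ?_ p hp ?_
    · rw [star_mul, ← hya]; noncomm_ring
    · rw [star_mul, mul_assoc, h, mul_zero]
  have split : ∀ p, IsStarProjection p → m 1 = m p + m (1 - p) := by
    intro p hp
    rw [← hm.add _ _ hp hp.one_sub (by rw [mul_sub, mul_one, hp.1.eq, sub_self])]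
    congr 1; abel
  have one : φ 1 = m 1 := by
    have e1 := split _ (isom_proj i1)
    rw [← G2 _ (isom_proj i1) (by rw [← mul_assoc, orth_symm o12, zero_mul]), ← G1 _ (isom_proj i1).one_sub (by
      rw [show star s1 * (1 - s1 * star s1) = star s1 - (star s1 * s1) * star s1 by noncomm_ring, i1]; simp), ← map_add] at e1
    rw [e1]; congr 1; abel
  intro p hp
  obtain ⟨a, ha, h | h⟩ := dich p hp
  · exact good a ha p hp h
  · have e1 := good a ha _ hp.one_sub h
    rw [map_sub, one, split p hp] at e1
    linear_combination -e1
end Glue2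

section HilbIso
variable {E : Type u} [NormedAddCommGroup E] [InnerProductSpace ℂ E] [CompleteSpace E]

theorem hb_ext {ι : Type*} (b : HilbertBasis ι ℂ E) {T S : E →L[ℂ] E} (h : ∀ i, T (b i) = S (b i)) : T = S := by
  refine ContinuousLinearMap.ext_on (s := Set.range b) ?_ ?_
  · rw [dense_iff_closure_eq, ← Submodule.topologicalClosure_coe, b.dense_span]; rfl
  · rintro _ ⟨i, rfl⟩; exact h i

theorem star_mul_one_iff (V : E →L[ℂ] E) : star V * V = 1 ↔ ∀ x, ‖V x‖ = ‖x‖ := by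
  rw [ContinuousLinearMap.norm_map_iff_adjoint_comp_self]; rfl

theorem hb_isom {ι : Type*} (b : HilbertBasis ι ℂ E) {v : ι → E} (hv : Orthonormal ℂ v) :
    ∃ V : E →L[ℂ] E, star V * V = 1 ∧ ∀ i, V (b i) = v i := by
  classical
  set L := hv.orthogonalFamily.linearIsometry with hL
  refine ⟨(L.comp b.repr.toLinearIsometry).toContinuousLinearMap, ?_, ?_⟩
  · rw [star_mul_one_iff]
    intro x
    exact (L.comp b.repr.toLinearIsometry).norm_map x
  · intro i
    show L (b.repr (b i)) = v i
    rw [b.repr_self, hL, OrthogonalFamily.linearIsometry_apply_single]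
    simp

theorem star_mul_zero {ι : Type*} (b : HilbertBasis ι ℂ E) {V W T : E →L[ℂ] E}
    (h : ∀ i j, inner ℂ (V (b i)) (T (W (b j))) = 0) : star V * T * W = 0 := by
  refine hb_ext b fun j => ?_
  have : ∀ i, inner ℂ (b i) ((star V * T * W) (b j)) = 0 := by
    intro i
    show inner ℂ (b i) ((ContinuousLinearMap.adjoint V) (T (W (b j)))) = 0
    rw [ContinuousLinearMap.adjoint_inner_right]; exact h i j
  have h2 : b.repr ((star V * T * W) (b j)) = 0 := by
    ext i
    rw [b.repr_apply_apply, this i]; rfl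
  simpa using h2

theorem exists_cuntz {ι : Type*} [Infinite ι] (b : HilbertBasis ι ℂ E) : ∃ s1 s2 : E →L[ℂ] E, Cuntz s1 s2 := by
  have e : Nonempty (ι ≃ ι ⊕ ι) := by
    rw [← Cardinal.eq, Cardinal.mk_sum, Cardinal.lift_id, Cardinal.add_eq_self (Cardinal.aleph0_le_mk ι)]
  obtain ⟨e⟩ := e
  obtain ⟨s1, i1, h1⟩ := hb_isom b (b.orthonormal.comp (fun i => e.symm (Sum.inl i)) (fun i j h => by simpa using h))
  obtain ⟨s2, i2, h2⟩ := hb_isom b (b.orthonormal.comp (fun i => e.symm (Sum.inr i)) (fun i j h => by simpa using h))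
  have o : star s1 * s2 = 0 := by
    rw [← mul_one (star s1)]
    refine star_mul_zero b fun i j => ?_
    rw [h1, h2]
    exact b.orthonormal.2 (by simp)
  have o' := orth_symm o
  refine ⟨s1, s2, i1, i2, o, ?_⟩
  refine hb_ext b fun k => ?_
  show s1 (star s1 (b k)) + s2 (star s2 (b k)) = b k
  have hk : (∃ i, k = e.symm (Sum.inl i)) ∨ (∃ i, k = e.symm (Sum.inr i)) := by
    rcases h : e k with i | i
    · left; exact ⟨i, by rw [← h]; simp⟩
    · right; exact ⟨i, by rw [← h]; simp⟩
  have ap : ∀ (S T U : E →L[ℂ] E) x, S * T = U → S (T x) = U x := fun S T U x h => by rw [← h]; rfl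
  obtain ⟨i, rfl⟩ | ⟨i, rfl⟩ := hk
  · have : b (e.symm (Sum.inl i)) = s1 (b i) := (h1 i).symm
    rw [this, ap _ _ _ _ i1, ap _ _ _ _ o']; simp
  · have : b (e.symm (Sum.inr i)) = s2 (b i) := (h2 i).symm
    rw [this, ap _ _ _ _ i2, ap _ _ _ _ o]; simp

theorem small_perp {ι : Type u} [Infinite ι] (b : HilbertBasis ι ℂ E) (S : Set E) (hS : Cardinal.mk S < Cardinal.mk ι) :
    ∃ v : E, ‖v‖ = 1 ∧ ∀ s ∈ S, inner ℂ s v = 0 := by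
  by_cases hf : S.Finite
  · have : FiniteDimensional ℂ (Submodule.span ℂ S) := FiniteDimensional.span_of_finite ℂ hf
    have hne : (Submodule.span ℂ S)ᗮ ≠ ⊥ := by
      intro h
      rw [Submodule.orthogonal_eq_bot_iff] at h
      have : FiniteDimensional ℂ E := by
        rw [h] at this
        exact Module.Finite.of_surjective (⊤ : Submodule ℂ E).subtype (fun x => ⟨⟨x, trivial⟩, rfl⟩)
      have := b.orthonormal.linearIndependent.finite
      exact not_finite ι
    obtain ⟨v, hv, v0⟩ := Submodule.exists_mem_ne_zero_of_ne_bot hne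
    refine ⟨(‖v‖⁻¹ : ℂ) • v, ?_, ?_⟩
    · rw [norm_smul]; simp [v0]
    · intro s hs
      rw [inner_smul_right, (Submodule.mem_orthogonal _ _).1 hv s (Submodule.subset_span hs), mul_zero]
  · have hinf : Infinite S := Set.infinite_coe_iff.2 hf
    have hc : ∀ s : S, (Function.support fun i => ‖inner ℂ (b i) (s : E)‖^2).Countable := fun s =>
      (b.orthonormal.inner_products_summable (s:E)).countable_support
    set U := ⋃ s : S, (Function.support fun i => ‖inner ℂ (b i) (s : E)‖^2)
    have hU : Cardinal.mk U < Cardinal.mk ι := by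
      refine lt_of_le_of_lt ?_ hS
      refine (Cardinal.mk_iUnion_le _).trans ?_
      refine (mul_le_mul_right (ciSup_le' fun s => (hc s).le_aleph0) _).trans ?_
      exact (Cardinal.mul_aleph0_eq (Cardinal.aleph0_le_mk S)).le
    obtain ⟨i, hi⟩ : ∃ i, i ∉ U := by
      by_contra hh
      push Not at hh
      have : U = Set.univ := Set.eq_univ_of_forall hh
      rw [this, Cardinal.mk_univ] at hU
      exact lt_irrefl _ hU
    refine ⟨b i, b.orthonormal.1 i, fun s hs => ?_⟩
    have : i ∉ (Function.support fun i => ‖inner ℂ (b i) s‖^2) := fun h => hi (Set.mem_iUnion.2 ⟨⟨s, hs⟩, h⟩)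
    simp at this
    rw [← inner_conj_symm, this, map_zero]

theorem lemZ {ι : Type u} [Infinite ι] (b : HilbertBasis ι ℂ E) (W : E →L[ℂ] E) :
    ∃ a b : E →L[ℂ] E, star a * a = 1 ∧ star b * b = 1 ∧ star b * W * a = 0 := by
  let P : Set (Set (E × E)) := {S | (∀ x ∈ S, ‖x.1‖ = 1 ∧ ‖x.2‖ = 1) ∧
    (∀ x ∈ S, ∀ y ∈ S, x ≠ y → inner ℂ x.1 y.1 = 0 ∧ inner ℂ x.2 y.2 = 0) ∧
    (∀ x ∈ S, ∀ y ∈ S, inner ℂ x.2 (W y.1) = 0)}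
  obtain ⟨S, hS⟩ := zorn_subset P (by
    intro c hc hch
    refine ⟨⋃₀ c, ⟨?_, ?_, ?_⟩, fun s hs => Set.subset_sUnion_of_mem hs⟩
    · rintro x ⟨s, hs, hx⟩; exact (hc hs).1 x hx
    · rintro x ⟨s, hs, hx⟩ y ⟨t, ht, hy⟩ hxy
      rcases hch.total hs ht with h | h
      · exact (hc ht).2.1 x (h hx) y hy hxy
      · exact (hc hs).2.1 x hx y (h hy) hxy
    · rintro x ⟨s, hs, hx⟩ y ⟨t, ht, hy⟩
      rcases hch.total hs ht with h | h
      · exact (hc ht).2.2 x (h hx) y hy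
      · exact (hc hs).2.2 x hx y (h hy))
  have hP := hS.prop
  have hcard : Cardinal.mk ι ≤ Cardinal.mk S := by
    by_contra hlt
    rw [not_le] at hlt
    have inf := Cardinal.aleph0_le_mk ι
    obtain ⟨p, p1, hp⟩ := small_perp b (Prod.fst '' S ∪ (fun x : E × E => (ContinuousLinearMap.adjoint W) x.2) '' S) (by
      refine (Cardinal.mk_union_le _ _).trans_lt (Cardinal.add_lt_of_lt inf ?_ ?_)
      · exact Cardinal.mk_image_le.trans_lt hlt
      · exact Cardinal.mk_image_le.trans_lt hlt)
    obtain ⟨q, q1, hq⟩ := small_perp b ((Prod.snd '' S ∪ (fun x : E × E => W x.1) '' S) ∪ {W p}) (by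
      refine (Cardinal.mk_union_le _ _).trans_lt (Cardinal.add_lt_of_lt inf ((Cardinal.mk_union_le _ _).trans_lt (Cardinal.add_lt_of_lt inf ?_ ?_)) ?_)
      · exact Cardinal.mk_image_le.trans_lt hlt
      · exact Cardinal.mk_image_le.trans_lt hlt
      · rw [Cardinal.mk_singleton]; exact Cardinal.one_lt_aleph0.trans_le inf)
    have A1 : ∀ x ∈ S, inner ℂ x.1 p = 0 := fun x hx => hp _ (Or.inl ⟨x, hx, rfl⟩)
    have A2 : ∀ x ∈ S, inner ℂ x.2 (W p) = 0 := fun x hx => by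
      have := hp _ (Or.inr ⟨x, hx, rfl⟩)
      rwa [ContinuousLinearMap.adjoint_inner_left] at this
    have B1 : ∀ x ∈ S, inner ℂ x.2 q = 0 := fun x hx => hq _ (Or.inl (Or.inl ⟨x, hx, rfl⟩))
    have B2 : ∀ x ∈ S, inner ℂ q (W x.1) = 0 := fun x hx => by
      rw [inner_eq_zero_symm]; exact hq _ (Or.inl (Or.inr ⟨x, hx, rfl⟩))
    have B3 : inner ℂ q (W p) = 0 := by
      rw [inner_eq_zero_symm]; exact hq _ (Or.inr rfl)
    have hin : insert (p, q) S ∈ P := by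
      refine ⟨?_, ?_, ?_⟩
      · rintro x (rfl | hx)
        · exact ⟨p1, q1⟩
        · exact hP.1 x hx
      · rintro x (rfl | hx) y (rfl | hy) hxy
        · exact absurd rfl hxy
        · exact ⟨inner_eq_zero_symm.1 (A1 y hy), inner_eq_zero_symm.1 (B1 y hy)⟩
        · exact ⟨A1 x hx, B1 x hx⟩
        · exact hP.2.1 x hx y hy hxy
      · rintro x (rfl | hx) y (rfl | hy)
        · exact B3
        · exact B2 y hy
        · exact A2 x hx
        · exact hP.2.2 x hx y hy
    have : (p, q) ∈ S := hS.le_of_ge hin (Set.subset_insert _ _) (Set.mem_insert _ _)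
    have := A1 _ this
    simp only [inner_self_eq_norm_sq_to_K, p1] at this
    simp at this
  obtain ⟨f⟩ := hcard
  have onf : ∀ v : E × E → E, (∀ x ∈ S, ‖v x‖ = 1) → (∀ x ∈ S, ∀ y ∈ S, x ≠ y → inner ℂ (v x) (v y) = 0) →
      Orthonormal ℂ (fun i => v (f i)) := fun v h1 h2 =>
    ⟨fun i => h1 _ (f i).2, fun i j hij => h2 _ (f i).2 _ (f j).2 (fun h => hij (f.injective (Subtype.ext h)))⟩
  obtain ⟨a, ia, ha⟩ := hb_isom b (onf Prod.fst (fun x hx => (hP.1 x hx).1) (fun x hx y hy h => (hP.2.1 x hx y hy h).1))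
  obtain ⟨c, ic, hc⟩ := hb_isom b (onf Prod.snd (fun x hx => (hP.1 x hx).2) (fun x hx y hy h => (hP.2.1 x hx y hy h).2))
  refine ⟨a, c, ia, ic, star_mul_zero b fun i j => ?_⟩
  rw [ha, hc]
  exact hP.2.2 _ (f i).2 _ (f j).2

theorem dich_proj {ι : Type u} [Infinite ι] (b : HilbertBasis ι ℂ E) (p : E →L[ℂ] E) (hp : IsStarProjection p) :
    ∃ a : E →L[ℂ] E, star a * a = 1 ∧ (star a * p = 0 ∨ star a * (1 - p) = 0) := by
  -- maximal orthonormal set in the union of range and kernel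
  have hpp : ∀ x, p (p x) = p x := fun x => by
    have := congrArg (fun T : E →L[ℂ] E => T x) hp.1.eq; exact this
  have sa : ∀ x y, inner ℂ (p x) y = inner ℂ x (p y) := fun x y => by
    rw [← ContinuousLinearMap.adjoint_inner_left]
    congr 1
    exact congrArg (fun T : E →L[ℂ] E => T x) hp.2.star_eq.symm
  have key : ∀ q : E →L[ℂ] E, IsClosed {x : E | q x = x} ∧ True := fun q => ⟨isClosed_eq q.continuous continuous_id, trivial⟩
  have bas : ∀ q : E →L[ℂ] E, ∃ w : Set E, Orthonormal ℂ ((↑) : w → E) ∧ (∀ x ∈ w, q x = x) ∧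
      ∀ v, q v = v → (∀ x ∈ w, inner ℂ x v = 0) → v = 0 := by
    intro q
    set K : Submodule ℂ E := LinearMap.eqLocus (q : E →ₗ[ℂ] E) LinearMap.id with hK
    have : IsClosed (K : Set E) := (key q).1
    have : CompleteSpace K := this.completeSpace_coe
    obtain ⟨w, c, hc⟩ := exists_hilbertBasis ℂ K
    refine ⟨Subtype.val '' w, ?_, ?_, ?_⟩
    · have on : Orthonormal ℂ (fun x : w => ((x : K) : E)) := by
        have := c.orthonormal.comp_linearIsometry K.subtypeₗᵢ
        rw [hc] at this
        exact this
      refine ⟨?_, ?_⟩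
      · rintro ⟨_, x, hx, rfl⟩; exact on.1 ⟨x, hx⟩
      · rintro ⟨_, x, hx, rfl⟩ ⟨_, y, hy, rfl⟩ hxy
        refine on.2 (i := ⟨x, hx⟩) (j := ⟨y, hy⟩) (fun h => hxy ?_)
        have := congrArg (fun z : w => ((z : K) : E)) h
        exact Subtype.ext this
    · rintro _ ⟨x, hx, rfl⟩; exact x.2
    · intro v hv h
      have h2 : c.repr ⟨v, hv⟩ = 0 := by
        ext i
        rw [c.repr_apply_apply, hc]
        exact h _ ⟨i, i.2, rfl⟩
      have : (⟨v, hv⟩ : K) = 0 := by simpa using h2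
      exact congrArg Subtype.val this
  have fin : ∀ q : E →L[ℂ] E, IsStarProjection q → ∀ w : Set E, Orthonormal ℂ ((↑) : w → E) → (∀ x ∈ w, q x = x) →
      Cardinal.mk ι ≤ Cardinal.mk w → ∃ a : E →L[ℂ] E, star a * a = 1 ∧ star a * (1 - q) = 0 := by
    intro q hq w on hw hc
    obtain ⟨f⟩ := hc
    obtain ⟨a, ia, ha⟩ := hb_isom b (on.comp f f.injective)
    refine ⟨a, ia, ?_⟩
    have : q * a = a := hb_ext b fun i => by
      show q (a (b i)) = a (b i)
      rw [ha]; exact hw _ (f i).2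
    have h2 := congrArg star this
    rw [star_mul, hq.2.star_eq] at h2
    rw [mul_sub, h2, mul_one, sub_self]
  obtain ⟨w1, on1, h1, m1⟩ := bas p
  obtain ⟨w2, on2, h2, m2⟩ := bas (1 - p)
  by_cases c1 : Cardinal.mk ι ≤ Cardinal.mk w1
  · obtain ⟨a, ia, ha⟩ := fin p hp w1 on1 h1 c1
    exact ⟨a, ia, Or.inr ha⟩
  by_cases c2 : Cardinal.mk ι ≤ Cardinal.mk w2
  · obtain ⟨a, ia, ha⟩ := fin _ hp.one_sub w2 on2 h2 c2
    exact ⟨a, ia, Or.inl (by simpa using ha)⟩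
  rw [not_le] at c1 c2
  obtain ⟨v, v1, hv⟩ := small_perp b (w1 ∪ w2) ((Cardinal.mk_union_le _ _).trans_lt (Cardinal.add_lt_of_lt (Cardinal.aleph0_le_mk ι) c1 c2))
  have e1 := m1 (p v) (hpp v) (fun x hx => by rw [← sa, h1 x hx]; exact hv x (Or.inl hx))
  have e2 := m2 ((1 - p) v) (by simp [hpp]) (fun x hx => by
    have hx2 := h2 x hx
    have : p x = 0 := by simpa using hx2
    simp only [ContinuousLinearMap.sub_apply, ContinuousLinearMap.one_apply, inner_sub_right]
    rw [← sa, this, inner_zero_left, hv x (Or.inr hx), sub_zero])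
  have : v = 0 := by
    simpa [e1] using e2
  rw [this] at v1; simp at v1
end HilbIso

section BdAll
variable {E : Type u} [NormedAddCommGroup E] [InnerProductSpace ℂ E] [CompleteSpace E]
open InnerProductSpace

theorem exists_inf_basis (h : ¬ FiniteDimensional ℂ E) : ∃ (ι : Type u) (_ : HilbertBasis ι ℂ E), Infinite ι := by
  obtain ⟨w, b, hb⟩ := exists_hilbertBasis ℂ E
  refine ⟨w, b, ?_⟩
  by_contra hf
  rw [not_infinite_iff_finite] at hf
  have := Fintype.ofFinite w
  exact h (Module.Basis.finiteDimensional_of_finite b.toOrthonormalBasis.toBasis)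

theorem sa_mem_span [FiniteDimensional ℂ E] (T : E →L[ℂ] E) (hT : IsSelfAdjoint T) :
    T ∈ Submodule.span ℂ {p : E →L[ℂ] E | IsStarProjection p} := by
  have hs : (T : E →ₗ[ℂ] E).IsSymmetric := ContinuousLinearMap.isSelfAdjoint_iff_isSymmetric.1 hT
  set v := hs.eigenvectorBasis rfl with hv
  have e : T = ∑ i, ((hs.eigenvalues rfl i : ℝ) : ℂ) • rankOne ℂ (v i) (v i) := by
    have : (T : E →ₗ[ℂ] E) = ((∑ i, ((hs.eigenvalues rfl i : ℝ) : ℂ) • rankOne ℂ (v i) (v i) : E →L[ℂ] E) : E →ₗ[ℂ] E) := by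
      refine v.toBasis.ext fun j => ?_
      simp only [OrthonormalBasis.coe_toBasis]
      rw [hv, hs.apply_eigenvectorBasis rfl j, ← hv]
      simp only [ContinuousLinearMap.coe_coe, ContinuousLinearMap.sum_apply, ContinuousLinearMap.smul_apply, rankOne_apply,
        orthonormal_iff_ite.1 v.orthonormal, ite_smul, one_smul, zero_smul, smul_ite, smul_zero]
      rw [Finset.sum_ite_eq' Finset.univ j]
      simp
    exact ContinuousLinearMap.coe_injective this
  rw [e]
  exact Submodule.sum_mem _ fun i _ => Submodule.smul_mem _ _ (Submodule.subset_span (isStarProjection_rankOne_self (v.orthonormal.1 i)))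

theorem span_proj_fin [FiniteDimensional ℂ E] : ⊤ ≤ Submodule.span ℂ {p : E →L[ℂ] E | IsStarProjection p} := by
  intro x _
  rw [← realPart_add_I_smul_imaginaryPart x]
  exact Submodule.add_mem _ (sa_mem_span _ (realPart x).2) (Submodule.smul_mem _ _ (sa_mem_span _ (imaginaryPart x).2))

theorem bd_all (E : Type u) [NormedAddCommGroup E] [InnerProductSpace ℂ E] [CompleteSpace E] :
    ∃ K : ℝ, 0 ≤ K ∧ ∀ (φ : (E →L[ℂ] E) →ₗ[ℂ] ℂ) (C : ℝ), (∀ p, IsStarProjection p → ‖φ p‖ ≤ C) →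
      ∀ x, ‖φ x‖ ≤ K * C * ‖x‖ := by
  by_cases hf : FiniteDimensional ℂ E
  · let b := Module.Basis.ofSpan (span_proj_fin (E := E))
    have hb : ∀ i, IsStarProjection (b i) := fun i => Module.Basis.ofSpan_subset (span_proj_fin (E := E)) ⟨i, rfl⟩
    have : Finite ((linearIndepOn_empty ℂ id).extend (Set.empty_subset {p : E →L[ℂ] E | IsStarProjection p})) :=
      Module.Finite.finite_basis b
    have := Fintype.ofFinite ((linearIndepOn_empty ℂ id).extend (Set.empty_subset {p : E →L[ℂ] E | IsStarProjection p}))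
    refine ⟨∑ i, ‖LinearMap.toContinuousLinearMap (b.coord i)‖, Finset.sum_nonneg fun i _ => norm_nonneg _, fun φ C hC x => ?_⟩
    have hx : φ x = ∑ i, b.coord i x * φ (b i) := by
      conv_lhs => rw [← b.sum_repr x]
      rw [map_sum]
      exact Finset.sum_congr rfl fun i _ => by rw [map_smul]; rfl
    rw [hx, Finset.sum_mul, Finset.sum_mul]
    refine (norm_sum_le _ _).trans (Finset.sum_le_sum fun i _ => ?_)
    rw [norm_mul]
    have h1 : ‖b.coord i x‖ ≤ ‖LinearMap.toContinuousLinearMap (b.coord i)‖ * ‖x‖ :=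
      (LinearMap.toContinuousLinearMap (b.coord i)).le_opNorm x
    have h2 := hC _ (hb i)
    calc _ ≤ (‖LinearMap.toContinuousLinearMap (b.coord i)‖ * ‖x‖) * C :=
          mul_le_mul h1 h2 (norm_nonneg _) (by positivity)
      _ = _ := by ring
  · obtain ⟨ι, b, hι⟩ := exists_inf_basis hf
    obtain ⟨s1, s2, hc⟩ := exists_cuntz b
    exact ⟨224, by norm_num, fun φ C hC x => bd_inf hc.i1 hc.i2 hc.o hC x⟩

theorem zero_of_proj (φ : (E →L[ℂ] E) →ₗ[ℂ] ℂ) (h : ∀ p, IsStarProjection p → φ p = 0) (x : E →L[ℂ] E) : φ x = 0 := by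
  obtain ⟨K, _, hK⟩ := bd_all E
  have := hK φ 0 (fun p hp => by rw [h p hp]; simp) x
  simpa using this

theorem corner_all : CornerProp (E →L[ℂ] E) := by
  intro e he ω hω x
  obtain ⟨K, hKp, hK⟩ := isStarProjection_iff_eq_starProjection.1 he
  have hKc : CompleteSpace K := by
    have : IsClosed (K : Set E) := by
      have h2 : (K : Set E) = {y | e y = y} := by
        ext y; rw [hK]; exact Submodule.starProjection_eq_self_iff.symm
      rw [h2]; exact isClosed_eq e.continuous continuous_id
    exact this.completeSpace_coe
  set V : K →L[ℂ] E := K.subtypeL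
  set P : E →L[ℂ] K := K.orthogonalProjectionOnto
  have hVP : ∀ y, V (P y) = e y := fun y => by rw [hK]; rfl
  have hPV : ∀ y, P (V y) = y := fun y => by simp [P, V]
  have adj : ∀ (y : E) (z : K), inner ℂ (P y) z = inner ℂ y (V z) := fun y z => by
    have := K.adjoint_subtypeL
    show inner ℂ (K.orthogonalProjectionOnto y) z = _
    rw [← this, ContinuousLinearMap.adjoint_inner_left]
  let ω' : (K →L[ℂ] K) →ₗ[ℂ] ℂ :=
    { toFun := fun T => ω (V ∘L T ∘L P)
      map_add' := fun S T => by rw [← map_add]; congr 1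
      map_smul' := fun c T => by rw [RingHom.id_apply, ← map_smul]; congr 1 }
  have h0 : ∀ T, ω' T = 0 := zero_of_proj ω' (by
    intro p hp
    refine hω _ ⟨?_, ?_⟩ ?_
    · ext y
      show V (p (P (V (p (P y))))) = V (p (P y))
      rw [hPV]
      have := congrArg (fun T : K →L[ℂ] K => T (P y)) hp.1.eq
      exact congrArg V this
    · rw [ContinuousLinearMap.isSelfAdjoint_iff_isSymmetric]
      intro y z
      show inner ℂ (V (p (P y))) z = inner ℂ y (V (p (P z)))
      rw [← adj, ← inner_conj_symm, ← adj, inner_conj_symm]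
      exact (ContinuousLinearMap.isSelfAdjoint_iff_isSymmetric.1 hp.2) _ _
    · ext y
      show e (V (p (P y))) = V (p (P y))
      rw [← hVP, hPV])
  have := h0 (P ∘L x ∘L V)
  rw [show e * x * e = V ∘L (P ∘L x ∘L V) ∘L P from ?_]
  · exact this
  · ext y
    show e (x (e y)) = V (P (x (V (P y))))
    rw [hVP, hVP]

theorem ext_inf (hf : ¬ FiniteDimensional ℂ E) {m : (E →L[ℂ] E) → ℂ} {C : ℝ} (hm : PMeas m C) :
    ∃ φ : (E →L[ℂ] E) →ₗ[ℂ] ℂ, ∀ p, IsStarProjection p → φ p = m p := by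
  obtain ⟨ι, b, hι⟩ := exists_inf_basis hf
  obtain ⟨s1, s2, hc⟩ := exists_cuntz b
  exact glue_main corner_all hm hc (lemZ b) (dich_proj b)
end BdAll

section FinExt
set_option linter.unusedSimpArgs false
set_option linter.unusedSectionVars false
set_option linter.deprecated false
variable {E : Type u} [NormedAddCommGroup E] [InnerProductSpace ℂ E] [CompleteSpace E]
open InnerProductSpace

/-- the quadratic function attached to a measure -/
noncomputable def FF (m : (E →L[ℂ] E) → ℂ) (v : E) : ℂ :=
  ((‖v‖^2 : ℝ) : ℂ) * m ((((‖v‖^2)⁻¹ : ℝ) : ℂ) • rankOne ℂ v v)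

theorem FF_smul (m : (E →L[ℂ] E) → ℂ) (c : ℂ) (v : E) : FF m (c • v) = ((‖c‖^2 : ℝ) : ℂ) * FF m v := by
  by_cases hc : c = 0
  · simp [FF, hc]
  unfold FF
  have : (((‖c • v‖^2)⁻¹ : ℝ) : ℂ) • rankOne ℂ (c • v) (c • v) = (((‖v‖^2)⁻¹ : ℝ) : ℂ) • rankOne ℂ v v := by
    ext x
    simp only [ContinuousLinearMap.smul_apply, rankOne_apply, inner_smul_left, smul_smul, norm_smul]
    congr 1
    have h1 : (‖c‖ : ℂ) ≠ 0 := by simpa using hc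
    have h2 : (starRingEnd ℂ) c * c = (‖c‖ : ℂ)^2 := by rw [mul_comm, Complex.mul_conj, Complex.normSq_eq_norm_sq]; norm_cast
    push_cast
    rw [mul_pow, mul_inv]
    calc _ = ((‖c‖:ℂ)^2)⁻¹ * ((starRingEnd ℂ) c * c) * (((‖v‖:ℂ)^2)⁻¹ * inner ℂ v x) := by ring
      _ = _ := by rw [h2, inv_mul_cancel₀ (by positivity), one_mul]
  rw [this, norm_smul, mul_pow]; push_cast; ring

theorem FF_unit (m : (E →L[ℂ] E) → ℂ) {c : ℂ} (hc : ‖c‖ = 1) (v : E) : FF m (c • v) = FF m v := by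
  rw [FF_smul, hc]; simp

theorem FF_neg (m : (E →L[ℂ] E) → ℂ) (v : E) : FF m (-v) = FF m v := by
  rw [← neg_one_smul ℂ v]; exact FF_unit m (by simp) v

theorem FF_zero (m : (E →L[ℂ] E) → ℂ) : FF m (0:E) = 0 := by simp [FF]

noncomputable def BB (m : (E →L[ℂ] E) → ℂ) (v w : E) : ℂ := FF m (v + w) - FF m (v - w)

theorem BB_neg (m : (E →L[ℂ] E) → ℂ) (v w : E) : BB m v (-w) = - BB m v w := by
  unfold BB; rw [sub_neg_eq_add, ← sub_eq_add_neg]; ring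

/-- complex orthonormal triples -/
def OT (u v w : E) : Prop := ‖u‖ = 1 ∧ ‖v‖ = 1 ∧ ‖w‖ = 1 ∧ inner ℂ u v = 0 ∧ inner ℂ u w = 0 ∧ inner ℂ v w = 0

theorem OT_inner {u v w : E} (h : OT u v w) : ∀ i j : Fin 3, inner ℂ ((![u, v, w] : Fin 3 → E) i) ((![u, v, w] : Fin 3 → E) j) = if i = j then (1:ℂ) else 0 := by
  obtain ⟨h1, h2, h3, h4, h5, h6⟩ := h
  intro i j
  fin_cases i <;> fin_cases j <;> simp [h1, h2, h3, h4, h5, h6, inner_self_eq_norm_sq_to_K, inner_eq_zero_symm.1 h4, inner_eq_zero_symm.1 h5, inner_eq_zero_symm.1 h6]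

theorem ofin1 {x : E} (hx : ‖x‖ = 1) : inner ℂ x x = (1:ℂ) := by
  rw [inner_self_eq_norm_sq_to_K, hx]; simp

theorem nsq_of_inner {x : E} {r : ℝ} (hx : inner ℂ x x = (r:ℂ)) : ‖x‖^2 = r := by
  rw [inner_self_eq_norm_sq_to_K] at hx
  exact Complex.ofReal_injective (by push_cast; exact hx)

theorem FG {m : (E →L[ℂ] E) → ℂ} {C : ℝ} (hm : PMeas m C) {u v w : E} (h : OT u v w) (x y z : ℝ) :
    FF m ((x:ℂ) • u + (y:ℂ) • v + (z:ℂ) • w) = x^2 * FF m u + y^2 * FF m v + z^2 * FF m w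
      + x * y / 2 * BB m u v + x * z / 2 * BB m u w + y * z / 2 * BB m v w := by
  set e : Fin 3 → Fin 3 → (E →L[ℂ] E) := fun i j => rankOne ℂ ((![u, v, w] : Fin 3 → E) i) ((![u, v, w] : Fin 3 → E) j) with he
  have hI := OT_inner h
  have hMU : MU3 e := by
    refine ⟨fun i j => ?_, fun i j k l => ?_⟩
    · rw [he, ContinuousLinearMap.star_eq_adjoint]; simp [adjoint_rankOne]
    · rw [he]
      show rankOne ℂ _ _ ∘L rankOne ℂ _ _ = _
      rw [rankOne_comp_rankOne, hI]
      split_ifs with hh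
      · rw [one_smul]
      · rw [zero_smul]
  have key : ∀ x y z : ℝ, FF m ((x:ℂ) • u + (y:ℂ) • v + (z:ℂ) • w) = ((x^2+y^2+z^2 : ℝ) : ℂ) * m (MM e (rk x y z)) := by
    intro x y z
    have hn : ‖(x:ℂ) • u + (y:ℂ) • v + (z:ℂ) • w‖^2 = x^2+y^2+z^2 := by
      have h0 : inner ℂ ((x:ℂ) • u + (y:ℂ) • v + (z:ℂ) • w) ((x:ℂ) • u + (y:ℂ) • v + (z:ℂ) • w) = ((x^2+y^2+z^2 : ℝ) : ℂ) := by
        obtain ⟨h1, h2, h3, h4, h5, h6⟩ := h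
        simp only [inner_add_left, inner_add_right, inner_smul_left, inner_smul_right, h4, h5, h6, inner_eq_zero_symm.1 h4,
          inner_eq_zero_symm.1 h5, inner_eq_zero_symm.1 h6, ofin1 h1, ofin1 h2, ofin1 h3, Complex.conj_ofReal]
        push_cast; ring
      exact nsq_of_inner h0
    unfold FF
    rw [hn]
    congr 2
    ext t
    simp only [MM, Fin.sum_univ_three, ContinuousLinearMap.smul_apply, ContinuousLinearMap.add_apply, rankOne_apply, he,
      inner_add_left, inner_smul_left, rk, Complex.conj_ofReal, ← Complex.coe_smul]
    simp
    module
  have g := frame_gleason hMU hm x y z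
  have k1 := key 1 0 0
  have k2 := key 0 1 0
  have k3 := key 0 0 1
  have k4 := key 1 1 0
  have k5 := key 1 0 1
  have k6 := key 0 1 1
  have k7 := key 1 (-1) 0
  have k8 := key 1 0 (-1)
  have k9 := key 0 1 (-1)
  norm_num at k1 k2 k3 k4 k5 k6 k7 k8 k9
  rw [key, g, ← k1, ← k2, ← k3]
  unfold BB
  rw [sub_eq_add_neg u v, sub_eq_add_neg u w, sub_eq_add_neg v w, k4, k5, k6, k7, k8, k9]
  ring

theorem BB_lin {m : (E →L[ℂ] E) → ℂ} {C : ℝ} (hm : PMeas m C) {u v w : E} (h : OT u v w) (y z : ℝ) :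
    BB m u ((y:ℂ) • v + (z:ℂ) • w) = y * BB m u v + z * BB m u w := by
  have h1 := FG hm h 1 y z
  have h2 := FG hm h 1 (-y) (-z)
  unfold BB
  rw [show u + ((y:ℂ) • v + (z:ℂ) • w) = ((1:ℝ):ℂ) • u + (y:ℂ) • v + (z:ℂ) • w by push_cast; module,
    show u - ((y:ℂ) • v + (z:ℂ) • w) = ((1:ℝ):ℂ) • u + ((-y:ℝ):ℂ) • v + ((-z:ℝ):ℂ) • w by push_cast; module, h1, h2]
  push_cast
  unfold BB
  ring

theorem OT.ph {u v w : E} (h : OT u v w) {c d : ℂ} (hc : ‖c‖ = 1) (hd : ‖d‖ = 1) : OT u (c • v) (d • w) := by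
  obtain ⟨h1, h2, h3, h4, h5, h6⟩ := h
  refine ⟨h1, by simp [norm_smul, *], by simp [norm_smul, *], ?_, ?_, ?_⟩ <;>
    simp [inner_smul_left, inner_smul_right, h4, h5, h6]

theorem OT.rot {u v w : E} (h : OT u v w) {c : ℂ} (hc : ‖c‖ = 1) :
    OT u ((r2:ℂ) • (c • v) + (r2:ℂ) • ((-Complex.I * c) • w))
      ((r2:ℂ) • ((starRingEnd ℂ) c • v) + (r2:ℂ) • ((Complex.I * (starRingEnd ℂ) c) • w)) := by
  obtain ⟨h1, h2, h3, h4, h5, h6⟩ := h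
  have hr : (r2:ℂ) * r2 + r2 * r2 = 1 := by rw [r2_sqC]; norm_num
  have hcc : (starRingEnd ℂ) c * c = 1 := by rw [mul_comm, Complex.mul_conj, Complex.normSq_eq_norm_sq, hc]; simp
  have n1 : ∀ x : E, inner ℂ x x = (1:ℂ) → ‖x‖ = 1 := fun x hx => by
    have : ‖x‖^2 = 1 := nsq_of_inner (by rw [hx]; simp)
    nlinarith [norm_nonneg x]
  refine ⟨h1, n1 _ ?_, n1 _ ?_, ?_, ?_, ?_⟩ <;>
    simp only [inner_add_left, inner_add_right, inner_smul_left, inner_smul_right, h4, h5, h6, inner_eq_zero_symm.1 h4,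
          inner_eq_zero_symm.1 h5, inner_eq_zero_symm.1 h6, ofin1 h1, ofin1 h2, ofin1 h3, Complex.conj_ofReal,
          map_mul, map_neg, Complex.conj_I, Complex.conj_conj]
  · linear_combination hr + (2 * r2 * r2 : ℂ) * hcc - (r2:ℂ)*r2*(starRingEnd ℂ c * c) * Complex.I_sq
  · linear_combination hr + (2 * r2 * r2 : ℂ) * hcc - (r2:ℂ)*r2*(starRingEnd ℂ c * c) * Complex.I_sq
  · simp
  · simp
  · linear_combination (r2:ℂ)*r2*(starRingEnd ℂ c)^2 * Complex.I_sq
end FinExt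

section FinExt2
set_option linter.unusedSimpArgs false
set_option linter.unusedSectionVars false
set_option linter.deprecated false
variable {E : Type u} [NormedAddCommGroup E] [InnerProductSpace ℂ E] [CompleteSpace E]
open InnerProductSpace

theorem cosA {m : (E →L[ℂ] E) → ℂ} {C : ℝ} (hm : PMeas m C) {u v w : E} (h : OT u v w) {c : ℂ} (hc : ‖c‖ = 1) :
    (c.re:ℂ) * BB m u v + c.im * BB m u w = 1/2 * (BB m u (c • v) + BB m u ((-Complex.I * c) • w) +
      BB m u ((starRingEnd ℂ) c • v) + BB m u ((Complex.I * (starRingEnd ℂ) c) • w)) := by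
  have h1 := BB_lin hm (h.rot hc) r2 r2
  have h2 := BB_lin hm (h.ph (c := c) (d := -Complex.I * c) hc (by simp [hc])) r2 r2
  have h3 := BB_lin hm (h.ph (c := (starRingEnd ℂ) c) (d := Complex.I * (starRingEnd ℂ) c) (by simp [hc]) (by simp [hc])) r2 r2
  rw [h2, h3] at h1
  have h4 := BB_lin hm h c.re c.im
  have e : (r2:ℂ) • ((r2:ℂ) • (c • v) + (r2:ℂ) • ((-Complex.I * c) • w)) +
      (r2:ℂ) • ((r2:ℂ) • ((starRingEnd ℂ) c • v) + (r2:ℂ) • ((Complex.I * (starRingEnd ℂ) c) • w)) =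
      (c.re:ℂ) • v + (c.im:ℂ) • w := by
    have e1 : (r2:ℂ) * r2 * (c + starRingEnd ℂ c) = c.re := by
      rw [r2_sqC]; apply Complex.ext <;> simp <;> ring
    have e2 : (r2:ℂ) * r2 * (-Complex.I * c + Complex.I * starRingEnd ℂ c) = c.im := by
      rw [r2_sqC]; apply Complex.ext <;> simp <;> ring
    rw [← e1, ← e2]; module
  rw [e, h4] at h1
  rw [h1]
  linear_combination (BB m u (c • v) + BB m u ((-Complex.I * c) • w) +
      BB m u ((starRingEnd ℂ) c • v) + BB m u ((Complex.I * (starRingEnd ℂ) c) • w)) * r2_sqC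

theorem cosB {m : (E →L[ℂ] E) → ℂ} {C : ℝ} (hm : PMeas m C) {u v w : E} (h : OT u v w) {c : ℂ} (hc : ‖c‖ = 1) :
    2 * (c.re:ℂ) * BB m u v = BB m u (c • v) + BB m u ((starRingEnd ℂ) c • v) := by
  have h1 := cosA hm h hc
  have h' : OT u v (-w) := by simpa using h.ph (c := 1) (d := -1) (by simp) (by simp)
  have h2 := cosA hm h' hc
  rw [smul_neg, smul_neg, BB_neg, BB_neg, BB_neg] at h2
  linear_combination h1 + h2

theorem cosC {m : (E →L[ℂ] E) → ℂ} {C : ℝ} (hm : PMeas m C) {u v w : E} (h : OT u v w) {c : ℂ} (hc : ‖c‖ = 1) :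
    BB m u (c • v) = (c.re:ℂ) * BB m u v + c.im * BB m u (Complex.I • v) := by
  have h1 := cosB hm h hc
  have h' : OT u (Complex.I • v) w := by simpa using h.ph (c := Complex.I) (d := 1) (by simp) (by simp)
  have h2 := cosB hm h' (c := -Complex.I * c) (by simp [hc])
  rw [smul_smul, smul_smul, show -Complex.I * c * Complex.I = c by linear_combination - c * Complex.I_sq,
    show (starRingEnd ℂ) (-Complex.I * c) * Complex.I = - (starRingEnd ℂ) c by
      simp; linear_combination (starRingEnd ℂ) c * Complex.I_sq, neg_smul, BB_neg] at h2
  have e : ((-Complex.I * c).re : ℂ) = c.im := by simp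
  rw [e] at h2
  linear_combination -1/2 * (h1 + h2)

/-- formula on the span of two orthonormal vectors -/
theorem FF2 {m : (E →L[ℂ] E) → ℂ} {C : ℝ} (hm : PMeas m C) {u v w : E} (h : OT u v w) (α β : ℂ) :
    FF m (α • u + β • v) = ((‖α‖^2 : ℝ) : ℂ) * FF m u + ((‖β‖^2 : ℝ) : ℂ) * FF m v +
      1/2 * ((((starRingEnd ℂ) α * β).re : ℂ) * BB m u v + (((starRingEnd ℂ) α * β).im : ℂ) * BB m u (Complex.I • v)) := by
  have ph : ∀ a : ℂ, ∃ c : ℂ, ‖c‖ = 1 ∧ a = (‖a‖:ℂ) * c := fun a => by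
    by_cases ha : a = 0
    · exact ⟨1, by simp, by simp [ha]⟩
    · have : (‖a‖:ℂ) ≠ 0 := by simpa using ha
      exact ⟨a / ‖a‖, by simp [ha], by field_simp⟩
  obtain ⟨c, hc, hα⟩ := ph α
  obtain ⟨d, hd, hβ⟩ := ph β
  have hcc : (starRingEnd ℂ) c * c = 1 := by rw [mul_comm, Complex.mul_conj, Complex.normSq_eq_norm_sq, hc]; simp
  set g := (starRingEnd ℂ) c * d with hg
  have hgn : ‖g‖ = 1 := by simp [hg, hc, hd]
  have e : α • u + β • v = c • (((‖α‖:ℝ):ℂ) • u + ((‖β‖:ℝ):ℂ) • (g • v) + ((0:ℝ):ℂ) • w) := by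
    have : c * g = d := by rw [hg]; linear_combination d * hcc
    conv_lhs => rw [hα, hβ, ← this]
    push_cast; module
  have hw : OT u (g • v) w := by simpa using h.ph (c := g) (d := 1) hgn (by simp)
  rw [e, FF_unit m hc, FG hm hw, FF_unit m hgn, cosC hm h hgn]
  have e2 : (starRingEnd ℂ) α * β = ((‖α‖ * ‖β‖ : ℝ) : ℂ) * g := by
    conv_lhs => rw [hα, hβ]
    rw [map_mul, Complex.conj_ofReal, hg]; push_cast; ring
  rw [e2, Complex.re_ofReal_mul, Complex.im_ofReal_mul]
  push_cast
  ring

/-- abstract quadratic-form property -/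
structure QF (F : E → ℂ) : Prop where
  sm : ∀ (c : ℂ) (v : E), F (c • v) = ((‖c‖^2 : ℝ) : ℂ) * F v
  par : ∀ v w, F (v + w) + F (v - w) = 2 * F v + 2 * F w
  hom : ∀ (t : ℝ) (v w : E), F (v + (t:ℂ) • w) - F (v - (t:ℂ) • w) = t * (F (v + w) - F (v - w))

theorem QF_of_span {m : (E →L[ℂ] E) → ℂ} {C : ℝ} (hm : PMeas m C)
    (h : ∀ v w : E, ∃ a b c, OT a b c ∧ v ∈ Submodule.span ℂ {a, b} ∧ w ∈ Submodule.span ℂ {a, b}) : QF (FF m) := by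
  refine ⟨FF_smul m, fun v w => ?_, fun t v w => ?_⟩
  all_goals
    obtain ⟨a, b, c, hO, hv, hw⟩ := h v w
    obtain ⟨α, β, rfl⟩ := Submodule.mem_span_pair.1 hv
    obtain ⟨γ, δ, rfl⟩ := Submodule.mem_span_pair.1 hw
  · rw [show α • a + β • b + (γ • a + δ • b) = (α + γ) • a + (β + δ) • b by module,
      show α • a + β • b - (γ • a + δ • b) = (α - γ) • a + (β - δ) • b by module]
    simp only [FF2 hm hO, ← Complex.normSq_eq_norm_sq, Complex.normSq_apply]
    simp
    ring
  · rw [show α • a + β • b + (t:ℂ) • (γ • a + δ • b) = (α + t * γ) • a + (β + t * δ) • b by module,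
      show α • a + β • b - (t:ℂ) • (γ • a + δ • b) = (α - t * γ) • a + (β - t * δ) • b by module,
      show α • a + β • b + (γ • a + δ • b) = (α + γ) • a + (β + δ) • b by module,
      show α • a + β • b - (γ • a + δ • b) = (α - γ) • a + (β - δ) • b by module]
    simp only [FF2 hm hO, ← Complex.normSq_eq_norm_sq, Complex.normSq_apply]
    simp
    ring
end FinExt2

section FinExt3
set_option linter.unusedSimpArgs false
set_option linter.unusedSectionVars false
set_option linter.deprecated false
variable {E : Type u} [NormedAddCommGroup E] [InnerProductSpace ℂ E] [CompleteSpace E]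
open InnerProductSpace

theorem span2 [FiniteDimensional ℂ E] (hf : 3 ≤ Module.finrank ℂ E) (v w : E) :
    ∃ a b c : E, OT a b c ∧ v ∈ Submodule.span ℂ {a, b} ∧ w ∈ Submodule.span ℂ {a, b} := by
  obtain ⟨k, hk⟩ := Nat.exists_eq_add_of_le hf
  have hc : Module.finrank ℂ E = Fintype.card (Fin (k + 3)) := by simp [hk, add_comm]
  let i0 : Fin (k+3) := ⟨0, by omega⟩
  let i1 : Fin (k+3) := ⟨1, by omega⟩
  let i2 : Fin (k+3) := ⟨2, by omega⟩
  let f : Fin (k+3) → E := fun i => if i = i0 then v else if i = i1 then w else 0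
  let b := gramSchmidtOrthonormalBasis hc f
  have h01 : i0 ≠ i1 := by simp [i0, i1]
  have h02 : i0 ≠ i2 := by simp [i0, i2]
  have h12 : i1 ≠ i2 := by simp [i1, i2]
  have f0 : f i0 = v := by simp [f]
  have f1 : f i1 = w := by simp [f, h01.symm]
  have key : ∀ x : E, (∀ j, i1 < j → inner ℂ (b j) x = 0) → x ∈ Submodule.span ℂ {b i0, b i1} := by
    intro x hx
    rw [← b.sum_repr' x]
    refine Submodule.sum_mem _ fun j _ => ?_
    by_cases h : i1 < j
    · rw [hx j h, zero_smul]; exact Submodule.zero_mem _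
    · have : j = i0 ∨ j = i1 := by
        have h' : j.1 ≤ 1 := by simpa [i1, Fin.lt_def] using h
        rcases Nat.le_one_iff_eq_zero_or_eq_one.1 h' with h | h
        · left; exact Fin.ext h
        · right; exact Fin.ext h
      refine Submodule.smul_mem _ _ (Submodule.subset_span ?_)
      rcases this with rfl | rfl <;> simp
  refine ⟨b i0, b i1, b i2, ⟨b.norm_eq_one _, b.norm_eq_one _, b.norm_eq_one _, b.inner_eq_zero h01, b.inner_eq_zero h02, b.inner_eq_zero h12⟩, ?_, ?_⟩
  · refine key v fun j hj => ?_
    rw [← f0]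
    exact gramSchmidtOrthonormalBasis_inv_triangular hc f (lt_trans (by simp [i0, i1, Fin.lt_def]) hj)
  · refine key w fun j hj => ?_
    rw [← f1]
    exact gramSchmidtOrthonormalBasis_inv_triangular hc f hj

noncomputable def B0 (F : E → ℂ) (v w : E) : ℂ := F (v + w) - F (v - w)

namespace QF
variable {F : E → ℂ}

theorem unit (h : QF F) {c : ℂ} (hc : ‖c‖ = 1) (v : E) : F (c • v) = F v := by rw [h.sm, hc]; simp

theorem neg (h : QF F) (v : E) : F (-v) = F v := by
  rw [← neg_one_smul ℂ v]; exact h.unit (by simp) v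

theorem B_symm (h : QF F) (v w : E) : B0 F v w = B0 F w v := by
  unfold B0; rw [add_comm, ← neg_sub w v, h.neg]

theorem B_real (h : QF F) (t : ℝ) (v w : E) : B0 F v ((t:ℂ) • w) = t * B0 F v w := h.hom t v w

theorem B_add (h : QF F) (v w w' : E) : B0 F v (w + w') = B0 F v w + B0 F v w' := by
  have h1 := h.par (v + ((1/2:ℝ):ℂ) • (w + w')) (((1/2:ℝ):ℂ) • (w - w'))
  have h2 := h.par (v - ((1/2:ℝ):ℂ) • (w + w')) (((1/2:ℝ):ℂ) • (w - w'))
  have h3 := h.B_real (1/2) v (w + w')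
  unfold B0 at *
  rw [show v + ((1/2:ℝ):ℂ) • (w + w') + ((1/2:ℝ):ℂ) • (w - w') = v + w by push_cast; module,
    show v + ((1/2:ℝ):ℂ) • (w + w') - ((1/2:ℝ):ℂ) • (w - w') = v + w' by push_cast; module] at h1
  rw [show v - ((1/2:ℝ):ℂ) • (w + w') + ((1/2:ℝ):ℂ) • (w - w') = v - w' by push_cast; module,
    show v - ((1/2:ℝ):ℂ) • (w + w') - ((1/2:ℝ):ℂ) • (w - w') = v - w by push_cast; module] at h2
  push_cast at *
  linear_combination h2 - h1 - 2 * h3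

theorem B_I (h : QF F) (v w : E) : B0 F (Complex.I • v) (Complex.I • w) = B0 F v w := by
  unfold B0; rw [← smul_add, ← smul_sub, h.unit (by simp), h.unit (by simp)]

theorem B_neg (v w : E) : B0 F v (-w) = - B0 F v w := by
  unfold B0; rw [sub_neg_eq_add, ← sub_eq_add_neg]; ring

theorem B_I' (h : QF F) (v w : E) : B0 F (Complex.I • v) w = - B0 F v (Complex.I • w) := by
  rw [← h.B_I v, smul_smul, Complex.I_mul_I, neg_one_smul, B_neg, neg_neg]

theorem B_c (h : QF F) (c : ℂ) (v w : E) : B0 F v (c • w) = c.re * B0 F v w + c.im * B0 F v (Complex.I • w) := by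
  rw [← h.B_real, ← h.B_real, ← h.B_add]
  congr 1
  conv_lhs => rw [← Complex.re_add_im c]
  module

noncomputable def S (F : E → ℂ) (v w : E) : ℂ := 1/4 * (B0 F v w - Complex.I * B0 F v (Complex.I • w))

theorem S_add (h : QF F) (v w w' : E) : S F v (w + w') = S F v w + S F v w' := by
  unfold S; rw [smul_add, h.B_add, h.B_add]; ring

theorem S_smul (h : QF F) (c : ℂ) (v w : E) : S F v (c • w) = c * S F v w := by
  unfold S
  rw [smul_comm, h.B_c c v w, h.B_c c v (Complex.I • w), smul_smul Complex.I Complex.I w, Complex.I_mul_I, neg_one_smul, B_neg]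
  conv_rhs => rw [← Complex.re_add_im c]
  linear_combination (1/4 * c.im * B0 F v (Complex.I • w)) * Complex.I_sq

theorem S_add' (h : QF F) (v v' w : E) : S F (v + v') w = S F v w + S F v' w := by
  unfold S
  rw [h.B_symm _ w, h.B_symm _ (Complex.I • w), h.B_add, h.B_add, h.B_symm v, h.B_symm v', h.B_symm v, h.B_symm v']; ring

theorem S_smul' (h : QF F) (c : ℂ) (v w : E) : S F (c • v) w = (starRingEnd ℂ) c * S F v w := by
  unfold S
  rw [h.B_symm _ w, h.B_symm _ (Complex.I • w), h.B_c c w v, h.B_c c (Complex.I • w) v, h.B_I, h.B_symm w, h.B_symm w (Complex.I • v), h.B_I',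
    h.B_symm (Complex.I • w) v]
  have : (starRingEnd ℂ) c = c.re - c.im * Complex.I := by apply Complex.ext <;> simp
  rw [this]
  linear_combination (-1/4 * c.im * B0 F v (Complex.I • w)) * Complex.I_sq

theorem S_self (h : QF F) (v : E) : S F v v = F v := by
  unfold S B0
  rw [show v + v = (2:ℂ) • v by module, show v - v = (0:ℂ) • v by module,
    show v + Complex.I • v = (1 + Complex.I) • v by module, show v - Complex.I • v = (1 - Complex.I) • v by module,
    h.sm, h.sm, h.sm (1 + _), h.sm (1 - _)]
  simp only [← Complex.normSq_eq_norm_sq, Complex.normSq_apply]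
  simp
  ring

noncomputable def L1 (h : QF F) (v : E) : E →ₗ[ℂ] ℂ where
  toFun := S F v
  map_add' := h.S_add v
  map_smul' c w := h.S_smul c v w

noncomputable def L2 (h : QF F) (w : E) : E →ₛₗ[starRingEnd ℂ] ℂ where
  toFun v := S F v w
  map_add' v v' := h.S_add' v v' w
  map_smul' c v := h.S_smul' c v w

theorem exists_phi [FiniteDimensional ℂ E] (h : QF F) : ∃ φ : (E →L[ℂ] E) →ₗ[ℂ] ℂ, ∀ w, φ (rankOne ℂ w w) = F w := by
  let b := stdOrthonormalBasis ℂ E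
  let φ : (E →L[ℂ] E) →ₗ[ℂ] ℂ :=
    { toFun := fun T => ∑ i, h.L1 (b i) (T (b i))
      map_add' := fun T T' => by simp [Finset.sum_add_distrib]
      map_smul' := fun c T => by simp [Finset.mul_sum] }
  refine ⟨φ, fun w => ?_⟩
  show ∑ i, h.L1 (b i) (rankOne ℂ w w (b i)) = F w
  have h1 : F w = h.L2 w w := (h.S_self w).symm
  conv_rhs => rw [h1, ← b.sum_repr' w]
  conv_rhs => arg 1; rw [b.sum_repr' w]
  rw [map_sum]
  refine Finset.sum_congr rfl fun i _ => ?_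
  rw [LinearMap.map_smulₛₗ, inner_conj_symm, rankOne_apply, map_smul]
  rfl
end QF

theorem PMeas.zero {m : (E →L[ℂ] E) → ℂ} {C : ℝ} (hm : PMeas m C) : m 0 = 0 := by
  have := hm.add 0 0 (IsStarProjection.zero _) (IsStarProjection.zero _) (by simp)
  simpa using this

theorem proj_sum {ι : Type*} [Fintype ι] [DecidableEq ι] {m : (E →L[ℂ] E) → ℂ} {C : ℝ} (hm : PMeas m C) {v : ι → E} (hv : Orthonormal ℂ v)
    (s : Finset ι) : IsStarProjection (∑ i ∈ s, rankOne ℂ (v i) (v i)) ∧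
      m (∑ i ∈ s, rankOne ℂ (v i) (v i)) = ∑ i ∈ s, FF m (v i) := by
  induction s using Finset.induction_on with
  | empty => exact ⟨by simp, by simpa using hm.zero⟩
  | insert a s ha ih =>
    have h1 : IsStarProjection (rankOne ℂ (v a) (v a)) := by
      refine ⟨?_, ?_⟩
      · show rankOne ℂ _ _ ∘L rankOne ℂ _ _ = _
        rw [rankOne_comp_rankOne, ofin1 (hv.1 a), one_smul]
      · show star _ = _
        rw [ContinuousLinearMap.star_eq_adjoint, adjoint_rankOne]
    have h2 : rankOne ℂ (v a) (v a) * (∑ i ∈ s, rankOne ℂ (v i) (v i)) = 0 := by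
      rw [Finset.mul_sum]
      refine Finset.sum_eq_zero fun i hi => ?_
      show rankOne ℂ _ _ ∘L rankOne ℂ _ _ = _
      rw [rankOne_comp_rankOne, hv.2 (show a ≠ i from fun hh => ha (by rw [hh]; exact hi)), zero_smul]
    rw [Finset.sum_insert ha, Finset.sum_insert ha, hm.add _ _ h1 ih.1 h2, ih.2]
    refine ⟨h1.add ih.1 h2, ?_⟩
    congr 1
    unfold FF; rw [hv.1 a]; simp

theorem proj_eq_sum [FiniteDimensional ℂ E] {p : E →L[ℂ] E} (hp : IsStarProjection p) :
    ∃ (n : ℕ) (v : Fin n → E), Orthonormal ℂ v ∧ p = ∑ i, rankOne ℂ (v i) (v i) := by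
  obtain ⟨K, hKp, hK⟩ := isStarProjection_iff_eq_starProjection.1 hp
  let b := stdOrthonormalBasis ℂ K
  refine ⟨_, fun i => (b i : E), b.orthonormal.comp_linearIsometry K.subtypeₗᵢ, ?_⟩
  rw [hK]
  exact b.starProjection_eq_sum_rankOne

theorem ext_fin [FiniteDimensional ℂ E] (hf : 3 ≤ Module.finrank ℂ E) {m : (E →L[ℂ] E) → ℂ} {C : ℝ} (hm : PMeas m C) :
    ∃ φ : (E →L[ℂ] E) →ₗ[ℂ] ℂ, ∀ p, IsStarProjection p → φ p = m p := by
  obtain ⟨φ, hφ⟩ := (QF_of_span hm (span2 hf)).exists_phi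
  refine ⟨φ, fun p hp => ?_⟩
  obtain ⟨n, v, hv, rfl⟩ := proj_eq_sum hp
  rw [(proj_sum hm hv Finset.univ).2, map_sum]
  exact Finset.sum_congr rfl fun i _ => hφ _

theorem ext_one (hf : Module.finrank ℂ E = 1) {m : (E →L[ℂ] E) → ℂ} {C : ℝ} (hm : PMeas m C) :
    ∃ φ : (E →L[ℂ] E) →ₗ[ℂ] ℂ, ∀ p, IsStarProjection p → φ p = m p := by
  obtain ⟨v, hv, hs⟩ := finrank_eq_one_iff'.1 hf
  let ev : (E →L[ℂ] E) →ₗ[ℂ] ℂ :=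
    { toFun := fun T => m 1 * ((inner ℂ v v)⁻¹ * inner ℂ v (T v))
      map_add' := fun S T => by simp [inner_add_right]; ring
      map_smul' := fun c T => by simp [inner_smul_right]; ring }
  refine ⟨ev, fun p hp => ?_⟩
  have hvv : inner ℂ v v ≠ (0:ℂ) := by simpa using hv
  obtain ⟨c, hc⟩ := hs (p v)
  have hpc : p = c • 1 := by
    ext w
    obtain ⟨d, rfl⟩ := hs w
    rw [map_smul, ← hc]; exact smul_comm _ _ _
  have h2 : c * c = c := by
    have : p (p v) = p v := by conv_rhs => rw [← hp.1]
                               rfl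
    rw [← hc, map_smul, ← hc, smul_smul] at this
    exact smul_left_injective ℂ hv this
  show m 1 * ((inner ℂ v v)⁻¹ * inner ℂ v (p v)) = m p
  rw [← hc, inner_smul_right]
  rcases eq_or_ne c 0 with h | h
  · rw [hpc, h]; simp [hm.zero]
  · have : c = 1 := mul_left_cancel₀ h (by rw [h2, mul_one])
    rw [hpc, this, one_smul, one_mul, inv_mul_cancel₀ hvv, mul_one]

theorem ext_all (hdim : Module.rank ℂ E ≠ 2) {m : (E →L[ℂ] E) → ℂ} {C : ℝ} (hm : PMeas m C) :
    ∃ φ : (E →L[ℂ] E) →ₗ[ℂ] ℂ, ∀ p, IsStarProjection p → φ p = m p := by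
  by_cases hf : FiniteDimensional ℂ E
  · have h2 : Module.finrank ℂ E ≠ 2 := fun h => hdim (by rw [← Module.finrank_eq_rank, h]; rfl)
    rcases Nat.lt_or_ge (Module.finrank ℂ E) 3 with h | h
    · rcases Nat.eq_zero_or_pos (Module.finrank ℂ E) with h0 | h0
      · have := Module.finrank_zero_iff.1 h0
        refine ⟨0, fun p _ => ?_⟩
        rw [show p = 0 from ContinuousLinearMap.ext fun x => Subsingleton.elim _ _, hm.zero]; rfl
      · exact ext_one (by omega) hm
    · exact ext_fin h hm
  · exact ext_inf hf hm
end FinExt3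

section Final
set_option linter.unusedSimpArgs false
set_option linter.unusedSectionVars false
set_option linter.deprecated false
variable {E : Type u} [NormedAddCommGroup E] [InnerProductSpace ℂ E] [CompleteSpace E]

theorem lin_eq_of_proj {φ ψ : (E →L[ℂ] E) →ₗ[ℂ] ℂ} (h : ∀ p, IsStarProjection p → φ p = ψ p) : φ = ψ := by
  refine LinearMap.ext fun x => ?_
  have := zero_of_proj (φ - ψ) (fun p hp => by rw [LinearMap.sub_apply, h p hp, sub_self]) x
  rwa [LinearMap.sub_apply, sub_eq_zero] at this

/-- `y ↦ conj (φ (star y))` -/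
noncomputable def cst (φ : (E →L[ℂ] E) →ₗ[ℂ] ℂ) : (E →L[ℂ] E) →ₗ[ℂ] ℂ where
  toFun y := (starRingEnd ℂ) (φ (star y))
  map_add' y z := by rw [star_add, map_add, map_add]
  map_smul' c y := by rw [star_smul, map_smul]; simp

theorem core (hdim : Module.rank ℂ E ≠ 2) {d : (E →L[ℂ] E) → (E →L[ℂ] E) → ℂ} {C : ℝ}
    (hadd : ∀ p₁ p₂ q, IsStarProjection p₁ → IsStarProjection p₂ → IsStarProjection q →
      p₁ * p₂ = 0 → d (p₁ + p₂) q = d p₁ q + d p₂ q)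
    (hherm : ∀ p q, IsStarProjection p → IsStarProjection q → d p q = starRingEnd ℂ (d q p))
    (hbd : ∀ p q, IsStarProjection p → IsStarProjection q → ‖d p q‖ ≤ C) :
    ∃ Q : (E →L[ℂ] E) →ₗ[ℂ] ((E →L[ℂ] E) →ₛₗ[starRingEnd ℂ] ℂ),
      (∃ K : ℝ, ∀ x y : E →L[ℂ] E, ‖Q x y‖ ≤ K * ‖x‖ * ‖y‖) ∧
      (∀ x y : E →L[ℂ] E, Q x y = starRingEnd ℂ (Q y x)) ∧
      ∀ p q, IsStarProjection p → IsStarProjection q → Q p q = d p q := by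
  obtain ⟨K, hK0, hK⟩ := bd_all E
  have h1 : ∀ q, IsStarProjection q → ∃ φ : (E →L[ℂ] E) →ₗ[ℂ] ℂ, ∀ p, IsStarProjection p → φ p = d p q := fun q hq =>
    ext_all hdim (m := fun p => d p q) (C := C) ⟨fun p₁ p₂ a b c => hadd p₁ p₂ q a b hq c, fun p hp => hbd p q hp hq⟩
  choose! φ hφ using h1
  have hbφ : ∀ q, IsStarProjection q → ∀ x, ‖φ q x‖ ≤ K * C * ‖x‖ := fun q hq x =>
    hK (φ q) C (fun p hp => by rw [hφ q hq p hp]; exact hbd p q hp hq) x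
  have h2 : ∀ x, ∃ ψ : (E →L[ℂ] E) →ₗ[ℂ] ℂ, ∀ q, IsStarProjection q → ψ q = φ q x := fun x => by
    refine ext_all hdim (m := fun q => φ q x) (C := K * C * ‖x‖) ⟨fun q r hq hr hqr => ?_, fun q hq => hbφ q hq x⟩
    have hqr' : IsStarProjection (q + r) := hq.add hr hqr
    have : φ (q + r) = φ q + φ r := lin_eq_of_proj fun p hp => by
      rw [LinearMap.add_apply, hφ _ hqr' p hp, hφ q hq p hp, hφ r hr p hp, hherm p _ hp hqr', hadd q r p hq hr hp hqr,
        map_add, ← hherm p q hp hq, ← hherm p r hp hr]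
    rw [this]; rfl
  choose ψ hψ using h2
  have hadd' : ∀ x x', ψ (x + x') = ψ x + ψ x' := fun x x' => lin_eq_of_proj fun q hq => by
    rw [LinearMap.add_apply, hψ _ q hq, hψ _ q hq, hψ _ q hq, map_add]
  have hsm' : ∀ (c : ℂ) x, ψ (c • x) = c • ψ x := fun c x => lin_eq_of_proj fun q hq => by
    rw [LinearMap.smul_apply, hψ _ q hq, hψ _ q hq, map_smul]
  have hp1 : ∀ p, IsStarProjection p → ψ p = cst (φ p) := fun p hp => lin_eq_of_proj fun q hq => by
    rw [hψ p q hq, hφ q hq p hp]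
    show _ = (starRingEnd ℂ) (φ p (star q))
    rw [hq.2.star_eq, hφ p hp q hq]; exact hherm p q hp hq
  let Q : (E →L[ℂ] E) →ₗ[ℂ] ((E →L[ℂ] E) →ₛₗ[starRingEnd ℂ] ℂ) :=
    { toFun := fun x =>
        { toFun := fun y => ψ x (star y)
          map_add' := fun y z => by rw [star_add, map_add]
          map_smul' := fun c y => by rw [star_smul, map_smul]; rfl }
      map_add' := fun x x' => by ext y; show ψ (x + x') (star y) = _; rw [hadd']; rfl
      map_smul' := fun c x => by ext y; show ψ (c • x) (star y) = _; rw [hsm']; rfl }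
  have hQ : ∀ x y, Q x y = ψ x (star y) := fun _ _ => rfl
  refine ⟨Q, ⟨K * (K * C), fun x y => ?_⟩, fun x y => ?_, fun p q hp hq => ?_⟩
  · rw [hQ]
    have := hK (ψ x) (K * C * ‖x‖) (fun q hq => by rw [hψ x q hq]; exact hbφ q hq x) (star y)
    rw [norm_star] at this
    calc _ ≤ _ := this
      _ = _ := by ring
  · let L : (E →L[ℂ] E) →ₗ[ℂ] ℂ :=
      { toFun := fun x => ψ x (star y)
        map_add' := fun x x' => by rw [hadd']; rfl
        map_smul' := fun c x => by rw [hsm']; rfl }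
    have : L = cst (ψ y) := lin_eq_of_proj fun p hp => by
      show ψ p (star y) = (starRingEnd ℂ) (ψ y (star p))
      rw [hp1 p hp, hp.2.star_eq, hψ y p hp]
      show (starRingEnd ℂ) (φ p (star (star y))) = _
      rw [star_star]
    exact LinearMap.congr_fun this x
  · rw [hQ, hq.2.star_eq, hψ p q hq, hφ q hq p hp]

theorem form_unique {Q Q' : (E →L[ℂ] E) →ₗ[ℂ] ((E →L[ℂ] E) →ₛₗ[starRingEnd ℂ] ℂ)}
    (h : ∀ p q, IsStarProjection p → IsStarProjection q → Q p q = Q' p q) : Q = Q' := by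
  let L : ((E →L[ℂ] E) →ₗ[ℂ] ((E →L[ℂ] E) →ₛₗ[starRingEnd ℂ] ℂ)) → (E →L[ℂ] E) → (E →L[ℂ] E) →ₗ[ℂ] ℂ := fun Q y =>
    { toFun := fun x => Q x y
      map_add' := fun x x' => by rw [map_add]; rfl
      map_smul' := fun c x => by rw [map_smul]; rfl }
  let R : ((E →L[ℂ] E) →ₗ[ℂ] ((E →L[ℂ] E) →ₛₗ[starRingEnd ℂ] ℂ)) → (E →L[ℂ] E) → (E →L[ℂ] E) →ₗ[ℂ] ℂ := fun Q x =>
    { toFun := fun y => Q x (star y)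
      map_add' := fun y z => by rw [star_add, map_add]
      map_smul' := fun c y => by rw [star_smul, LinearMap.map_smulₛₗ]; simp }
  have h1 : ∀ q, IsStarProjection q → L Q q = L Q' q := fun q hq => lin_eq_of_proj fun p hp => h p q hp hq
  have h2 : ∀ x, R Q x = R Q' x := fun x => lin_eq_of_proj fun q hq => by
    show Q x (star q) = Q' x (star q)
    rw [hq.2.star_eq]; exact LinearMap.congr_fun (h1 q hq) x
  refine LinearMap.ext fun x => LinearMap.ext fun y => ?_
  have := LinearMap.congr_fun (h2 x) (star y)
  change Q x (star (star y)) = Q' x (star (star y)) at this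
  rwa [star_star] at this
end Final

/-- On a Hilbert space of dimension `≠ 2`, bounded decoherence
functionals are in one-to-one correspondence with bounded Hermitian
sesquilinear forms `Q` on `B(𝔥)` with `Q(1,1) = 1` and `Q(p,p) ≥ 0` for all
projections `p`, the correspondence being determined by agreement on pairs of
projections (i.e. `Q = D(·, ·*)` for the bounded bilinear extension `D` of `d`). -/
theorem stmt_1 (hdim : Module.rank ℂ E ≠ 2) :
    (∀ d : (E →L[ℂ] E) → (E →L[ℂ] E) → ℂ, IsDecoherenceFunctional d → DFBounded d →
      ∃ Q, IsGoodForm Q ∧ ∀ p q, IsOrthoProj p → IsOrthoProj q → Q p q = d p q) ∧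
    (∀ Q, IsGoodForm Q →
      ∃ d : (E →L[ℂ] E) → (E →L[ℂ] E) → ℂ, IsDecoherenceFunctional d ∧ DFBounded d ∧
        ∀ p q, IsOrthoProj p → IsOrthoProj q → Q p q = d p q) ∧
    (∀ (d : (E →L[ℂ] E) → (E →L[ℂ] E) → ℂ) Q Q',
      IsDecoherenceFunctional d → DFBounded d → IsGoodForm Q → IsGoodForm Q' →
      (∀ p q, IsOrthoProj p → IsOrthoProj q → Q p q = d p q) →
      (∀ p q, IsOrthoProj p → IsOrthoProj q → Q' p q = d p q) → Q = Q') ∧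
    (∀ (d d' : (E →L[ℂ] E) → (E →L[ℂ] E) → ℂ) Q,
      IsDecoherenceFunctional d → DFBounded d →
      IsDecoherenceFunctional d' → DFBounded d' → IsGoodForm Q →
      (∀ p q, IsOrthoProj p → IsOrthoProj q → Q p q = d p q) →
      (∀ p q, IsOrthoProj p → IsOrthoProj q → Q p q = d' p q) →
      ∀ p q, IsOrthoProj p → IsOrthoProj q → d p q = d' p q) := by
  refine ⟨fun d hd hb => ?_, fun Q hQ => ?_, fun d Q Q' _ _ _ _ h h' => ?_, fun d d' Q _ _ _ _ _ h h' p q hp hq => ?_⟩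
  · obtain ⟨C, hC⟩ := hb
    have o : ∀ p : E →L[ℂ] E, IsStarProjection p → IsOrthoProj p := fun p hp => ⟨hp.1, hp.2⟩
    obtain ⟨Q, hK, hH, hQ⟩ := core hdim (d := d) (C := C)
      (fun p₁ p₂ q a b c e => hd.orthoadd p₁ p₂ q (o _ a) (o _ b) (o _ c) e)
      (fun p q a b => hd.hermitian p q (o _ a) (o _ b)) (fun p q a b => hC p q (o _ a) (o _ b))
    have hQ' : ∀ p q, IsOrthoProj p → IsOrthoProj q → Q p q = d p q := fun p q a b => hQ p q ⟨a.1, a.2⟩ ⟨b.1, b.2⟩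
    have one : IsOrthoProj (1 : E →L[ℂ] E) := ⟨IsIdempotentElem.one, IsSelfAdjoint.one _⟩
    exact ⟨Q, ⟨hK, hH, by rw [hQ' 1 1 one one, hd.normalized], fun p hp => by rw [hQ' p p hp hp]; exact hd.pos p hp⟩, hQ'⟩
  · obtain ⟨⟨K, hK⟩, hH, h1, hpos⟩ := hQ
    refine ⟨fun x y => Q x y, ⟨fun p q _ _ => hH p q, hpos, h1, fun p₁ p₂ q _ _ _ _ => ?_⟩, ⟨|K|, fun p q hp hq => ?_⟩,
      fun _ _ _ _ => rfl⟩
    · show Q (p₁ + p₂) q = _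
      rw [map_add]; rfl
    · have n : ∀ p : E →L[ℂ] E, IsOrthoProj p → ‖p‖ ≤ 1 := fun p hp => IsStarProjection.norm_le p ⟨hp.1, hp.2⟩
      calc ‖Q p q‖ ≤ K * ‖p‖ * ‖q‖ := hK p q
        _ ≤ |K| * 1 * 1 := by
          gcongr
          · exact le_abs_self K
          · exact n p hp
          · exact n q hq
        _ = |K| := by ring
  · exact form_unique fun p q hp hq => (h p q ⟨hp.1, hp.2⟩ ⟨hq.1, hq.2⟩).trans (h' p q ⟨hp.1, hp.2⟩ ⟨hq.1, hq.2⟩).symm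
  · exact (h p q hp hq).symm.trans (h' p q hp hq)
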